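/- There exist constants c > 0, C > 0 and x₀ ≥ 3 such that for all real x ≥ x₀, |π(x) − li(x)| ≤ C · x · exp(−c · (log x)^{3/5} · (log log x)^{-1/5}). -/

import Mathlib

open Finset Filter Real

/-- The prime counting function `π(x)`, the number of primes `p ≤ x`, as a real number. -/
noncomputable def primePi (x : ℝ) : ℝ :=
  (((Finset.Iic ⌊x⌋₊).filter Nat.Prime).card : ℝ)

/-- The logarithmic integral `li(x) = ∫_2^x dt / log t`. -/
noncomputable def li (x : ℝ) : ℝ := ∫ t in (2:ℝ)..x, 1 / Real.log t

namespace VK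
open MeasureTheory ComplexConjugate

/-- normalized measure on the torus -/
noncomputable def tm (k : ℕ) : Measure (UnitAddTorus (Fin k)) :=
  Measure.pi fun _ => (AddCircle.haarAddCircle : Measure (AddCircle (1 : ℝ)))

instance tm_prob (k : ℕ) : IsProbabilityMeasure (tm k) := by unfold tm; infer_instance

/-- integral of a character on the torus -/
lemma int_e {k : ℕ} (v : Fin k → ℤ) :
    ∫ w : UnitAddTorus (Fin k), UnitAddTorus.mFourier v w ∂(tm k) = if v = 0 then 1 else 0 := by
  split_ifs with h
  · simp [h, UnitAddTorus.mFourier_zero]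
  · rw [UnitAddTorus.mFourier, ContinuousMap.coe_mk, tm, MeasureTheory.integral_fintype_prod_eq_prod]
    obtain ⟨i, hi⟩ := Function.ne_iff.mp h
    apply Finset.prod_eq_zero (mem_univ i)
    have := (orthonormal_iff_ite.mp <| (orthonormal_fourier (T := 1))) 0 (v i)
    rw [ContinuousMap.inner_toLp, if_neg (show (0:ℤ) ≠ v i from Ne.symm hi)] at this
    simpa using this

/-- generating function of a finite family of frequency vectors -/
noncomputable def F {k : ℕ} {ι : Type*} (S : Finset ι) (φ : ι → (Fin k → ℤ))
    (w : UnitAddTorus (Fin k)) : ℂ := ∑ a ∈ S, UnitAddTorus.mFourier (φ a) w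

lemma F_cont {k : ℕ} {ι : Type*} (S : Finset ι) (φ : ι → (Fin k → ℤ)) : Continuous (F S φ) := by
  unfold F; fun_prop

lemma cint {k : ℕ} {E : Type*} [NormedAddCommGroup E] {f : UnitAddTorus (Fin k) → E} (h : Continuous f) :
    Integrable f (tm k) := by
  have := h.continuousOn.integrableOn_compact (μ := tm k) (isCompact_univ)
  simpa using this

lemma int_F {k : ℕ} {ι κ : Type*} (S : Finset ι) (φ : ι → (Fin k → ℤ))
    (T : Finset κ) (ψ : κ → (Fin k → ℤ)) :
    ∫ w, F S φ w * conj (F T ψ w) ∂(tm k) = (((S ×ˢ T).filter (fun q => φ q.1 = ψ q.2)).card : ℂ) := by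
  have : ∀ w, F S φ w * conj (F T ψ w)
      = ∑ q ∈ S ×ˢ T, UnitAddTorus.mFourier (φ q.1 - ψ q.2) w := by
    intro w
    simp only [F, map_sum, sum_mul_sum, sum_product, sub_eq_add_neg,
      UnitAddTorus.mFourier_add, UnitAddTorus.mFourier_neg]
  simp_rw [this]
  rw [integral_finsetSum _ (fun q _ => cint (by fun_prop))]
  simp_rw [int_e, sub_eq_zero]
  simp

lemma int_F_sq {k : ℕ} {ι : Type*} (S : Finset ι) (φ : ι → (Fin k → ℤ)) :
    ∫ w, ‖F S φ w‖ ^ 2 ∂(tm k) = (((S ×ˢ S).filter (fun q => φ q.1 = φ q.2)).card : ℝ) := by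
  have h := int_F S φ S φ
  simp_rw [Complex.mul_conj, Complex.normSq_eq_norm_sq] at h
  have h2 : ((∫ w, ‖F S φ w‖ ^ 2 ∂(tm k) : ℝ) : ℂ) = _ := (integral_ofReal (𝕜 := ℂ)).symm.trans h
  exact_mod_cast h2

/-- moment vector -/
def mo (k : ℕ) (x : ℤ) : Fin k → ℤ := fun j => x ^ (j.val + 1)

/-- tuples with entries in `A` -/
abbrev tup (s : ℕ) (A : Finset ℤ) : Finset (Fin s → ℤ) := Fintype.piFinset fun _ => A

/-- summed moments -/
def ms (k : ℕ) {ι : Type*} [Fintype ι] (x : ι → ℤ) : Fin k → ℤ := ∑ i, mo k (x i)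

lemma ms_apply (k : ℕ) {ι : Type*} [Fintype ι] (x : ι → ℤ) (j : Fin k) :
    ms k x j = ∑ i, x i ^ (j.val + 1) := by simp [ms, mo]

lemma e_sum {k : ℕ} {ι : Type*} (s : Finset ι) (v : ι → Fin k → ℤ) (w : UnitAddTorus (Fin k)) :
    UnitAddTorus.mFourier (∑ i ∈ s, v i) w = ∏ i ∈ s, UnitAddTorus.mFourier (v i) w := by
  classical
  induction s using Finset.induction_on with
  | empty => simp [UnitAddTorus.mFourier_zero]
  | insert a s ha ih => rw [sum_insert ha, Finset.prod_insert ha, UnitAddTorus.mFourier_add, ih]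

lemma norm_e {k : ℕ} (v : Fin k → ℤ) (w : UnitAddTorus (Fin k)) :
    ‖UnitAddTorus.mFourier v w‖ = 1 := by
  simp only [UnitAddTorus.mFourier, ContinuousMap.coe_mk, norm_prod]
  exact Finset.prod_eq_one fun i _ => Circle.norm_coe _

lemma F_pow {k : ℕ} (s : ℕ) (A : Finset ℤ) (w : UnitAddTorus (Fin k)) :
    F (tup s A) (ms k) w = F A (mo k) w ^ s := by
  unfold F ms
  simp_rw [e_sum]
  rw [tup, ← Finset.prod_univ_sum (fun _ => A) (fun _ a => UnitAddTorus.mFourier (mo k a) w)]; simp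

/-- Vinogradov's mean value -/
noncomputable def J (s k : ℕ) (A : Finset ℤ) : ℝ :=
  ∫ w : UnitAddTorus (Fin k), ‖F A (mo k) w‖ ^ (2 * s) ∂(tm k)

lemma J_eq (s k : ℕ) (A : Finset ℤ) : J s k A =
    (((tup s A ×ˢ tup s A).filter (fun q => ms k q.1 = ms k q.2)).card : ℝ) := by
  rw [← int_F_sq]
  simp_rw [F_pow, J, norm_pow, ← pow_mul, mul_comm]

lemma J_mono (s k : ℕ) {A B : Finset ℤ} (h : A ⊆ B) : J s k A ≤ J s k B := by
  rw [J_eq, J_eq]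
  have : tup s A ⊆ tup s B := Fintype.piFinset_subset _ _ fun _ => h
  exact_mod_cast Finset.card_le_card (Finset.filter_subset_filter _ (Finset.product_subset_product this this))

lemma J_nonneg (s k : ℕ) (A : Finset ℤ) : 0 ≤ J s k A := by rw [J_eq]; positivity

lemma J_triv (s k : ℕ) (A : Finset ℤ) : J s k A ≤ (A.card : ℝ) ^ (2 * s) := by
  rw [J_eq]
  have : (#((tup s A ×ˢ tup s A).filter (fun q => ms k q.1 = ms k q.2))) ≤ A.card ^ (2 * s) := by
    refine (Finset.card_filter_le _ _).trans (le_of_eq ?_)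
    simp [Finset.card_product, two_mul, pow_add]
  exact_mod_cast this

/-- twisted mean values are dominated -/
lemma J_twist (s k : ℕ) (A : Finset ℤ) (v : Fin k → ℤ) :
    ((((tup s A ×ˢ tup s A).filter (fun q => ms k q.1 = v + ms k q.2)).card : ℕ) : ℝ) ≤ J s k A := by
  have h := int_F (tup s A) (ms k) (tup s A) (fun x => v + ms k x)
  have h2 : ‖∫ w, F (tup s A) (ms k) w * conj (F (tup s A) (fun x => v + ms k x) w) ∂(tm k)‖ ≤ J s k A := by
    refine (norm_integral_le_integral_norm _).trans (le_of_eq ?_)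
    refine integral_congr_ae (Eventually.of_forall fun w => ?_)
    have : F (tup s A) (fun x => v + ms k x) w = UnitAddTorus.mFourier v w * F (tup s A) (ms k) w := by
      simp [F, UnitAddTorus.mFourier_add, mul_sum]
    simp only [this, norm_mul, RCLike.norm_conj, norm_e, F_pow, norm_pow]
    ring
  rw [h] at h2
  simpa using h2

lemma ms_shift {k : ℕ} {ι : Type*} [Fintype ι] (x y : ι → ℤ) (c : ℤ)
    (h : ms k x = ms k y) : ms k (fun i => x i + c) = ms k (fun i => y i + c) := by
  have h' : ∀ j ≤ k, ∑ i, x i ^ j = ∑ i, y i ^ j := by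
    intro j hj
    rcases Nat.eq_zero_or_pos j with rfl | hp
    · simp
    · have := congrFun h ⟨j - 1, by omega⟩
      simpa [ms_apply, Nat.sub_add_cancel hp] using this
  ext j
  simp only [ms_apply, add_pow]
  rw [sum_comm, sum_comm (s := univ)]
  refine sum_congr rfl fun i hi => ?_
  rw [← sum_mul, ← sum_mul, ← sum_mul, ← sum_mul, h' i (by simp at hi; omega)]

lemma ms_affine {k : ℕ} {ι : Type*} [Fintype ι] (x y : ι → ℤ) (p c : ℤ) (hp : p ≠ 0)
    (h : ms k (fun i => p * x i + c) = ms k (fun i => p * y i + c)) : ms k x = ms k y := by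
  have := ms_shift _ _ (-c) h
  ext j
  have h2 := congrFun this j
  simp only [ms_apply, add_neg_cancel_right, mul_pow, ← mul_sum] at h2 ⊢
  exact mul_left_cancel₀ (pow_ne_zero _ hp) h2

lemma J_affine (s k : ℕ) (A B : Finset ℤ) (p c : ℤ) (hp : p ≠ 0)
    (h : ∀ a ∈ A, ∃ b ∈ B, a = p * b + c) : J s k A ≤ J s k B := by
  rw [J_eq, J_eq]
  choose! g hg hg2 using h
  norm_cast
  refine Finset.card_le_card_of_injOn (fun q => (fun i => g (q.1 i), fun i => g (q.2 i))) ?_ ?_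
  · intro q hq
    simp only [Finset.coe_filter, mem_product, Fintype.mem_piFinset, Set.mem_ofPred_eq] at hq ⊢
    refine ⟨⟨fun i => hg _ (hq.1.1 i), fun i => hg _ (hq.1.2 i)⟩, ms_affine _ _ p c hp ?_⟩
    have h1 : (fun i => p * g (q.1 i) + c) = q.1 := funext fun i => (hg2 _ (hq.1.1 i)).symm
    have h2 : (fun i => p * g (q.2 i) + c) = q.2 := funext fun i => (hg2 _ (hq.1.2 i)).symm
    rw [h1, h2, hq.2]
  · intro q hq q' hq' he
    simp only [Finset.coe_filter, mem_product, Fintype.mem_piFinset, Set.mem_ofPred_eq] at hq hq'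
    simp only [Prod.mk.injEq] at he
    ext i
    · rw [hg2 _ (hq.1.1 i), hg2 _ (hq'.1.1 i), congrFun he.1 i]
    · rw [hg2 _ (hq.1.2 i), hg2 _ (hq'.1.2 i), congrFun he.2 i]

lemma newton_unique {R : Type*} [CommRing R] {k : ℕ} (hk : ∀ n : ℕ, 1 ≤ n → n ≤ k → IsUnit (n : R))
    (U W : Fin k → R) (h : ∀ j, 1 ≤ j → j ≤ k → ∑ i, U i ^ j = ∑ i, W i ^ j) (x : R) :
    ∏ i, (x - U i) = ∏ i, (x - W i) := by
  have key : ∀ n ≤ k, MvPolynomial.aeval U (MvPolynomial.esymm (Fin k) R n)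
      = MvPolynomial.aeval W (MvPolynomial.esymm (Fin k) R n) := by
    intro n
    induction n using Nat.strong_induction_on with
    | _ n ih =>
      intro hn
      rcases Nat.eq_zero_or_pos n with rfl | hp
      · simp
      · have e1 := congrArg (MvPolynomial.aeval U) (MvPolynomial.mul_esymm_eq_sum (Fin k) R n)
        have e2 := congrArg (MvPolynomial.aeval W) (MvPolynomial.mul_esymm_eq_sum (Fin k) R n)
        simp only [map_mul, map_natCast, map_pow, map_neg, map_one, map_sum] at e1 e2
        apply (hk n hp hn).mul_left_cancel
        rw [e1, e2]
        congr 1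
        refine sum_congr rfl fun a ha => ?_
        rw [mem_filter] at ha
        have ha1 := Finset.HasAntidiagonal.mem_antidiagonal.mp ha.1
        rw [ih a.1 ha.2 (by omega)]
        congr 1
        simp only [MvPolynomial.psum, map_sum, map_pow, MvPolynomial.aeval_X]
        exact h _ (by omega) (by omega)
  have hm : ∀ V : Fin k → R, ∏ i, (x - V i) = Polynomial.eval x
      (((univ : Finset (Fin k)).val.map V).map fun t => Polynomial.X - Polynomial.C t).prod := by
    intro V
    rw [Multiset.map_map, ← Finset.prod, Polynomial.eval_prod]
    simp
  rw [hm, hm, Multiset.prod_X_sub_X_eq_sum_esymm, Multiset.prod_X_sub_X_eq_sum_esymm]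
  congr 1
  simp only [Multiset.card_map, Finset.card_val, Finset.card_univ, Fintype.card_fin]
  refine sum_congr rfl fun j hj => ?_
  have := key j (by simp at hj; omega)
  rw [MvPolynomial.aeval_esymm_eq_multiset_esymm, MvPolynomial.aeval_esymm_eq_multiset_esymm] at this
  rw [this]

lemma linnik_fiber {k p : ℕ} (hp : p.Prime) (hkp : k < p) (u w : Fin k → ℤ)
    (hu : ∀ i i', i ≠ i' → ¬ (p : ℤ) ∣ u i - u i')
    (h : ∀ j, (p : ℤ) ^ k ∣ ms k u j - ms k w j) (i : Fin k) :
    ∃ i', (p : ℤ) ^ k ∣ w i - u i' := by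
  have hpi : Prime (p : ℤ) := Nat.prime_iff_prime_int.mp hp
  have hun : ∀ n : ℕ, 1 ≤ n → n ≤ k → IsUnit (n : ZMod (p ^ k)) := by
    intro n h1 h2
    rw [ZMod.isUnit_iff_coprime]
    exact (Nat.Coprime.pow_left _ ((Nat.Prime.coprime_iff_not_dvd hp).mpr
      (Nat.not_dvd_of_pos_of_lt h1 (by omega)))).symm
  have hz := newton_unique hun (fun i => (u i : ZMod (p ^ k))) (fun i => (w i : ZMod (p ^ k))) (by
    intro j h1 h2
    have := h ⟨j - 1, by omega⟩
    simp only [ms_apply, Nat.sub_add_cancel h1] at this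
    have h3 : ((p ^ k : ℕ) : ℤ) ∣ (∑ i, u i ^ j - ∑ i, w i ^ j) := by exact_mod_cast this
    rw [← ZMod.intCast_zmod_eq_zero_iff_dvd] at h3
    push_cast at h3
    exact sub_eq_zero.mp h3) (w i : ZMod (p ^ k))
  have h0 : ∏ i', ((w i : ZMod (p ^ k)) - (w i' : ZMod (p ^ k))) = 0 :=
    Finset.prod_eq_zero (mem_univ i) (by simp)
  rw [h0] at hz
  have hd : (p : ℤ) ^ k ∣ ∏ i', (w i - u i') := by
    have : ((p ^ k : ℕ) : ℤ) ∣ ∏ i', (w i - u i') := by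
      rw [← ZMod.intCast_zmod_eq_zero_iff_dvd]; push_cast; exact hz
    exact_mod_cast this
  have hk0 : k ≠ 0 := by have := i.2; omega
  obtain ⟨i0, -, hi0⟩ := (hpi.dvd_finsetProd_iff _).mp ((dvd_pow_self _ hk0).trans hd)
  refine ⟨i0, ?_⟩
  rw [← Finset.mul_prod_erase _ _ (mem_univ i0)] at hd
  refine IsCoprime.dvd_of_dvd_mul_right (IsCoprime.pow_left ?_) hd
  refine IsCoprime.prod_right fun i' hi' => ?_
  rw [Prime.coprime_iff_not_dvd hpi]
  intro hdv
  refine hu i' i0 (Finset.ne_of_mem_erase hi') ?_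
  have := dvd_sub hi0 hdv
  simpa using this

lemma linnik {k p : ℕ} (hp : p.Prime) (hkp : k < p) (A : Finset ℤ)
    (hA : ∀ a ∈ A, ∀ b ∈ A, (p : ℤ) ^ k ∣ a - b → a = b) (c : ℤ) (h : Fin k → ℤ) :
    #((tup k A).filter (fun u => (∀ i i', i ≠ i' → ¬ (p : ℤ) ∣ u i - u i') ∧
      ∀ j : Fin k, (p : ℤ) ^ (j.val + 1) ∣ ms k (fun i => u i - c) j - h j))
      ≤ k ^ k * p ^ (k * (k - 1) / 2) := by
  classical
  set S := (tup k A).filter (fun u => (∀ i i', i ≠ i' → ¬ (p : ℤ) ∣ u i - u i') ∧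
      ∀ j : Fin k, (p : ℤ) ^ (j.val + 1) ∣ ms k (fun i => u i - c) j - h j) with hS
  have hp0 : (0 : ℤ) < p := by exact_mod_cast hp.pos
  let g : (Fin k → ℤ) → (Fin k → ℤ) := fun u j =>
    ((ms k (fun i => u i - c) j - h j) / (p : ℤ) ^ (j.val + 1)) % (p : ℤ) ^ (k - 1 - j.val)
  have hfib : ∀ b ∈ S.image g, #(S.filter (fun u => g u = b)) ≤ k ^ k := by
    intro b hb
    obtain ⟨u, huS, rfl⟩ := Finset.mem_image.mp hb
    rw [hS, mem_filter] at huS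
    have hmap : ∀ w ∈ S.filter (fun w => g w = g u), ∀ i, ∃ i', w i = u i' := by
      intro w hw i
      rw [mem_filter, hS, mem_filter] at hw
      obtain ⟨i', hi'⟩ := linnik_fiber hp hkp (fun i => u i - c) (fun i => w i - c)
        (by intro a b hab; simpa using huS.2.1 a b hab) (by
          intro j
          have e := congrFun hw.2 j
          obtain ⟨a, ha⟩ := huS.2.2 j
          obtain ⟨d, hd⟩ := hw.1.2.2 j
          simp only [g] at e
          rw [ha, hd, Int.mul_ediv_cancel_left _ (by positivity),
            Int.mul_ediv_cancel_left _ (by positivity)] at e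
          have e2 : (p : ℤ) ^ (k - 1 - j.val) ∣ a - d := (Int.ModEq.dvd e)
          have : ms k (fun i => u i - c) j - ms k (fun i => w i - c) j
            = (p : ℤ) ^ (j.val + 1) * (a - d) := by linear_combination ha - hd
          rw [this]
          have hk : (p : ℤ) ^ k = (p : ℤ) ^ (j.val + 1) * (p : ℤ) ^ (k - 1 - j.val) := by
            rw [← pow_add]; congr 1; omega
          rw [hk]
          exact mul_dvd_mul_left _ e2) i
      refine ⟨i', hA _ (Fintype.mem_piFinset.mp hw.1.1 i) _ (Fintype.mem_piFinset.mp huS.1 i') ?_⟩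
      simpa using hi'
    have : S.filter (fun w => g w = g u) ⊆ (univ : Finset (Fin k → Fin k)).image (fun q i => u (q i)) := by
      intro w hw
      choose q hq using hmap w hw
      exact Finset.mem_image.mpr ⟨q, mem_univ _, funext fun i => (hq i).symm⟩
    refine (Finset.card_le_card this).trans (Finset.card_image_le.trans ?_)
    simp
  refine (Finset.card_le_mul_card_image S (k ^ k) hfib).trans ?_
  refine Nat.mul_le_mul_left _ ?_
  have hsub : S.image g ⊆ Fintype.piFinset
      (fun j : Fin k => Finset.Ico (0 : ℤ) ((p : ℤ) ^ (k - 1 - j.val))) := by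
    intro b hb
    obtain ⟨u, -, rfl⟩ := Finset.mem_image.mp hb
    rw [Fintype.mem_piFinset]
    intro j
    rw [mem_Ico]
    exact ⟨Int.emod_nonneg _ (by positivity), Int.emod_lt_of_pos _ (by positivity)⟩
  refine (Finset.card_le_card hsub).trans (le_of_eq ?_)
  rw [Fintype.card_piFinset]
  have : ∀ j : Fin k, #(Finset.Ico (0 : ℤ) ((p : ℤ) ^ (k - 1 - j.val))) = p ^ (k - 1 - j.val) := by
    intro j
    rw [Int.card_Ico]
    simp only [sub_zero]
    rw [← Nat.cast_pow, Int.toNat_natCast]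
  simp_rw [this]
  rw [Finset.prod_pow_eq_pow_sum, Fin.sum_univ_eq_sum_range (fun j => k - 1 - j),
    sum_range_reflect (fun j => j), sum_range_id]

lemma dom {k : ℕ} {ι κ : Type*} [DecidableEq ι] (S : Finset ι) (K : Finset κ) (Sc : κ → Finset ι)
    (φ : ι → Fin k → ℤ) (h : ∀ x ∈ S, ∃ c ∈ K, x ∈ Sc c) :
    ∫ w, ‖F S φ w‖ ^ 2 ∂(tm k) ≤ #K * ∑ c ∈ K, ∫ w, ‖F (Sc c) φ w‖ ^ 2 ∂(tm k) := by
  have h1 : ∀ c c', (#(((Sc c) ×ˢ (Sc c')).filter (fun q => φ q.1 = φ q.2)) : ℝ)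
      ≤ ((∫ w, ‖F (Sc c) φ w‖ ^ 2 ∂(tm k)) + ∫ w, ‖F (Sc c') φ w‖ ^ 2 ∂(tm k)) / 2 := by
    intro c c'
    have e := int_F (Sc c) φ (Sc c') φ
    have e2 := norm_integral_le_integral_norm (μ := tm k)
      (fun w => F (Sc c) φ w * conj (F (Sc c') φ w))
    rw [e] at e2
    have hc := F_cont (Sc c) φ
    have hc' := F_cont (Sc c') φ
    rw [← integral_add (cint (by fun_prop)) (cint (by fun_prop)), ← integral_div]
    refine le_trans (by simpa using e2) (integral_mono (cint (by fun_prop)) (cint (by fun_prop)) ?_)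
    intro w
    simp only [norm_mul, RCLike.norm_conj]
    nlinarith [sq_nonneg (‖F (Sc c) φ w‖ - ‖F (Sc c') φ w‖)]
  rw [int_F_sq]
  have h2 : (S ×ˢ S).filter (fun q => φ q.1 = φ q.2) ⊆ (K ×ˢ K).biUnion
      (fun c => ((Sc c.1) ×ˢ (Sc c.2)).filter (fun q => φ q.1 = φ q.2)) := by
    intro q hq
    simp only [mem_filter, mem_product] at hq
    obtain ⟨c, hc, hc2⟩ := h _ hq.1.1
    obtain ⟨d, hd, hd2⟩ := h _ hq.1.2
    simp only [mem_biUnion, mem_filter, mem_product]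
    exact ⟨(c, d), ⟨hc, hd⟩, ⟨hc2, hd2⟩, hq.2⟩
  have h3 := (Finset.card_le_card h2).trans Finset.card_biUnion_le
  calc (#((S ×ˢ S).filter (fun q => φ q.1 = φ q.2)) : ℝ)
      ≤ ∑ c ∈ K ×ˢ K, (#(((Sc c.1) ×ˢ (Sc c.2)).filter (fun q => φ q.1 = φ q.2)) : ℝ) := by
        exact_mod_cast h3
    _ ≤ ∑ c ∈ K ×ˢ K, ((∫ w, ‖F (Sc c.1) φ w‖ ^ 2 ∂(tm k)) + ∫ w, ‖F (Sc c.2) φ w‖ ^ 2 ∂(tm k)) / 2 :=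
        sum_le_sum fun c _ => h1 c.1 c.2
    _ = _ := by
        rw [sum_product]
        simp only [← sum_div, sum_add_distrib, sum_const, nsmul_eq_mul,
          ← mul_sum]
        ring

/-- residue class -/
def cl (p : ℕ) (A : Finset ℤ) (y : ℤ) : Finset ℤ := A.filter (fun a => (p : ℤ) ∣ a - y)

lemma holder_cl {k p : ℕ} (A : Finset ℤ) (I : Finset ℤ) (hI : I ⊆ Finset.Ico 0 (p : ℤ))
    (s : ℕ) (hs : 1 ≤ s) (g : UnitAddTorus (Fin k) → ℝ) (hg : Continuous g) (hg0 : ∀ w, 0 ≤ g w)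
    (K : ℝ) (hK : ∀ y ∈ I, ∫ w, g w * ‖F (cl p A y) (mo k) w‖ ^ (2 * s) ∂(tm k) ≤ K) :
    ∫ w, g w * ‖F (A.filter (fun a => ∃ y ∈ I, (p : ℤ) ∣ a - y)) (mo k) w‖ ^ (2 * s) ∂(tm k)
      ≤ (#I : ℝ) ^ (2 * s) * K := by
  classical
  have hU : ∀ w, F (A.filter (fun a => ∃ y ∈ I, (p : ℤ) ∣ a - y)) (mo k) w
      = ∑ y ∈ I, F (cl p A y) (mo k) w := by
    intro w
    have : A.filter (fun a => ∃ y ∈ I, (p : ℤ) ∣ a - y) = I.biUnion (cl p A) := by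
      ext a; simp only [mem_filter, mem_biUnion, cl]; tauto
    rw [this, F, sum_biUnion]
    · rfl
    · intro y hy z hz hyz
      rw [Function.onFun, Finset.disjoint_left]
      intro a ha hb
      simp only [cl, mem_filter] at ha hb
      apply hyz
      have h1 := Finset.mem_Ico.mp (hI hy)
      have h2 := Finset.mem_Ico.mp (hI hz)
      have h3 := dvd_sub ha.2 hb.2
      have h4 : (p : ℤ) ∣ z - y := by
        have e : (a - y) - (a - z) = z - y := by ring
        rwa [e] at h3
      have := Int.eq_zero_of_abs_lt_dvd h4 (by rw [abs_lt]; constructor <;> linarith)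
      linarith
  have hcont : ∀ y, Continuous (fun w => g w * ‖F (cl p A y) (mo k) w‖ ^ (2 * s)) := by
    intro y; have := F_cont (cl p A y) (mo k); fun_prop
  have hpt : ∀ w, g w * ‖F (A.filter (fun a => ∃ y ∈ I, (p : ℤ) ∣ a - y)) (mo k) w‖ ^ (2 * s)
      ≤ (#I : ℝ) ^ (2 * s - 1) * ∑ y ∈ I, g w * ‖F (cl p A y) (mo k) w‖ ^ (2 * s) := by
    intro w
    rw [hU, ← mul_sum, mul_left_comm]
    refine mul_le_mul_of_nonneg_left ?_ (hg0 w)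
    refine (pow_le_pow_left₀ (norm_nonneg _) (norm_sum_le _ _) _).trans ?_
    have h := pow_sum_div_card_le_sum_pow (s := I) (f := fun y => ‖F (cl p A y) (mo k) w‖)
      (fun _ _ => norm_nonneg _) (2 * s - 1)
    rw [Nat.sub_add_cancel (by omega)] at h
    rcases I.eq_empty_or_nonempty with rfl | hne
    · simp [show s ≠ 0 by omega]
    · rw [div_le_iff₀ (by have := hne.card_pos; positivity)] at h
      exact h.trans (le_of_eq (mul_comm _ _))
  have hc0 := F_cont (A.filter (fun a => ∃ y ∈ I, (p : ℤ) ∣ a - y)) (mo k)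
  refine (integral_mono (cint (by fun_prop)) (cint (by fun_prop)) hpt).trans ?_
  rw [integral_const_mul, integral_finsetSum _ (fun y _ => cint (hcont y))]
  have h5 : ∑ y ∈ I, ∫ w, g w * ‖F (cl p A y) (mo k) w‖ ^ (2 * s) ∂(tm k) ≤ #I * K := by
    simpa using sum_le_sum hK
  calc _ ≤ (#I : ℝ) ^ (2 * s - 1) * (#I * K) := by gcongr
    _ = _ := by
      conv_rhs => rw [show 2 * s = 2 * s - 1 + 1 by omega]
      ring

lemma J_cl (s k p P : ℕ) (hp : 0 < p) (y : ℤ) (hy : y ∈ Finset.Ico 0 (p : ℤ)) :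
    J s k (cl p (Ioc 0 (P : ℤ)) y) ≤ J s k (Ioc 0 ((P / p + 1 : ℕ) : ℤ)) := by
  refine J_affine s k _ _ p (y - p) (by positivity) fun a ha => ?_
  simp only [cl, mem_filter, mem_Ioc] at ha
  obtain ⟨q, hq⟩ := ha.2
  have h1 := Finset.mem_Ico.mp hy
  have hp' : (0 : ℤ) < p := by exact_mod_cast hp
  refine ⟨q + 1, ?_, by linear_combination hq⟩
  rw [mem_Ioc]
  constructor
  · by_contra hneg
    have : q ≤ -1 := by omega
    nlinarith
  · push_cast
    have : q ≤ (P : ℤ) / p := by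
      rw [Int.le_ediv_iff_mul_le hp']; nlinarith
    linarith

/-- tuples distinct mod p -/
def dis (p k : ℕ) (A : Finset ℤ) : Finset (Fin k → ℤ) :=
  (tup k A).filter (fun u => ∀ i i', i ≠ i' → ¬ (p : ℤ) ∣ u i - u i')

lemma ms_sum {k : ℕ} {α β : Type*} [Fintype α] [Fintype β] (x : α ⊕ β → ℤ) :
    ms k x = ms k (fun a => x (Sum.inl a)) + ms k (fun b => x (Sum.inr b)) := by
  simp [ms, Fintype.sum_sum_type]

lemma good_y {k p s : ℕ} (hp : p.Prime) (hkp : k < p) (A : Finset ℤ)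
    (hA : ∀ a ∈ A, ∀ b ∈ A, (p : ℤ) ^ k ∣ a - b → a = b) (y : ℤ) :
    ∫ w, ‖F (dis p k A) (ms k) w‖ ^ 2 * ‖F (cl p A y) (mo k) w‖ ^ (2 * s) ∂(tm k)
      ≤ ((k ^ k * p ^ (k * (k - 1) / 2) * #A ^ k : ℕ) : ℝ) * J s k (cl p A y) := by
  classical
  set T := tup s (cl p A y)
  have h1 : ∀ w, ‖F (dis p k A) (ms k) w‖ ^ 2 * ‖F (cl p A y) (mo k) w‖ ^ (2 * s)
      = ‖F (dis p k A ×ˢ T) (fun q => ms k q.1 + ms k q.2) w‖ ^ 2 := by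
    intro w
    have : F (dis p k A ×ˢ T) (fun q => ms k q.1 + ms k q.2) w
        = F (dis p k A) (ms k) w * F (cl p A y) (mo k) w ^ s := by
      rw [← F_pow]
      simp [F, UnitAddTorus.mFourier_add, sum_product, sum_mul_sum, T]
    rw [this, norm_mul, norm_pow]; ring
  simp_rw [h1]
  rw [int_F_sq]
  -- congruence relation
  let R : (Fin k → ℤ) → (Fin k → ℤ) → Prop := fun x' x =>
    ∀ j : Fin k, (p : ℤ) ^ (j.val + 1) ∣ ms k (fun i => x i - y) j - ms k (fun i => x' i - y) j
  have hR : ∀ x x' : Fin k → ℤ, ∀ z ∈ T, ∀ z' ∈ T, ms k x + ms k z = ms k x' + ms k z' → R x' x := by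
    intro x x' z hz z' hz' he j
    have e1 := ms_shift (k := k) (Sum.elim x z) (Sum.elim x' z') (-y) (by
      rw [ms_sum, ms_sum]; simpa using he)
    have e2 := congrFun e1 j
    rw [ms_sum, ms_sum] at e2
    simp only [Sum.elim_inl, Sum.elim_inr, Pi.add_apply, ← sub_eq_add_neg] at e2
    have hd : ∀ z ∈ T, (p : ℤ) ^ (j.val + 1) ∣ ms k (fun i => z i - y) j := by
      intro z hz
      rw [ms_apply]
      refine Finset.dvd_sum fun i _ => pow_dvd_pow_of_dvd ?_ _
      have := Fintype.mem_piFinset.mp hz i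
      simp only [cl, mem_filter] at this
      exact this.2
    have : ms k (fun i => x i - y) j - ms k (fun i => x' i - y) j
        = ms k (fun i => z' i - y) j - ms k (fun i => z i - y) j := by linear_combination e2
    rw [this]
    exact dvd_sub (hd z' hz') (hd z hz)
  have hcard : #(((dis p k A ×ˢ T) ×ˢ (dis p k A ×ˢ T)).filter
      (fun q => ms k q.1.1 + ms k q.1.2 = ms k q.2.1 + ms k q.2.2)) ≤
      ∑ x' ∈ dis p k A, ∑ x ∈ (dis p k A).filter (R x'),
        #((T ×ˢ T).filter (fun q => ms k q.1 = (ms k x' - ms k x) + ms k q.2)) := by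
    rw [sum_sigma', ← Finset.card_sigma]
    refine Finset.card_le_card_of_injOn (fun q => ⟨⟨q.2.1, q.1.1⟩, (q.1.2, q.2.2)⟩) ?_ ?_
    · intro q hq
      simp only [Finset.coe_filter, mem_product, Set.mem_ofPred_eq, Finset.coe_sigma] at hq ⊢
      simp only [mem_coe, mem_sigma, Set.mem_sigma_iff, mem_filter,
        mem_product]
      refine ⟨⟨hq.1.2.1, hq.1.1.1, hR _ _ _ hq.1.1.2 _ hq.1.2.2 hq.2⟩, ⟨hq.1.1.2, hq.1.2.2⟩, ?_⟩
      have := hq.2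
      rw [eq_comm, ← sub_eq_zero] at this ⊢
      rw [← this]; abel
    · rintro ⟨⟨a, b⟩, c, d⟩ _ ⟨⟨a', b'⟩, c', d'⟩ _ h
      simp only [Sigma.mk.injEq, heq_eq_eq, Prod.mk.injEq] at h
      grind
  calc (_ : ℝ) ≤ ∑ x' ∈ dis p k A, ∑ x ∈ (dis p k A).filter (R x'),
        (#((T ×ˢ T).filter (fun q => ms k q.1 = (ms k x' - ms k x) + ms k q.2)) : ℝ) := by
        exact_mod_cast hcard
    _ ≤ ∑ x' ∈ dis p k A, ∑ x ∈ (dis p k A).filter (R x'), J s k (cl p A y) :=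
        sum_le_sum fun x' _ => sum_le_sum fun x _ => J_twist _ _ _ _
    _ = ∑ x' ∈ dis p k A, (#((dis p k A).filter (R x')) : ℝ) * J s k (cl p A y) := by simp
    _ ≤ ∑ x' ∈ dis p k A, ((k ^ k * p ^ (k * (k - 1) / 2) : ℕ) : ℝ) * J s k (cl p A y) := by
        refine sum_le_sum fun x' _ => mul_le_mul_of_nonneg_right ?_ (J_nonneg _ _ _)
        have := linnik hp hkp A hA y (ms k (fun i => x' i - y))
        rw [dis, Finset.filter_filter]
        exact_mod_cast this
    _ ≤ _ := by
        rw [sum_const, nsmul_eq_mul, ← mul_assoc]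
        refine mul_le_mul_of_nonneg_right ?_ (J_nonneg _ _ _)
        have : #(dis p k A) ≤ #A ^ k := (Finset.card_filter_le _ _).trans (by simp)
        rw [← Nat.cast_mul, Nat.cast_le, mul_comm]
        exact Nat.mul_le_mul_left _ this

lemma good_emb {k p s n : ℕ} (hn : n = k + s) (A : Finset ℤ) (ι : Fin k ↪ Fin n)
    (w : UnitAddTorus (Fin k)) :
    F ((tup n A).filter (fun x => x ∘ ι ∈ dis p k A)) (ms k) w
      = F (dis p k A) (ms k) w * F A (mo k) w ^ s := by
  classical
  have hc : Fintype.card ((Set.range ι)ᶜ : Set (Fin n)) = s := by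
    rw [Fintype.card_compl_set, Fintype.card_fin, Set.card_range_of_injective ι.injective,
      Fintype.card_fin]; omega
  let e : Fin k ⊕ Fin s ≃ Fin n :=
    ((Equiv.ofInjective ι ι.injective).sumCongr (Fintype.equivFinOfCardEq hc).symm).trans
      (Equiv.Set.sumCompl (Set.range ι))
  have he : ∀ i, e (Sum.inl i) = ι i := fun i => by simp [e]
  have h1 : F (dis p k A) (ms k) w * F A (mo k) w ^ s
      = F (dis p k A ×ˢ tup s A) (fun q => ms k q.1 + ms k q.2) w := by
    rw [← F_pow]
    simp [F, UnitAddTorus.mFourier_add, sum_product, sum_mul_sum]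
  rw [h1, F, F]
  refine sum_nbij' (fun x => (fun i => x (e (Sum.inl i)), fun i => x (e (Sum.inr i))))
    (fun q => fun i => Sum.elim q.1 q.2 (e.symm i)) ?_ ?_ ?_ ?_ ?_
  · intro x hx
    simp only [mem_filter, Fintype.mem_piFinset, mem_product] at hx ⊢
    refine ⟨?_, fun i => hx.1 _⟩
    convert hx.2 using 1
    ext i; simp [he]
  · intro q hq
    simp only [mem_filter, Fintype.mem_piFinset, mem_product] at hq ⊢
    constructor
    · intro i
      rcases h : e.symm i with a | a
      · have := hq.1; simp only [dis, mem_filter, Fintype.mem_piFinset] at this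
        simpa using this.1 a
      · simpa using hq.2 a
    · convert hq.1 using 1
      ext i; simp [← he]
  · intro x hx
    ext i
    obtain ⟨j, rfl⟩ := e.surjective i
    rcases j with j | j <;> simp
  · intro q hq
    simp
  · intro x hx
    congr 1
    have : ms k x = ms k (fun j => x (e j)) := by
      simp only [ms]; exact (Equiv.sum_comp e (fun i => mo k (x i))).symm
    rw [this, ms_sum]

lemma bad_cover {k p n : ℕ} (hkp : k < p) (x : Fin n → ℤ)
    (h : ¬ ∃ ι : Fin k ↪ Fin n, ∀ i i', i ≠ i' → ¬ (p : ℤ) ∣ x (ι i) - x (ι i')) :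
    ∃ I ∈ Finset.powersetCard k (Finset.Ico 0 (p : ℤ)), ∀ i, ∃ y ∈ I, (p : ℤ) ∣ x i - y := by
  classical
  have hp : (0 : ℤ) < p := by have : 0 < p := by omega
                              exact_mod_cast this
  set R := (Finset.univ : Finset (Fin n)).image (fun i => x i % p) with hR
  have hsub : R ⊆ Finset.Ico 0 (p : ℤ) := by
    intro y hy
    obtain ⟨i, _, rfl⟩ := Finset.mem_image.mp hy
    exact Finset.mem_Ico.mpr ⟨Int.emod_nonneg _ hp.ne', Int.emod_lt_of_pos _ hp⟩
  have hcard : #R ≤ k := by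
    by_contra hlt
    push Not at hlt
    have : Nonempty (Fin k ↪ R) := Function.Embedding.nonempty_of_card_le (by simp; omega)
    obtain ⟨f⟩ := this
    have hf : ∀ j : Fin k, ∃ i, x i % p = (f j : ℤ) := fun j => by
      obtain ⟨i, _, hi⟩ := Finset.mem_image.mp (f j).2
      exact ⟨i, hi⟩
    choose g hg using hf
    have hinj : Function.Injective g := by
      intro a b hab
      apply f.injective
      apply Subtype.ext
      rw [← hg, ← hg, hab]
    refine h ⟨⟨g, hinj⟩, fun i i' hii' hd => hii' ?_⟩
    apply f.injective
    apply Subtype.ext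
    rw [← hg, ← hg]
    exact Int.emod_eq_emod_iff_emod_sub_eq_zero.mpr (Int.emod_eq_zero_of_dvd hd)
  obtain ⟨I, hI1, hI2, hI3⟩ := Finset.exists_subsuperset_card_eq hsub hcard (by simp; omega)
  refine ⟨I, Finset.mem_powersetCard.mpr ⟨hI2, hI3⟩, fun i => ⟨x i % p, hI1 (mem_image_of_mem _ (mem_univ i)), ?_⟩⟩
  exact Int.dvd_self_sub_emod

lemma good_bad (n k : ℕ) (A : Finset ℤ) (good : (Fin n → ℤ) → Prop) [DecidablePred good] :
    J n k A ≤ 2 * (∫ w, ‖F ((tup n A).filter good) (ms k) w‖ ^ 2 ∂(tm k))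
      + 2 * ∫ w, ‖F ((tup n A).filter (fun x => ¬ good x)) (ms k) w‖ ^ 2 ∂(tm k) := by
  have hGB : ∀ w, F A (mo k) w ^ n = F ((tup n A).filter good) (ms k) w
      + F ((tup n A).filter (fun x => ¬ good x)) (ms k) w := by
    intro w
    rw [← F_pow]; simp only [F]
    rw [sum_filter_add_sum_filter_not]
  have hcG := F_cont ((tup n A).filter good) (ms k)
  have hcB := F_cont ((tup n A).filter (fun x => ¬ good x)) (ms k)
  generalize F ((tup n A).filter good) (ms k) = f at *
  generalize F ((tup n A).filter (fun x => ¬ good x)) (ms k) = g at *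
  have hcA := F_cont A (mo k)
  rw [← integral_const_mul, ← integral_const_mul,
    ← integral_add (cint (by fun_prop)) (cint (by fun_prop)), J]
  refine integral_mono (cint (by fun_prop)) (cint (by fun_prop)) fun w => ?_
  have h3 : ‖F A (mo k) w‖ ^ (2 * n) = ‖f w + g w‖ ^ 2 := by
    rw [← hGB, norm_pow]; ring
  simp only
  rw [h3]
  nlinarith [norm_add_le (f w) (g w), norm_nonneg (f w + g w), sq_nonneg (‖f w‖ - ‖g w‖)]

lemma step {k p s n P : ℕ} (hn : n = k + s) (hs : 1 ≤ s) (hp : p.Prime) (hkp : k < p) (hP : P ≤ p ^ k) :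
    J n k (Ioc 0 (P : ℤ)) ≤
      2 * (((n ^ k) ^ 2 * (p ^ (2 * s) * (k ^ k * p ^ (k * (k - 1) / 2) * P ^ k)) : ℕ) : ℝ)
        * J s k (Ioc 0 ((P / p + 1 : ℕ) : ℤ))
      + 2 * (((p ^ k) ^ 2 * k ^ (2 * n) : ℕ) : ℝ) * J n k (Ioc 0 ((P / p + 1 : ℕ) : ℤ)) := by
  classical
  set A := Ioc 0 (P : ℤ)
  set L := Ioc 0 ((P / p + 1 : ℕ) : ℤ)
  have hA : ∀ a ∈ A, ∀ b ∈ A, (p : ℤ) ^ k ∣ a - b → a = b := by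
    intro a ha b hb hd
    have h1 := Finset.mem_Ioc.mp ha
    have h2 := Finset.mem_Ioc.mp hb
    have : (P : ℤ) ≤ (p : ℤ) ^ k := by exact_mod_cast hP
    have := Int.eq_zero_of_abs_lt_dvd hd (by rw [abs_lt]; constructor <;> linarith)
    linarith
  let good : (Fin n → ℤ) → Prop := fun x => ∃ ι : Fin k ↪ Fin n, ∀ i i', i ≠ i' → ¬ (p : ℤ) ∣ x (ι i) - x (ι i')
  set G := (tup n A).filter good
  set B := (tup n A).filter (fun x => ¬ good x)
  have hAcard : #A = P := by simp [A]
  -- good part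
  have hG : ∫ w, ‖F G (ms k) w‖ ^ 2 ∂(tm k) ≤
      (((n ^ k) ^ 2 * (p ^ (2 * s) * (k ^ k * p ^ (k * (k - 1) / 2) * P ^ k)) : ℕ) : ℝ) * J s k L := by
    have h1 := dom (k := k) G (Finset.univ : Finset (Fin k ↪ Fin n))
      (fun ι => (tup n A).filter (fun x => x ∘ ι ∈ dis p k A)) (ms k) (by
        intro x hx
        simp only [G, mem_filter] at hx
        obtain ⟨ι, hι⟩ := hx.2
        refine ⟨ι, mem_univ _, ?_⟩
        simp only [mem_filter, dis, Fintype.mem_piFinset, Function.comp]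
        exact ⟨Fintype.mem_piFinset.mp hx.1, fun i => Fintype.mem_piFinset.mp hx.1 _, hι⟩)
    have h2 : ∀ ι : Fin k ↪ Fin n,
        ∫ w, ‖F ((tup n A).filter (fun x => x ∘ ι ∈ dis p k A)) (ms k) w‖ ^ 2 ∂(tm k)
        ≤ (p : ℝ) ^ (2 * s) * (((k ^ k * p ^ (k * (k - 1) / 2) * P ^ k : ℕ) : ℝ) * J s k L) := by
      intro ι
      have h3 := holder_cl (k := k) (p := p) A (Finset.Ico 0 (p : ℤ)) (Finset.Subset.refl _) s hs
        (fun w => ‖F (dis p k A) (ms k) w‖ ^ 2) (by have := F_cont (dis p k A) (ms k); fun_prop)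
        (fun w => by positivity) (((k ^ k * p ^ (k * (k - 1) / 2) * P ^ k : ℕ) : ℝ) * J s k L) (by
          intro y hy
          refine (good_y hp hkp A hA y).trans ?_
          rw [hAcard]
          exact mul_le_mul_of_nonneg_left (J_cl s k p P hp.pos y hy) (by positivity))
      have h4 : A.filter (fun a => ∃ y ∈ Finset.Ico 0 (p : ℤ), (p : ℤ) ∣ a - y) = A := by
        refine Finset.filter_true_of_mem fun a _ => ⟨a % p, ?_, Int.dvd_self_sub_emod⟩
        have hp' : (0 : ℤ) < p := by exact_mod_cast hp.pos
        exact Finset.mem_Ico.mpr ⟨Int.emod_nonneg _ hp'.ne', Int.emod_lt_of_pos _ hp'⟩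
      rw [h4] at h3
      refine le_trans (le_of_eq ?_) (h3.trans (le_of_eq ?_))
      · refine integral_congr_ae (Eventually.of_forall fun w => ?_)
        simp only [good_emb hn A ι w, norm_mul, norm_pow]; ring
      · simp
    have h5 : (#(Finset.univ : Finset (Fin k ↪ Fin n)) : ℝ) ≤ (n : ℝ) ^ k := by
      rw [Finset.card_univ, Fintype.card_embedding_eq]
      simpa using (by exact_mod_cast Nat.descFactorial_le_pow n k : ((n.descFactorial k : ℕ) : ℝ) ≤ (n : ℝ) ^ k)
    have h6 : 0 ≤ J s k L := J_nonneg _ _ _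
    calc _ ≤ _ := h1
      _ ≤ (#(Finset.univ : Finset (Fin k ↪ Fin n)) : ℝ) * (#(Finset.univ : Finset (Fin k ↪ Fin n)) *
          ((p : ℝ) ^ (2 * s) * (((k ^ k * p ^ (k * (k - 1) / 2) * P ^ k : ℕ) : ℝ) * J s k L))) := by
        refine mul_le_mul_of_nonneg_left ?_ (by positivity)
        have := sum_le_sum (s := (Finset.univ : Finset (Fin k ↪ Fin n))) (fun ι _ => h2 ι)
        simpa using this
      _ ≤ (n : ℝ) ^ k * ((n : ℝ) ^ k *
          ((p : ℝ) ^ (2 * s) * (((k ^ k * p ^ (k * (k - 1) / 2) * P ^ k : ℕ) : ℝ) * J s k L))) := by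
        gcongr
      _ = _ := by push_cast; ring
  have hB : ∫ w, ‖F B (ms k) w‖ ^ 2 ∂(tm k) ≤ (((p ^ k) ^ 2 * k ^ (2 * n) : ℕ) : ℝ) * J n k L := by
    have h1 := dom (k := k) B (Finset.powersetCard k (Finset.Ico 0 (p : ℤ)))
      (fun I => tup n (A.filter (fun a => ∃ y ∈ I, (p : ℤ) ∣ a - y))) (ms k) (by
        intro x hx
        simp only [B, mem_filter] at hx
        obtain ⟨I, hI, hI2⟩ := bad_cover hkp x hx.2
        refine ⟨I, hI, ?_⟩
        simp only [mem_filter, Fintype.mem_piFinset]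
        exact fun i => ⟨Fintype.mem_piFinset.mp hx.1 i, hI2 i⟩)
    have h2 : ∀ I ∈ Finset.powersetCard k (Finset.Ico 0 (p : ℤ)),
        ∫ w, ‖F (tup n (A.filter (fun a => ∃ y ∈ I, (p : ℤ) ∣ a - y))) (ms k) w‖ ^ 2 ∂(tm k)
        ≤ (k : ℝ) ^ (2 * n) * J n k L := by
      intro I hI
      rw [mem_powersetCard] at hI
      have h3 := holder_cl (k := k) (p := p) A I hI.1 n (by omega)
        (fun w => 1) (by fun_prop) (fun w => by positivity) (J n k L) (by
          intro y hy
          simp only [one_mul]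
          exact J_cl n k p P hp.pos y (hI.1 hy))
      refine le_trans (le_of_eq ?_) (h3.trans (le_of_eq ?_))
      · refine integral_congr_ae (Eventually.of_forall fun w => ?_)
        simp only [F_pow, norm_pow, one_mul]; ring
      · rw [hI.2]
    have h5 : (#(Finset.powersetCard k (Finset.Ico 0 (p : ℤ))) : ℝ) ≤ (p : ℝ) ^ k := by
      rw [Finset.card_powersetCard]
      simp only [Int.card_Ico, sub_zero, Int.toNat_natCast]
      exact_mod_cast Nat.choose_le_pow p k
    have h6 : 0 ≤ J n k L := J_nonneg _ _ _
    calc _ ≤ _ := h1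
      _ ≤ (#(Finset.powersetCard k (Finset.Ico 0 (p : ℤ))) : ℝ) *
          (#(Finset.powersetCard k (Finset.Ico 0 (p : ℤ))) * ((k : ℝ) ^ (2 * n) * J n k L)) := by
        refine mul_le_mul_of_nonneg_left ?_ (by positivity)
        have := sum_le_sum h2
        rwa [sum_const, nsmul_eq_mul] at this
      _ ≤ (p : ℝ) ^ k * ((p : ℝ) ^ k * ((k : ℝ) ^ (2 * n) * J n k L)) := by gcongr
      _ = _ := by push_cast; ring
  have hsum : J n k A ≤ 2 * (∫ w, ‖F G (ms k) w‖ ^ 2 ∂(tm k)) + 2 * ∫ w, ‖F B (ms k) w‖ ^ 2 ∂(tm k) := good_bad n k A good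
  linarith

lemma it_second {k n : ℕ} {p e : ℝ} (hk : 2 ≤ k) (hn : k ^ 2 + k ≤ n) (hp : 256 * (k : ℝ) ^ 4 ≤ p)
    (h1 : 3 / 2 * (n : ℝ) ≤ e) (h2 : e ≤ 2 * n) :
    4 * (p ^ (2 * k) * (k : ℝ) ^ (2 * n)) * 2 ^ e ≤ p ^ e := by
  have hk' : (2 : ℝ) ≤ k := by exact_mod_cast hk
  have hn' : (k : ℝ) ^ 2 + k ≤ n := by exact_mod_cast hn
  have hp1 : 1 ≤ p := by nlinarith [pow_le_pow_left₀ (by norm_num) hk' 4]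
  have hp0 : 0 < p := by linarith
  have a1 : (2 : ℝ) ^ e ≤ 4 ^ n := by
    calc (2 : ℝ) ^ e ≤ 2 ^ (2 * n : ℝ) := rpow_le_rpow_of_exponent_le (by norm_num) h2
      _ = 4 ^ n := by
        rw [show (2 * n : ℝ) = ((2 * n : ℕ) : ℝ) by push_cast; ring, rpow_natCast, pow_mul]; norm_num
  have a2 : (4 : ℝ) ≤ 4 ^ n := by
    calc (4 : ℝ) = 4 ^ 1 := by norm_num
      _ ≤ 4 ^ n := pow_le_pow_right₀ (by norm_num) (by nlinarith)
  have a3 : (16 * (k : ℝ) ^ 2) ^ n ≤ p ^ ((n : ℝ) / 2) := by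
    calc (16 * (k : ℝ) ^ 2) ^ n = ((16 * (k : ℝ) ^ 2) ^ (2 : ℕ)) ^ ((n : ℝ) / 2) := by
          rw [← rpow_natCast (16 * (k : ℝ) ^ 2) 2, ← rpow_mul (by positivity), ← rpow_natCast]
          congr 1; push_cast; ring
      _ ≤ p ^ ((n : ℝ) / 2) := rpow_le_rpow (by positivity) (by nlinarith) (by positivity)
  calc 4 * (p ^ (2 * k) * (k : ℝ) ^ (2 * n)) * 2 ^ e
      ≤ 4 ^ n * (p ^ (2 * k) * (k : ℝ) ^ (2 * n)) * 4 ^ n := by gcongr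
    _ = p ^ (2 * k) * (16 * (k : ℝ) ^ 2) ^ n := by
        rw [mul_pow, pow_mul, show (16 : ℝ) = 4 * 4 by norm_num, mul_pow]; ring
    _ ≤ p ^ (2 * k) * p ^ ((n : ℝ) / 2) := by gcongr
    _ = p ^ ((2 * k : ℕ) + (n : ℝ) / 2) := by rw [rpow_add hp0, rpow_natCast]
    _ ≤ p ^ e := rpow_le_rpow_of_exponent_le hp1 (by push_cast; nlinarith)

lemma it_first {k s : ℕ} {p Q e η : ℝ} (hk : 2 ≤ k) (hp1 : 1 ≤ p) (hpQ : p ≤ 4 * Q)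
    (hη0 : 0 ≤ η) (hη : η ≤ k * (k + 1) / 2) (he : e = 2 * s - k * (k + 1) / 2 + η) (hs : k ^ 2 ≤ s) :
    p ^ (2 * s) * (p ^ (k * (k - 1) / 2) * (Q ^ k) ^ k) * (2 * Q ^ k / p) ^ e
      ≤ 2 ^ (2 * s) * 4 ^ k ^ 2 * (Q ^ k) ^ (e + 2 * k - η / k) := by
  have hk' : (2 : ℝ) ≤ k := by exact_mod_cast hk
  have hp0 : 0 < p := by linarith
  have hQ : 0 < Q := by linarith
  have hs' : (k : ℝ) ^ 2 ≤ s := by exact_mod_cast hs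
  have e1 : ((k * (k - 1) / 2 : ℕ) : ℝ) = k * (k + 1) / 2 - k := by
    have : 2 ∣ k * (k - 1) := (Nat.even_mul_pred_self k).two_dvd
    rw [Nat.cast_div this (by norm_num)]
    push_cast [Nat.cast_sub (show 1 ≤ k by omega)]; ring
  have he0 : 0 ≤ e := by rw [he]; nlinarith
  have e2 : p ^ (2 * s) * (p ^ (k * (k - 1) / 2) * (Q ^ k) ^ k) * (2 * Q ^ k / p) ^ e
      = 2 ^ e * p ^ ((k : ℝ) ^ 2 - η) * (Q ^ k) ^ (k + e) := by
    rw [div_rpow (by positivity) hp0.le, mul_rpow (by norm_num) (by positivity)]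
    rw [← rpow_natCast p, ← rpow_natCast p, e1, ← rpow_natCast (Q ^ k) k]
    rw [rpow_add (by positivity)]
    have : p ^ ((k : ℝ) ^ 2 - η) = p ^ ((2 * s : ℕ) : ℝ) * p ^ ((k : ℝ) * (k + 1) / 2 - k) / p ^ e := by
      rw [← rpow_add hp0, ← rpow_sub hp0]; congr 1; rw [he]; push_cast; ring
    rw [this]; field_simp
  rw [e2]
  have e3 : p ^ ((k : ℝ) ^ 2 - η) ≤ 4 ^ k ^ 2 * (Q ^ k) ^ ((k : ℝ) - η / k) := by
    calc p ^ ((k : ℝ) ^ 2 - η) ≤ (4 * Q) ^ ((k : ℝ) ^ 2 - η) :=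
          rpow_le_rpow hp0.le hpQ (by nlinarith)
      _ = 4 ^ ((k : ℝ) ^ 2 - η) * Q ^ ((k : ℝ) ^ 2 - η) := mul_rpow (by norm_num) hQ.le
      _ ≤ 4 ^ ((k ^ 2 : ℕ) : ℝ) * Q ^ ((k : ℝ) ^ 2 - η) := by
          gcongr
          · norm_num
          · push_cast; linarith
      _ = _ := by
          rw [rpow_natCast, ← rpow_natCast Q k, ← rpow_mul hQ.le]
          congr 2; field_simp
  have e4 : (2 : ℝ) ^ e ≤ 2 ^ (2 * s) := by
    rw [← rpow_natCast]; apply rpow_le_rpow_of_exponent_le (by norm_num); push_cast; linarith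
  calc 2 ^ e * p ^ ((k : ℝ) ^ 2 - η) * (Q ^ k) ^ (k + e)
      ≤ 2 ^ (2 * s) * (4 ^ k ^ 2 * (Q ^ k) ^ ((k : ℝ) - η / k)) * (Q ^ k) ^ (k + e) := by gcongr
    _ = _ := by
      rw [show e + 2 * k - η / k = ((k : ℝ) - η / k) + (k + e) by ring,
        rpow_add (show 0 < Q ^ k by positivity) ((k : ℝ) - η / k) (k + e)]; ring

lemma iter_step {k s n : ℕ} {D Dr e η : ℝ} (hk : 2 ≤ k) (hn : n = k + s) (hs : k ^ 2 ≤ s)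
    (hη0 : 0 ≤ η) (hη : η ≤ k * (k + 1) / 2) (he : e = 2 * s - k * (k + 1) / 2 + η)
    (hDr : 1 ≤ Dr) (hD1 : ((256 * k ^ 4) ^ k : ℝ) ^ ((k : ℝ) * (k + 1) / 2) ≤ D)
    (hD2 : 4 * (n : ℝ) ^ (2 * k) * k ^ k * 2 ^ (2 * s) * 4 ^ k ^ 2 ≤ D)
    (ih : ∀ P : ℕ, 1 ≤ P → J s k (Ioc 0 (P : ℤ)) ≤ Dr * (P : ℝ) ^ e) :
    ∀ P : ℕ, 1 ≤ P → J n k (Ioc 0 (P : ℤ)) ≤ D * Dr * (P : ℝ) ^ (e + 2 * k - η / k) := by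
  have hk' : (2 : ℝ) ≤ k := by exact_mod_cast hk
  have hs' : (k : ℝ) ^ 2 ≤ s := by exact_mod_cast hs
  have hn' : (n : ℝ) = k + s := by exact_mod_cast hn
  have hs1 : 1 ≤ s := le_trans (Nat.one_le_pow _ _ (by omega)) hs
  have hk4 : (2 : ℝ) ^ 4 ≤ (k : ℝ) ^ 4 := pow_le_pow_left₀ (by norm_num) hk' 4
  have hD0 : 1 ≤ D := by
    refine le_trans ?_ hD1
    exact one_le_rpow (one_le_pow₀ (by linarith)) (by positivity)
  set e' := e + 2 * k - η / k with he'
  have hηk : η / k ≤ η := div_le_self hη0 (by linarith)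
  have hηk0 : 0 ≤ η / k := by positivity
  have hkk : 2 * (k : ℝ) ≤ k ^ 2 := by rw [sq]; exact mul_le_mul_of_nonneg_right hk' (by linarith)
  have hkk2 : (k : ℝ) * (k + 1) = k ^ 2 + k := by ring
  have he'1 : 3 / 2 * (n : ℝ) ≤ e' := by rw [he', he, hn', hkk2]; linarith
  have he'2 : e' ≤ 2 * n := by rw [he', he, hn']; linarith
  have he'3 : 2 * n - (k : ℝ) * (k + 1) / 2 ≤ e' := by rw [he', he, hn']; linarith
  intro P
  induction P using Nat.strong_induction_on with
  | _ P IH =>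
  intro hP
  have hP1 : (1 : ℝ) ≤ P := by exact_mod_cast hP
  have hP0 : (0 : ℝ) < P := by linarith
  by_cases hsm : (P : ℝ) ≤ (256 * k ^ 4) ^ k
  · calc J n k (Ioc 0 (P : ℤ)) ≤ (P : ℝ) ^ (2 * n) := by simpa using J_triv n k (Ioc 0 (P : ℤ))
      _ = (P : ℝ) ^ (2 * n - e') * (P : ℝ) ^ e' := by
          rw [← rpow_add hP0, ← rpow_natCast]; congr 1; push_cast; ring
      _ ≤ (P : ℝ) ^ ((k : ℝ) * (k + 1) / 2) * (P : ℝ) ^ e' := by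
          gcongr
          linarith
      _ ≤ ((256 * k ^ 4) ^ k : ℝ) ^ ((k : ℝ) * (k + 1) / 2) * (P : ℝ) ^ e' := by gcongr
      _ ≤ D * Dr * (P : ℝ) ^ e' := by
          gcongr; exact hD1.trans (le_mul_of_one_le_right (by linarith) hDr)
  · push Not at hsm
    set Q : ℝ := (P : ℝ) ^ (1 / (k : ℝ)) with hQdef
    have hQk : Q ^ k = P := by
      rw [hQdef, ← rpow_natCast, ← rpow_mul hP0.le, one_div_mul_cancel (by linarith), rpow_one]
    have hQ0 : 0 ≤ Q := by positivity
    have hQ1 : 256 * (k : ℝ) ^ 4 < Q := by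
      by_contra hc; push Not at hc
      have := pow_le_pow_left₀ hQ0 hc k
      rw [hQk] at this; linarith
    have hm0 : ⌈Q⌉₊ ≠ 0 := by
      have : 0 < ⌈Q⌉₊ := Nat.ceil_pos.mpr (by linarith)
      omega
    obtain ⟨p, hp, hp1, hp2⟩ := Nat.exists_prime_lt_and_le_two_mul _ hm0
    have hpQ : Q ≤ p := (Nat.le_ceil Q).trans (by exact_mod_cast hp1.le)
    have hpQ2 : (p : ℝ) ≤ 4 * Q := by
      have h1 : (p : ℝ) ≤ 2 * ⌈Q⌉₊ := by exact_mod_cast hp2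
      have h2 := Nat.ceil_lt_add_one hQ0
      linarith
    have hp256 : 256 * (k : ℝ) ^ 4 ≤ p := by linarith
    have hkp : k < p := by
      have : (k : ℝ) < p := by
        have : (k : ℝ) ≤ (k : ℝ) ^ 4 := le_self_pow₀ (by linarith) (by norm_num)
        linarith
      exact_mod_cast this
    have hp0 : (0 : ℝ) < p := by linarith
    have hPp : P ≤ p ^ k := by
      have := pow_le_pow_left₀ hQ0 hpQ k
      rw [hQk] at this; exact_mod_cast this
    have hpP : (p : ℝ) ≤ P := by
      rw [← hQk]
      calc (p : ℝ) ≤ 4 * Q := hpQ2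
        _ ≤ Q ^ 2 := by rw [sq]; exact mul_le_mul_of_nonneg_right (by linarith) hQ0
        _ ≤ Q ^ k := pow_le_pow_right₀ (by linarith) hk
    have hL : ((P / p + 1 : ℕ) : ℝ) ≤ 2 * P / p := by
      have h1 : ((P / p : ℕ) : ℝ) ≤ (P : ℝ) / p := Nat.cast_div_le
      have h2 : 1 ≤ (P : ℝ) / p := by rwa [one_le_div hp0]
      push_cast; rw [mul_div_assoc]; push_cast at h1; linarith
    have hLP : P / p + 1 < P := by
      have : ((P / p + 1 : ℕ) : ℝ) < P := by
        refine lt_of_le_of_lt hL ?_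
        rw [div_lt_iff₀ hp0, mul_comm]
        exact mul_lt_mul_of_pos_left (by linarith) hP0
      exact_mod_cast this
    have i1 := ih (P / p + 1) (Nat.le_add_left 1 _)
    have i2 := IH (P / p + 1) hLP (Nat.le_add_left 1 _)
    have hst := step hn hs1 hp hkp hPp
    have he0 : 0 ≤ e := by rw [he, hkk2]; linarith
    have he'0 : 0 ≤ e' := le_trans (by positivity) he'1
    have j1 : J s k (Ioc 0 ((P / p + 1 : ℕ) : ℤ)) ≤ Dr * (2 * P / p : ℝ) ^ e :=
      i1.trans (by gcongr)
    have j2 : J n k (Ioc 0 ((P / p + 1 : ℕ) : ℤ)) ≤ D * Dr * (2 * P / p : ℝ) ^ e' :=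
      i2.trans (by gcongr)
    have f1 := it_first (p := p) hk (by linarith) hpQ2 hη0 hη he hs
    rw [hQk] at f1
    have f2 := it_second (p := p) hk (show k ^ 2 + k ≤ n by omega) hp256 he'1 he'2
    have t1 : 2 * (((n ^ k) ^ 2 * (p ^ (2 * s) * (k ^ k * p ^ (k * (k - 1) / 2) * P ^ k)) : ℕ) : ℝ)
        * J s k (Ioc 0 ((P / p + 1 : ℕ) : ℤ)) ≤ D * Dr * (P : ℝ) ^ e' / 2 := by
      calc _ ≤ 2 * (((n ^ k) ^ 2 * (p ^ (2 * s) * (k ^ k * p ^ (k * (k - 1) / 2) * P ^ k)) : ℕ) : ℝ)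
            * (Dr * (2 * P / p : ℝ) ^ e) := by gcongr
        _ = 2 * (n : ℝ) ^ (2 * k) * k ^ k * Dr * ((p : ℝ) ^ (2 * s) * (p ^ (k * (k - 1) / 2) * (P : ℝ) ^ k) * (2 * P / p) ^ e) := by
            push_cast; rw [mul_comm 2 k, pow_mul]; ring
        _ ≤ 2 * (n : ℝ) ^ (2 * k) * k ^ k * Dr * (2 ^ (2 * s) * 4 ^ k ^ 2 * (P : ℝ) ^ e') := by gcongr
        _ = (4 * (n : ℝ) ^ (2 * k) * k ^ k * 2 ^ (2 * s) * 4 ^ k ^ 2) * (Dr * (P : ℝ) ^ e' / 2) := by ring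
        _ ≤ D * (Dr * (P : ℝ) ^ e' / 2) := by gcongr
        _ = _ := by ring
    have t2 : 2 * (((p ^ k) ^ 2 * k ^ (2 * n) : ℕ) : ℝ) * J n k (Ioc 0 ((P / p + 1 : ℕ) : ℤ))
        ≤ D * Dr * (P : ℝ) ^ e' / 2 := by
      calc _ ≤ 2 * (((p ^ k) ^ 2 * k ^ (2 * n) : ℕ) : ℝ) * (D * Dr * (2 * P / p : ℝ) ^ e') := by gcongr
        _ = (4 * ((p : ℝ) ^ (2 * k) * (k : ℝ) ^ (2 * n)) * 2 ^ e') * ((D * Dr * P ^ e' / 2) / p ^ e') := by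
            rw [div_rpow (by positivity) hp0.le, mul_rpow (by norm_num) hP0.le]
            push_cast; rw [mul_comm 2 k, pow_mul]; field_simp; ring
        _ ≤ (p : ℝ) ^ e' * ((D * Dr * P ^ e' / 2) / p ^ e') := by gcongr
        _ = _ := by field_simp
    linarith

lemma vmvt {k : ℕ} (hk : 2 ≤ k) (P : ℕ) (hP : 1 ≤ P) :
    J (13 * k ^ 2) k (Ioc 0 (P : ℤ)) ≤ (k : ℝ) ^ (360 * k ^ 4) *
      (P : ℝ) ^ (26 * (k : ℝ) ^ 2 - k * (k + 1) / 2 + k * (k + 1) / 2 * exp (-12)) := by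
  have hk' : (2 : ℝ) ≤ k := by exact_mod_cast hk
  set D : ℝ := (k : ℝ) ^ (30 * k ^ 3) with hD
  set u : ℝ := 1 - 1 / k with hu
  have hu0 : 0 ≤ u := by rw [hu, sub_nonneg, div_le_one (by linarith)]; linarith
  have hu1 : u ≤ 1 := by rw [hu]; have : 0 ≤ 1 / (k : ℝ) := by positivity
                         linarith
  have hD1 : ((256 * k ^ 4) ^ k : ℝ) ^ ((k : ℝ) * (k + 1) / 2) ≤ D := by
    calc ((256 * k ^ 4) ^ k : ℝ) ^ ((k : ℝ) * (k + 1) / 2)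
        ≤ ((k : ℝ) ^ (12 * k)) ^ ((k : ℝ) ^ 2) := by
          apply rpow_le_rpow (by positivity) _ (by positivity) |>.trans
          · apply rpow_le_rpow_of_exponent_le
            · exact one_le_pow₀ (by linarith)
            · nlinarith
          · rw [pow_mul]
            apply pow_le_pow_left₀ (by positivity)
            have : (256 : ℝ) ≤ (k : ℝ) ^ 8 := by
              calc (256 : ℝ) = 2 ^ 8 := by norm_num
                _ ≤ _ := pow_le_pow_left₀ (by norm_num) hk' 8
            calc 256 * (k : ℝ) ^ 4 ≤ (k : ℝ) ^ 8 * k ^ 4 := by gcongr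
              _ = _ := by ring
      _ = (k : ℝ) ^ (12 * k ^ 3) := by
          rw [show ((k : ℝ) ^ 2) = ((k ^ 2 : ℕ) : ℝ) by push_cast; ring, rpow_natCast, ← pow_mul]
          congr 1; ring
      _ ≤ D := pow_le_pow_right₀ (by linarith) (by nlinarith [Nat.zero_le (k ^ 3)])
  have hD2 : ∀ s : ℕ, k + s ≤ 13 * k ^ 2 →
      4 * ((k + s : ℕ) : ℝ) ^ (2 * k) * k ^ k * 2 ^ (2 * s) * 4 ^ k ^ 2 ≤ D := by
    intro s hs
    have b1 : ((k + s : ℕ) : ℝ) ≤ (k : ℝ) ^ 6 := by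
      have h1 : ((k + s : ℕ) : ℝ) ≤ 13 * (k : ℝ) ^ 2 := by exact_mod_cast hs
      have h2 : (13 : ℝ) ≤ (k : ℝ) ^ 4 := by
        calc (13 : ℝ) ≤ 2 ^ 4 := by norm_num
          _ ≤ _ := pow_le_pow_left₀ (by norm_num) hk' 4
      calc _ ≤ _ := h1
        _ ≤ (k : ℝ) ^ 4 * k ^ 2 := by gcongr
        _ = _ := by ring
    have b2 : (4 : ℝ) ≤ (k : ℝ) ^ 2 := by nlinarith
    calc _ ≤ (k : ℝ) ^ 2 * ((k : ℝ) ^ 6) ^ (2 * k) * k ^ k * (k : ℝ) ^ (2 * s) * ((k : ℝ) ^ 2) ^ k ^ 2 := by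
          gcongr
      _ = (k : ℝ) ^ (2 + 12 * k + k + 2 * s + 2 * k ^ 2) := by
          simp only [← pow_mul, ← pow_add]; congr 1; ring
      _ ≤ D := by
        apply pow_le_pow_right₀ (by linarith)
        have : 2 * k ^ 2 ≤ k ^ 3 := by rw [pow_succ k 2]; nlinarith [Nat.zero_le (k ^ 2)]
        nlinarith
  have hD0 : 1 ≤ D := one_le_pow₀ (by linarith)
  have main : ∀ r ≤ 12 * k, ∀ P : ℕ, 1 ≤ P → J (k ^ 2 + k * r) k (Ioc 0 (P : ℤ)) ≤
      D ^ r * (P : ℝ) ^ (2 * ((k ^ 2 + k * r : ℕ) : ℝ) - k * (k + 1) / 2 + k * (k + 1) / 2 * u ^ r) := by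
    intro r
    induction r with
    | zero =>
      intro _ P hP
      have := J_triv (k ^ 2) k (Ioc 0 (P : ℤ))
      simp only [mul_zero, add_zero, pow_zero, mul_one, one_mul, sub_add_cancel]
      rw [show 2 * ((k ^ 2 : ℕ) : ℝ) = ((2 * k ^ 2 : ℕ) : ℝ) by push_cast; ring, rpow_natCast]
      simpa using this
    | succ r ih =>
      intro hr P hP
      have hur : u ^ r ≤ 1 := pow_le_one₀ hu0 hu1
      have := iter_step (k := k) (s := k ^ 2 + k * r) (n := k + (k ^ 2 + k * r)) (D := D) (Dr := D ^ r)
        (η := k * (k + 1) / 2 * u ^ r) hk rfl (by omega) (by positivity)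
        (mul_le_of_le_one_right (by positivity) hur) rfl (one_le_pow₀ hD0) hD1
        (hD2 _ (by nlinarith)) (ih (by omega)) P hP
      rw [show k ^ 2 + k * (r + 1) = k + (k ^ 2 + k * r) by ring, pow_succ' D]
      refine this.trans (le_of_eq ?_)
      congr 2
      push_cast
      rw [pow_succ u, hu]; field_simp; ring
  have hm := main (12 * k) le_rfl P hP
  rw [show k ^ 2 + k * (12 * k) = 13 * k ^ 2 by ring] at hm
  refine hm.trans ?_
  have hP1 : (1 : ℝ) ≤ P := by exact_mod_cast hP
  have hue : u ^ (12 * k) ≤ exp (-12) := by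
    have : u ≤ exp (-(1 / k)) := by
      have := Real.add_one_le_exp (-(1 / (k : ℝ))); rw [hu]; linarith
    calc u ^ (12 * k) ≤ exp (-(1 / k)) ^ (12 * k) := pow_le_pow_left₀ hu0 this _
      _ = _ := by rw [← Real.exp_nat_mul]; congr 1; push_cast; field_simp
  rw [hD, ← pow_mul, show 30 * k ^ 3 * (12 * k) = 360 * k ^ 4 by ring]
  refine mul_le_mul_of_nonneg_left (rpow_le_rpow_of_exponent_le hP1 ?_) (by positivity)
  have := mul_le_mul_of_nonneg_left hue (show 0 ≤ (k : ℝ) * (k + 1) / 2 by positivity)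
  push_cast; linarith

/-- additive character -/
noncomputable def ee (r : ℝ) : ℂ := Complex.exp ((2 * π * r : ℝ) * Complex.I)

lemma ee_norm (r : ℝ) : ‖ee r‖ = 1 := Complex.norm_exp_ofReal_mul_I _
lemma ee_zero : ee 0 = 1 := by simp [ee]
lemma ee_add (r r' : ℝ) : ee (r + r') = ee r * ee r' := by
  rw [ee, ee, ee, ← Complex.exp_add]; congr 1; push_cast; ring
lemma ee_neg (r : ℝ) : ee (-r) = conj (ee r) := by
  rw [ee, ee, ← Complex.exp_conj, map_mul, Complex.conj_ofReal, Complex.conj_I]; congr 1; push_cast; ring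
lemma ee_sum {ι : Type*} (s : Finset ι) (f : ι → ℝ) : ee (∑ i ∈ s, f i) = ∏ i ∈ s, ee (f i) := by
  classical
  induction s using Finset.induction_on with
  | empty => simp [ee_zero]
  | insert a s ha ih => rw [sum_insert ha, Finset.prod_insert ha, ee_add, ih]

/-- weighted pairing -/
noncomputable def br {k : ℕ} (α : Fin k → ℝ) (u v : Fin k → ℤ) : ℝ := ∑ j, α j * u j * v j

lemma br_comm {k : ℕ} (α : Fin k → ℝ) (u v : Fin k → ℤ) : br α u v = br α v u :=
  sum_congr rfl fun j _ => by ring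

lemma br_sub {k : ℕ} (α : Fin k → ℝ) (u v v' : Fin k → ℤ) : br α u (v - v') = br α u v + -br α u v' := by
  simp only [br, Pi.sub_apply, ← sum_neg_distrib, ← sum_add_distrib]
  exact sum_congr rfl fun j _ => by push_cast; ring

lemma br_ms {k s : ℕ} (α : Fin k → ℝ) (u : Fin k → ℤ) (x : Fin s → ℤ) :
    br α u (ms k x) = ∑ i, br α u (mo k (x i)) := by
  simp only [br]
  rw [sum_comm]
  refine sum_congr rfl fun j _ => ?_
  rw [ms_apply, ← mul_sum]; simp [mo]

/-- pairs of tuples -/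
def TT (s : ℕ) (A : Finset ℤ) : Finset ((Fin s → ℤ) × (Fin s → ℤ)) := tup s A ×ˢ tup s A

lemma TT_card (s : ℕ) (A : Finset ℤ) : #(TT s A) = #A ^ (2 * s) := by
  simp [TT, two_mul, pow_add]

lemma dual (k s : ℕ) (A : Finset ℤ) (α : Fin k → ℝ) (u : Fin k → ℤ) :
    ((‖∑ y ∈ A, ee (br α u (mo k y))‖ ^ (2 * s) : ℝ) : ℂ)
      = ∑ q ∈ TT s A, ee (br α u (ms k q.1 - ms k q.2)) := by
  have h1 : (∑ y ∈ A, ee (br α u (mo k y))) ^ s = ∑ x ∈ tup s A, ee (br α u (ms k x)) := by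
    simp_rw [br_ms, ee_sum]
    rw [tup, ← Finset.prod_univ_sum (fun _ => A) (fun _ a => ee (br α u (mo k a)))]; simp
  rw [pow_mul, ← Complex.normSq_eq_norm_sq]
  push_cast
  rw [← Complex.mul_conj, mul_pow, ← map_pow, h1, map_sum, sum_mul_sum, TT, sum_product]
  simp_rw [br_sub, ee_add, ee_neg]

/-- box of vectors -/
noncomputable def box (k s Y : ℕ) : Finset (Fin k → ℤ) :=
  Fintype.piFinset fun j => Icc (-((s * Y ^ (j.val + 1) : ℕ) : ℤ)) (s * Y ^ (j.val + 1) : ℕ)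

lemma TT_box {k s Y : ℕ} {q : (Fin s → ℤ) × (Fin s → ℤ)} (hq : q ∈ TT s (Ioc 0 (Y : ℤ))) :
    ms k q.1 - ms k q.2 ∈ box k s Y := by
  simp only [TT, mem_product, Fintype.mem_piFinset, mem_Ioc] at hq
  rw [box, Fintype.mem_piFinset]
  intro j
  have hb : ∀ x : Fin s → ℤ, (∀ i, 0 < x i ∧ x i ≤ Y) →
      0 ≤ ms k x j ∧ ms k x j ≤ (s * Y ^ (j.val + 1) : ℕ) := by
    intro x hx
    rw [ms_apply]
    refine ⟨sum_nonneg fun i _ => pow_nonneg (hx i).1.le _, ?_⟩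
    have := sum_le_sum (s := (Finset.univ : Finset (Fin s)))
      (fun i _ => pow_le_pow_left₀ (hx i).1.le (hx i).2 (j.val + 1))
    simpa using this
  have h1 := hb _ hq.1
  have h2 := hb _ hq.2
  rw [mem_Icc, Pi.sub_apply]
  constructor <;> linarith

lemma TT_sum (k s Y : ℕ) (h : (Fin k → ℤ) → ℝ) (hh : ∀ v, 0 ≤ h v) :
    ∑ q ∈ TT s (Ioc 0 (Y : ℤ)), h (ms k q.1 - ms k q.2)
      ≤ J s k (Ioc 0 (Y : ℤ)) * ∑ v ∈ box k s Y, h v := by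
  rw [← sum_fiberwise_of_maps_to (fun q hq => TT_box (k := k) hq), mul_sum]
  refine sum_le_sum fun v _ => ?_
  rw [sum_congr rfl (g := fun _ => h v) (fun q hq => by rw [(Finset.mem_filter.mp hq).2])]
  rw [sum_const, nsmul_eq_mul]
  refine mul_le_mul_of_nonneg_right ?_ (hh v)
  refine le_trans (le_of_eq ?_) (J_twist s k (Ioc 0 (Y : ℤ)) v)
  congr 2
  ext q
  simp only [TT, mem_filter, sub_eq_iff_eq_add]

/-- one-dimensional bilinear sum -/
noncomputable def Sg (a : ℝ) (V : ℕ) : ℝ :=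
  ∑ u ∈ Icc (-(V : ℤ)) V, ‖∑ v ∈ Icc (-(V : ℤ)) V, ee (a * u * v)‖

lemma double_holder (k s Y : ℕ) (hs : 1 ≤ s) (α : Fin k → ℝ) :
    ‖∑ x ∈ Ioc 0 (Y : ℤ), ∑ y ∈ Ioc 0 (Y : ℤ), ee (br α (mo k x) (mo k y))‖ ^ (2 * s * (2 * s))
      ≤ (Y : ℝ) ^ (2 * (2 * s * (2 * s - 1))) * (J s k (Ioc 0 (Y : ℤ))) ^ 2 *
        ∏ j : Fin k, Sg (α j) (s * Y ^ (j.val + 1)) := by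
  set A := Ioc 0 (Y : ℤ) with hA
  have hAc : #A = Y := by simp [A]
  have pm : ∀ {ι : Type} (S : Finset ι) (f : ι → ℝ), (∀ i, 0 ≤ f i) →
      (∑ i ∈ S, f i) ^ (2 * s) ≤ (#S : ℝ) ^ (2 * s - 1) * ∑ i ∈ S, f i ^ (2 * s) := by
    intro ι S f hf
    have h := pow_sum_div_card_le_sum_pow (s := S) (f := f) (fun i _ => hf i) (2 * s - 1)
    rw [Nat.sub_add_cancel (by omega)] at h
    rcases S.eq_empty_or_nonempty with rfl | hne
    · simp [show s ≠ 0 by omega]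
    · rw [div_le_iff₀ (by have := hne.card_pos; positivity)] at h
      exact h.trans (le_of_eq (mul_comm _ _))
  let g : (Fin k → ℤ) → ℝ := fun v => ‖∑ x ∈ A, ee (br α v (mo k x))‖
  -- general swap
  have swap : ∀ {ι : Type} (S : Finset ι) (f : ι → Fin k → ℤ), ∑ x ∈ S, g (f x) ^ (2 * s)
      ≤ ∑ q ∈ TT s A, ‖∑ x ∈ S, ee (br α (ms k q.1 - ms k q.2) (f x))‖ := by
    intro ι S f
    have h1 : ((∑ x ∈ S, g (f x) ^ (2 * s) : ℝ) : ℂ)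
        = ∑ q ∈ TT s A, ∑ x ∈ S, ee (br α (ms k q.1 - ms k q.2) (f x)) := by
      rw [sum_comm]
      rw [Complex.ofReal_sum]
      refine sum_congr rfl fun x _ => ?_
      simp only [g]
      rw [dual]
      exact sum_congr rfl fun q _ => by rw [br_comm]
    have h2 : ∑ x ∈ S, g (f x) ^ (2 * s) = ‖((∑ x ∈ S, g (f x) ^ (2 * s) : ℝ) : ℂ)‖ := by
      rw [Complex.norm_real, Real.norm_of_nonneg]
      exact sum_nonneg fun x _ => by positivity
    rw [h2, h1]
    exact norm_sum_le _ _
  have s1 : ‖∑ x ∈ A, ∑ y ∈ A, ee (br α (mo k x) (mo k y))‖ ^ (2 * s)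
      ≤ (Y : ℝ) ^ (2 * s - 1) * ∑ q ∈ TT s A, g (ms k q.1 - ms k q.2) := by
    calc _ ≤ (∑ x ∈ A, g (mo k x)) ^ (2 * s) := by
          refine pow_le_pow_left₀ (norm_nonneg _) (norm_sum_le _ _) _
      _ ≤ (#A : ℝ) ^ (2 * s - 1) * ∑ x ∈ A, g (mo k x) ^ (2 * s) := pm A _ fun x => norm_nonneg _
      _ ≤ _ := by
          rw [hAc]
          exact mul_le_mul_of_nonneg_left (swap A (mo k)) (by positivity)
  have s2 : (∑ q ∈ TT s A, g (ms k q.1 - ms k q.2)) ^ (2 * s)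
      ≤ (Y : ℝ) ^ (2 * s * (2 * s - 1)) * (J s k A * ∑ v ∈ box k s Y, g v ^ (2 * s)) := by
    refine (pm (TT s A) _ fun x => norm_nonneg _).trans ?_
    rw [TT_card, hAc]
    push_cast
    rw [← pow_mul]
    exact mul_le_mul_of_nonneg_left (TT_sum k s Y (fun v => g v ^ (2 * s)) fun v => by positivity) (by positivity)
  have s3 : ∑ v ∈ box k s Y, g v ^ (2 * s) ≤ J s k A * ∏ j : Fin k, Sg (α j) (s * Y ^ (j.val + 1)) := by
    refine (swap (box k s Y) id).trans ?_
    refine (TT_sum k s Y (fun u => ‖∑ v ∈ box k s Y, ee (br α u (id v))‖) fun v => norm_nonneg _).trans ?_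
    refine mul_le_mul_of_nonneg_left (le_of_eq ?_) (J_nonneg _ _ _)
    unfold Sg
    rw [Finset.prod_univ_sum]
    refine sum_congr rfl fun u _ => ?_
    rw [← norm_prod, Finset.prod_univ_sum]
    simp only [br, ee_sum, id]
    rfl
  have hJ := J_nonneg s k A
  calc _ = (‖∑ x ∈ A, ∑ y ∈ A, ee (br α (mo k x) (mo k y))‖ ^ (2 * s)) ^ (2 * s) := by rw [← pow_mul]
    _ ≤ ((Y : ℝ) ^ (2 * s - 1) * ∑ q ∈ TT s A, g (ms k q.1 - ms k q.2)) ^ (2 * s) :=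
        pow_le_pow_left₀ (by positivity) s1 _
    _ = (Y : ℝ) ^ (2 * s * (2 * s - 1)) * (∑ q ∈ TT s A, g (ms k q.1 - ms k q.2)) ^ (2 * s) := by
        rw [mul_pow, ← pow_mul]; congr 2; ring
    _ ≤ (Y : ℝ) ^ (2 * s * (2 * s - 1)) * ((Y : ℝ) ^ (2 * s * (2 * s - 1)) *
        (J s k A * (J s k A * ∏ j : Fin k, Sg (α j) (s * Y ^ (j.val + 1))))) := by
        refine mul_le_mul_of_nonneg_left (s2.trans ?_) (by positivity)
        gcongr
    _ = _ := by rw [two_mul (2 * s * (2 * s - 1)), pow_add]; ring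

lemma Icc_succ_symm (V : ℕ) : Icc (-((V + 1 : ℕ) : ℤ)) ((V + 1 : ℕ) : ℤ)
    = insert ((V : ℤ) + 1) (insert (-((V : ℤ) + 1)) (Icc (-(V : ℤ)) V)) := by
  ext x; simp only [mem_Icc, mem_insert]; push_cast; omega

lemma sum_Icc_succ_symm {M : Type*} [AddCommMonoid M] (V : ℕ) (f : ℤ → M) :
    ∑ x ∈ Icc (-((V + 1 : ℕ) : ℤ)) ((V + 1 : ℕ) : ℤ), f x
    = f ((V : ℤ) + 1) + (f (-((V : ℤ) + 1)) + ∑ x ∈ Icc (-(V : ℤ)) V, f x) := by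
  rw [Icc_succ_symm, sum_insert, sum_insert]
  · simp
  · simp only [mem_insert, mem_Icc]; omega

lemma ee_sub_one (b : ℝ) (hb : |b| ≤ 1 / 2) : 4 * |b| ≤ ‖ee b - 1‖ := by
  have h1 : ‖ee b - 1‖ = 2 * |Real.sin (π * b)| := by
    have : ee b - 1 = ee (b / 2) * (ee (b / 2) - ee (-(b / 2))) := by
      rw [mul_sub, ← ee_add, ← ee_add]; simp [ee_zero]
    rw [this, norm_mul, ee_norm, one_mul]
    have h2 : ee (b / 2) - ee (-(b / 2)) = ((2 * Real.sin (π * b) : ℝ) : ℂ) * Complex.I := by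
      rw [ee_neg, ee, Complex.sub_conj, Complex.exp_ofReal_mul_I_im]
      congr 3; ring_nf
    rw [h2, norm_mul, Complex.norm_I, mul_one, Complex.norm_real, Real.norm_eq_abs, abs_mul]; norm_num
  rw [h1]
  have h3 := Real.mul_abs_le_abs_sin (x := π * b) (by rw [abs_mul, abs_of_pos pi_pos]; nlinarith [pi_pos])
  rw [abs_mul, abs_of_pos pi_pos] at h3
  have : 2 / π * (π * |b|) = 2 * |b| := by field_simp
  linarith

lemma geom_bound (b : ℝ) (hb0 : b ≠ 0) (hb : |b| ≤ 1 / 2) (V : ℕ) :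
    ‖∑ v ∈ Icc (-(V : ℤ)) V, ee (b * v)‖ ≤ 1 / (2 * |b|) := by
  have h : ∀ V : ℕ, (ee b - 1) * ∑ v ∈ Icc (-(V : ℤ)) V, ee (b * v)
      = ee (b * (V + 1)) - ee (-(b * V)) := by
    intro V
    induction V with
    | zero => simp [ee_zero]
    | succ V ih =>
      rw [sum_Icc_succ_symm, mul_add, mul_add, ih, sub_mul, sub_mul, ← ee_add, ← ee_add]
      push_cast
      rw [show b + b * ((V : ℝ) + 1) = b * (V + 1 + 1) by ring,
        show b + b * -((V : ℝ) + 1) = -(b * V) by ring,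
        show b * -((V : ℝ) + 1) = -(b * (V + 1)) by ring]
      ring
  have h1 := congrArg norm (h V)
  rw [norm_mul] at h1
  have h2 : ‖ee (b * (V + 1)) - ee (-(b * V))‖ ≤ 2 := by
    refine (norm_sub_le _ _).trans ?_; rw [ee_norm, ee_norm]; norm_num
  have h3 := ee_sub_one b hb
  have hb' : 0 < |b| := abs_pos.mpr hb0
  rw [le_div_iff₀ (by positivity)]
  nlinarith [norm_nonneg (∑ v ∈ Icc (-(V : ℤ)) V, ee (b * v))]

lemma inner_triv (b : ℝ) (V : ℕ) : ‖∑ v ∈ Icc (-(V : ℤ)) V, ee (b * v)‖ ≤ 2 * V + 1 := by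
  refine (norm_sum_le _ _).trans ?_
  simp_rw [ee_norm]
  simp only [sum_const, Int.card_Icc, nsmul_eq_mul, mul_one]
  have : (((V : ℤ) + 1 - -(V : ℤ)).toNat : ℝ) = (((V : ℤ) + 1 - -(V : ℤ)).toNat : ℤ) := by norm_cast
  rw [this, Int.toNat_of_nonneg (by omega)]; push_cast; linarith

lemma Sg_nonneg (a : ℝ) (V : ℕ) : 0 ≤ Sg a V := sum_nonneg fun _ _ => norm_nonneg _

lemma Sg_triv (a : ℝ) (V : ℕ) (hV : 1 ≤ V) : Sg a V ≤ 9 * (V : ℝ) ^ 2 := by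
  have hV' : (1 : ℝ) ≤ V := by exact_mod_cast hV
  have : Sg a V ≤ ∑ u ∈ Icc (-(V : ℤ)) V, (2 * V + 1 : ℝ) :=
    sum_le_sum fun u _ => inner_triv _ _
  rw [sum_const, Int.card_Icc, nsmul_eq_mul] at this
  have h2 : (((V : ℤ) + 1 - -(V : ℤ)).toNat : ℝ) = (((V : ℤ) + 1 - -(V : ℤ)).toNat : ℤ) := by norm_cast
  rw [h2, Int.toNat_of_nonneg (by omega)] at this
  push_cast at this
  nlinarith

lemma sum_symm_le (f : ℤ → ℝ) (B c : ℝ) (V : ℕ) (h0 : f 0 ≤ B)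
    (h : ∀ u : ℤ, u ≠ 0 → |u| ≤ V → f u ≤ c / |(u : ℝ)|) :
    ∑ u ∈ Icc (-(V : ℤ)) V, f u ≤ B + 2 * c * harmonic V := by
  have : ∀ U : ℕ, U ≤ V → ∑ u ∈ Icc (-(U : ℤ)) U, f u ≤ B + 2 * c * harmonic U := by
    intro U
    induction U with
    | zero => intro _; simpa using h0
    | succ U ih =>
      intro hU
      rw [sum_Icc_succ_symm, harmonic_succ]
      have i1 := ih (by omega)
      have i2 := h ((U : ℤ) + 1) (by omega) (by rw [abs_of_pos (by omega)]; omega)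
      have i3 := h (-((U : ℤ) + 1)) (by omega) (by rw [abs_neg, abs_of_pos (by omega)]; omega)
      have p : (0 : ℝ) < U + 1 := by positivity
      push_cast at i2 i3 ⊢
      rw [abs_neg] at i3
      rw [abs_of_pos p] at i2 i3
      rw [div_eq_mul_inv] at i2 i3
      linarith
  exact this V le_rfl

lemma Sg_good (a : ℝ) (V : ℕ) (hV : 1 ≤ V) (ha : a ≠ 0) (haV : |a| * V ≤ 1 / 2) :
    Sg a V ≤ 3 * V + (1 + log V) / |a| := by
  have hV' : (1 : ℝ) ≤ V := by exact_mod_cast hV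
  have ha' : 0 < |a| := abs_pos.mpr ha
  have h1 := sum_symm_le (fun u : ℤ => ‖∑ v ∈ Icc (-(V : ℤ)) V, ee (a * u * v)‖)
    (3 * V) (1 / (2 * |a|)) V ((inner_triv _ _).trans (by linarith)) (by
      intro u hu huV
      have hu' : (u : ℝ) ≠ 0 := by exact_mod_cast hu
      have huV' : |(u : ℝ)| ≤ V := by exact_mod_cast huV
      have := geom_bound (a * u) (mul_ne_zero ha hu') (by
        rw [abs_mul]; nlinarith) V
      refine this.trans (le_of_eq ?_)
      rw [abs_mul]; field_simp)
  refine h1.trans ?_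
  have h2 := harmonic_le_one_add_log V
  have : 2 * (1 / (2 * |a|)) * (harmonic V : ℝ) = harmonic V / |a| := by field_simp
  rw [this]
  gcongr

lemma Sg_e1 {N t l n : ℝ} {Y m : ℕ} (hN0 : 0 < N) (hN1 : 1 ≤ N) (hn0 : 0 < n) (hn2 : n ≤ 2 * N)
    (hm2 : m ≤ 4 * l) (h2N : (2 : ℝ) ≤ N ^ (1 / 96 : ℝ))
    (hY1 : N ^ (7 / 16 : ℝ) / 2 ≤ Y) (htp : ∀ c : ℝ, t ^ c = N ^ (l * c)) :
    n ^ m ≤ t ^ (3 / 4 - 1 / 8 : ℝ) * (Y : ℝ) ^ (2 * m) := by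
  have h8 : 8 * N ≤ N ^ (1 / 32 + 1 : ℝ) := by
    rw [rpow_add hN0, rpow_one]
    refine mul_le_mul_of_nonneg_right ?_ hN0.le
    calc (8 : ℝ) = 2 ^ 3 := by norm_num
      _ ≤ (N ^ (1 / 96 : ℝ)) ^ 3 := pow_le_pow_left₀ (by norm_num) h2N 3
      _ = _ := by rw [← rpow_natCast, ← rpow_mul hN0.le]; norm_num
  have hN4 : 0 < (4 : ℝ) ^ m := by positivity
  calc n ^ m ≤ (2 * N) ^ m := pow_le_pow_left₀ hn0.le hn2 m
    _ = (8 * N) ^ m / 4 ^ m := by rw [← div_pow]; congr 1; ring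
    _ ≤ (N ^ (1 / 32 + 1 : ℝ)) ^ m / 4 ^ m :=
        div_le_div_of_nonneg_right (pow_le_pow_left₀ (by linarith) h8 m) hN4.le
    _ = N ^ ((1 / 32 + 1) * m : ℝ) / 4 ^ m := by rw [rpow_mul hN0.le, rpow_natCast]
    _ ≤ N ^ (l * (3 / 4 - 1 / 8) + 7 / 16 * (2 * m : ℕ)) / 4 ^ m := by
        refine div_le_div_of_nonneg_right (rpow_le_rpow_of_exponent_le hN1 ?_) hN4.le
        push_cast; linarith
    _ = t ^ (3 / 4 - 1 / 8 : ℝ) * (N ^ (7 / 16 : ℝ) / 2) ^ (2 * m) := by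
        rw [rpow_add hN0, htp, rpow_mul hN0.le (7 / 16 : ℝ), rpow_natCast, div_pow, pow_mul (2 : ℝ),
          mul_div_assoc]
        norm_num
    _ ≤ _ := by
        refine mul_le_mul_of_nonneg_left (pow_le_pow_left₀ (by positivity) hY1 _) ?_
        rw [htp]; positivity

set_option maxHeartbeats 800000 in
lemma Sg_save {N t l n a : ℝ} {Y m s : ℕ} (hN : 2 ^ 96 ≤ N) (ht : t = N ^ l) (hl : 1 / 2 ≤ l)
    (hm1 : 2 * l ≤ m) (hm2 : m ≤ 4 * l) (hms : m ≤ s) (hn1 : N ≤ n) (hn2 : n ≤ 2 * N)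
    (ha : |a| = t / (2 * π * m * n ^ m)) (hY1 : N ^ (7 / 16 : ℝ) / 2 ≤ Y) (hY2 : Y ≤ N ^ (7 / 16 : ℝ))
    (hT1 : 2 * π * (2 + 1.75 * log t) ≤ 4.5 * t ^ (1 / 4 : ℝ))
    (hT2 : s ≤ 3 * t ^ (1 / 8 : ℝ)) :
    Sg a (s * Y ^ m) ≤ 9 * ((s * Y ^ m : ℕ) : ℝ) ^ 2 * t ^ (-(1 / 8) : ℝ) := by
  have hN0 : 0 < N := by linarith
  have hN1 : 1 ≤ N := by linarith
  have ht1 : 1 ≤ t := by rw [ht]; exact one_le_rpow hN1 (by linarith)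
  have ht0 : 0 < t := by linarith
  have hn0 : 0 < n := by linarith
  have hm0 : 1 ≤ m := by
    have : (1 : ℝ) ≤ m := by linarith
    exact_mod_cast this
  have hm0' : (1 : ℝ) ≤ m := by exact_mod_cast hm0
  have hms' : (m : ℝ) ≤ s := by exact_mod_cast hms
  have hs1 : (1 : ℝ) ≤ s := by linarith
  have hp := pi_gt_three
  have htp : ∀ c : ℝ, t ^ c = N ^ (l * c) := fun c => by rw [ht, ← rpow_mul hN0.le]
  have h2N : (2 : ℝ) ≤ N ^ (1 / 96 : ℝ) := by
    calc (2 : ℝ) = ((2 : ℝ) ^ (96 : ℝ)) ^ (1 / 96 : ℝ) := by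
          rw [← rpow_mul (by norm_num)]; norm_num
      _ ≤ _ := rpow_le_rpow (by positivity) (by exact_mod_cast hN) (by norm_num)
  have h2N' : (2 : ℝ) ≤ N ^ (1 / 16 : ℝ) :=
    h2N.trans (rpow_le_rpow_of_exponent_le hN1 (by norm_num))
  have hYlow : N ^ (3 / 8 : ℝ) ≤ Y := by
    refine le_trans ?_ hY1
    rw [le_div_iff₀ (by norm_num)]
    calc N ^ (3 / 8 : ℝ) * 2 ≤ N ^ (3 / 8 : ℝ) * N ^ (1 / 16 : ℝ) := by gcongr
      _ = _ := by rw [← rpow_add hN0]; norm_num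
  have hY1' : (1 : ℝ) ≤ Y := le_trans (one_le_rpow hN1 (by norm_num)) hYlow
  have hV : (1 : ℝ) ≤ ((s * Y ^ m : ℕ) : ℝ) := by
    push_cast
    have := one_le_pow₀ hY1' (n := m)
    nlinarith
  set V : ℕ := s * Y ^ m with hVdef
  have hVeq : (V : ℝ) = s * (Y : ℝ) ^ m := by rw [hVdef]; push_cast; ring
  have ha0 : 0 < |a| := by rw [ha]; positivity
  have hnm : N ^ (m : ℝ) ≤ n ^ m := by rw [rpow_natCast]; exact pow_le_pow_left₀ hN0.le hn1 m
  have hYm : (Y : ℝ) ^ m ≤ N ^ (7 / 16 * m : ℝ) := by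
    rw [rpow_mul hN0.le, rpow_natCast]; exact pow_le_pow_left₀ (by positivity) hY2 m
  -- (iii)
  have haV : |a| * V ≤ 1 / 2 := by
    rw [ha, hVeq]
    have e1 : t * (Y : ℝ) ^ m ≤ t ^ (-(1 / 8) : ℝ) * n ^ m := by
      calc t * (Y : ℝ) ^ m ≤ N ^ l * N ^ (7 / 16 * m : ℝ) := by rw [ht]; gcongr
        _ = N ^ (l + 7 / 16 * m) := by rw [rpow_add hN0]
        _ ≤ N ^ (l * (-(1 / 8)) + m) := rpow_le_rpow_of_exponent_le hN1 (by linarith)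
        _ = t ^ (-(1 / 8) : ℝ) * N ^ (m : ℝ) := by rw [rpow_add hN0, htp]
        _ ≤ _ := by gcongr
    have e2 : (s : ℝ) * t ^ (-(1 / 8) : ℝ) ≤ 3 := by
      rw [rpow_neg ht0.le, ← div_eq_mul_inv, div_le_iff₀ (by positivity)]; exact hT2
    rw [div_mul_eq_mul_div, div_le_iff₀ (by positivity)]
    calc t * (s * (Y : ℝ) ^ m) = s * (t * (Y : ℝ) ^ m) := by ring
      _ ≤ s * (t ^ (-(1 / 8) : ℝ) * n ^ m) := by gcongr
      _ = (s * t ^ (-(1 / 8) : ℝ)) * n ^ m := by ring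
      _ ≤ 3 * n ^ m := by gcongr
      _ ≤ π * m * n ^ m := by gcongr; nlinarith
      _ = _ := by ring
  have hg := Sg_good a V (by exact_mod_cast hV) (abs_pos.mp ha0) haV
  refine hg.trans ?_
  -- (i)
  have i1 : 3 * (V : ℝ) ≤ 9 / 2 * (V : ℝ) ^ 2 * t ^ (-(1 / 8) : ℝ) := by
    have : t ^ (1 / 8 : ℝ) ≤ V := by
      calc t ^ (1 / 8 : ℝ) = N ^ (l * (1 / 8)) := htp _
        _ ≤ N ^ (3 / 8 * m : ℝ) := rpow_le_rpow_of_exponent_le hN1 (by linarith)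
        _ = (N ^ (3 / 8 : ℝ)) ^ m := by rw [rpow_mul hN0.le, rpow_natCast]
        _ ≤ (Y : ℝ) ^ m := pow_le_pow_left₀ (by positivity) hYlow m
        _ ≤ V := by rw [hVeq]; exact le_mul_of_one_le_left (by positivity) hs1
    have h1 : 1 ≤ V * t ^ (-(1 / 8) : ℝ) := by
      rw [rpow_neg ht0.le, ← div_eq_mul_inv, one_le_div (by positivity)]; exact this
    nlinarith
  have hlogV : 1 + log V ≤ s * (2 + 1.75 * log t) := by
    rw [hVeq, Real.log_mul (by linarith) (by positivity), Real.log_pow]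
    have h1 : log s ≤ s - 1 := Real.log_le_sub_one_of_pos (by linarith)
    have h2 : log Y ≤ 7 / 16 * log N := by
      rw [← Real.log_rpow hN0]; exact Real.log_le_log (by linarith) hY2
    have h3 : log t = l * log N := by rw [ht, Real.log_rpow hN0]
    have h4 : 0 ≤ log N := Real.log_nonneg hN1
    have h5 : m * log Y ≤ 4 * l * (7 / 16 * log N) := by
      have : 0 ≤ log Y := Real.log_nonneg hY1'
      exact mul_le_mul hm2 h2 this (by linarith)
    have h6 : 0 ≤ log t := Real.log_nonneg ht1
    nlinarith
  have i2 : (1 + log V) / |a| ≤ 9 / 2 * (V : ℝ) ^ 2 * t ^ (-(1 / 8) : ℝ) := by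
    rw [ha, div_div_eq_mul_div, div_le_iff₀ ht0]
    have e1 := Sg_e1 hN0 hN1 hn0 hn2 hm2 h2N hY1 htp
    calc (1 + log V) * (2 * π * m * n ^ m)
        ≤ (s * (2 + 1.75 * log t)) * (2 * π * s * (t ^ (3 / 4 - 1 / 8 : ℝ) * (Y : ℝ) ^ (2 * m))) := by
          gcongr
          · have : 0 ≤ log t := Real.log_nonneg ht1
            positivity
      _ = (2 * π * (2 + 1.75 * log t)) * (s ^ 2 * (t ^ (3 / 4 - 1 / 8 : ℝ) * (Y : ℝ) ^ (2 * m))) := by ring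
      _ ≤ (4.5 * t ^ (1 / 4 : ℝ)) * (s ^ 2 * (t ^ (3 / 4 - 1 / 8 : ℝ) * (Y : ℝ) ^ (2 * m))) := by gcongr
      _ = 9 / 2 * (s * (Y : ℝ) ^ m) ^ 2 * (t ^ (1 / 4 : ℝ) * t ^ (3 / 4 - 1 / 8 : ℝ)) := by ring
      _ = 9 / 2 * (V : ℝ) ^ 2 * (t ^ (-(1 / 8) : ℝ) * t ^ (1 : ℝ)) := by
          rw [← rpow_add ht0, ← rpow_add ht0, hVeq]; norm_num
      _ = _ := by rw [rpow_one]; ring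
  linarith

lemma card_good {k : ℕ} {l : ℝ} (hl : 1 / 2 ≤ l) (hk : 4 * l ≤ k) :
    l ≤ #((Finset.univ : Finset (Fin k)).filter
      (fun j => 2 * l ≤ ((j.val + 1 : ℕ) : ℝ) ∧ ((j.val + 1 : ℕ) : ℝ) ≤ 4 * l)) := by
  classical
  have h1 : ⌊2 * l⌋₊ ≤ #((Finset.univ : Finset (Fin k)).filter
      (fun j => 2 * l ≤ ((j.val + 1 : ℕ) : ℝ) ∧ ((j.val + 1 : ℕ) : ℝ) ≤ 4 * l)) := by
    have hc0 := Nat.le_ceil (2 * l)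
    have hc1 := Nat.ceil_lt_add_one (show 0 ≤ 2 * l by linarith)
    have hf := Nat.floor_le (show 0 ≤ 2 * l by linarith)
    have hcpos : 0 < ⌈2 * l⌉₊ := Nat.ceil_pos.mpr (by linarith)
    have key : ∀ i ∈ range ⌊2 * l⌋₊, ((⌈2 * l⌉₊ - 1 + i + 1 : ℕ) : ℝ) ≤ 4 * l := by
      intro i hi
      have : i + 1 ≤ ⌊2 * l⌋₊ := Finset.mem_range.mp hi
      have : (i : ℝ) + 1 ≤ ⌊2 * l⌋₊ := by exact_mod_cast this
      have e : ((⌈2 * l⌉₊ - 1 + i + 1 : ℕ) : ℝ) = ⌈2 * l⌉₊ + i := by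
        have : ⌈2 * l⌉₊ - 1 + i + 1 = ⌈2 * l⌉₊ + i := by omega
        rw [this]; push_cast; ring
      rw [e]; linarith
    rw [← Finset.card_range ⌊2 * l⌋₊]
    have hlt : ∀ i ∈ range ⌊2 * l⌋₊, ⌈2 * l⌉₊ - 1 + i < k := by
      intro i hi
      have := (key i hi).trans hk
      have : ⌈2 * l⌉₊ - 1 + i + 1 ≤ k := by exact_mod_cast this
      omega
    have hkpos : 0 < k := by
      have : (0 : ℝ) < k := by linarith
      exact_mod_cast this
    refine Finset.card_le_card_of_injOn (fun i => if h : ⌈2 * l⌉₊ - 1 + i < k then ⟨_, h⟩ else ⟨0, hkpos⟩) ?_ ?_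
    · intro i hi
      have hi' := Finset.mem_coe.mp hi
      simp only [dif_pos (hlt i hi')]
      simp only [Finset.coe_filter, mem_univ, true_and, Set.mem_ofPred_eq]
      refine ⟨?_, key i hi'⟩
      have : ⌈2 * l⌉₊ - 1 + i + 1 = ⌈2 * l⌉₊ + i := by omega
      rw [this]; push_cast
      have : (0 : ℝ) ≤ i := by positivity
      linarith
    · intro i hi i' hi' h
      simp only [dif_pos (hlt i (Finset.mem_coe.mp hi)), dif_pos (hlt i' (Finset.mem_coe.mp hi')),
        Fin.mk.injEq] at h
      omega
  have h2 : l ≤ ⌊2 * l⌋₊ := by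
    have a1 := Nat.lt_floor_add_one (2 * l)
    have a2 : 1 ≤ ⌊2 * l⌋₊ := Nat.le_floor (by push_cast; linarith)
    have a2' : (1 : ℝ) ≤ ⌊2 * l⌋₊ := by exact_mod_cast a2
    rcases le_total l 1 with h | h <;> linarith
  exact h2.trans (by exact_mod_cast h1)

set_option maxHeartbeats 800000 in
lemma W_bound {N t l n : ℝ} {Y k : ℕ} (hN : 2 ^ 96 ≤ N) (ht : t = N ^ l) (hl : 1 / 2 ≤ l)
    (hk1 : 4 * l ≤ k) (hk0 : 2 ≤ k) (hk2 : k ≤ 24 * l) (hn1 : N ≤ n) (hn2 : n ≤ 2 * N)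
    (α : Fin k → ℝ) (hα : ∀ j, |α j| = t / (2 * π * ((j.val + 1 : ℕ) : ℝ) * n ^ (j.val + 1)))
    (hY1 : N ^ (7 / 16 : ℝ) / 2 ≤ Y) (hY2 : Y ≤ N ^ (7 / 16 : ℝ))
    (hT1 : 2 * π * (2 + 1.75 * log t) ≤ 4.5 * t ^ (1 / 4 : ℝ))
    (hT2 : 13 * (k : ℝ) ^ 2 ≤ 3 * t ^ (1 / 8 : ℝ)) :
    ‖∑ x ∈ Ioc 0 (Y : ℤ), ∑ y ∈ Ioc 0 (Y : ℤ), ee (br α (mo k x) (mo k y))‖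
      ≤ (Y : ℝ) ^ 2 * k ^ 2 * N ^ (-(l ^ 2 / (10816 * k ^ 4)) : ℝ) := by
  classical
  have hN0 : 0 < N := by linarith
  have hN1 : 1 ≤ N := by linarith
  have ht1 : 1 ≤ t := by rw [ht]; exact one_le_rpow hN1 (by linarith)
  have ht0 : 0 < t := by linarith
  have hk' : (2 : ℝ) ≤ k := by exact_mod_cast hk0
  set s : ℕ := 13 * k ^ 2 with hs
  have hY0 : (0 : ℝ) < Y := lt_of_lt_of_le (by positivity) hY1
  have hY1' : 1 ≤ Y := by exact_mod_cast hY0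
  have hYr : (1 : ℝ) ≤ Y := by exact_mod_cast hY1'
  have hs1 : 1 ≤ s := by rw [hs]; nlinarith
  have hprod : ∏ j : Fin k, Sg (α j) (s * Y ^ (j.val + 1)) ≤
      9 ^ k * (s : ℝ) ^ (2 * k) * (Y : ℝ) ^ (k * (k + 1)) * t ^ (-(l / 8)) := by
    set p : Fin k → Prop := fun j => 2 * l ≤ ((j.val + 1 : ℕ) : ℝ) ∧ ((j.val + 1 : ℕ) : ℝ) ≤ 4 * l with hp
    calc ∏ j : Fin k, Sg (α j) (s * Y ^ (j.val + 1))
        ≤ ∏ j : Fin k, (9 * (((s * Y ^ (j.val + 1) : ℕ) : ℝ)) ^ 2 * if p j then t ^ (-(1 / 8) : ℝ) else 1) := by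
          refine Finset.prod_le_prod (fun j _ => Sg_nonneg _ _) fun j _ => ?_
          split_ifs with h
          · refine Sg_save hN ht hl h.1 h.2 ?_ hn1 hn2 (hα j) hY1 hY2 hT1 (by rw [hs]; push_cast; exact hT2)
            have := j.2
            rw [hs]; nlinarith
          · rw [mul_one]
            exact Sg_triv _ _ (Nat.one_le_iff_ne_zero.mpr (by positivity))
      _ = 9 ^ k * (s : ℝ) ^ (2 * k) * (Y : ℝ) ^ (k * (k + 1)) *
            (t ^ (-(1 / 8) : ℝ)) ^ #((Finset.univ : Finset (Fin k)).filter p) := by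
          rw [Finset.prod_mul_distrib, Finset.prod_ite]
          simp only [Finset.prod_const, one_pow, mul_one]
          congr 1
          push_cast
          simp only [mul_pow, Finset.prod_mul_distrib, Finset.prod_const, Finset.card_univ, Fintype.card_fin,
            ← pow_mul, Finset.prod_pow_eq_pow_sum]
          have : ∀ k : ℕ, ∑ j : Fin k, (j.val + 1) * 2 = k * (k + 1) := by
            intro k
            induction k with
            | zero => simp
            | succ k ih => rw [Fin.sum_univ_castSucc]; simp only [Fin.val_castSucc, Fin.val_last, ih]; ring
          rw [this]; ring
      _ ≤ _ := by
          refine mul_le_mul_of_nonneg_left ?_ (by positivity)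
          rw [← rpow_natCast, ← rpow_mul ht0.le]
          refine rpow_le_rpow_of_exponent_le ht1 ?_
          have := card_good hl hk1
          linarith
  have hJ := vmvt hk0 Y hY1'
  have hJ0 := J_nonneg s k (Ioc 0 (Y : ℤ))
  have hmain := double_holder k s Y hs1 α
  set W := ‖∑ x ∈ Ioc 0 (Y : ℤ), ∑ y ∈ Ioc 0 (Y : ℤ), ee (br α (mo k x) (mo k y))‖ with hW
  have hexp : exp (-12) ≤ 1 / 4368 := by
    rw [Real.exp_neg, ← one_div]
    refine one_div_le_one_div_of_le (by norm_num) ?_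
    have := Real.exp_one_gt_d9
    calc (4368 : ℝ) ≤ 2.7 ^ 12 := by norm_num
      _ ≤ exp 1 ^ 12 := pow_le_pow_left₀ (by norm_num) (by linarith) _
      _ = exp 12 := by rw [← Real.exp_nat_mul]; norm_num
  have hε : (Y : ℝ) ^ ((k : ℝ) * (k + 1) * exp (-12)) ≤ N ^ (l ^ 2 / 16) := by
    calc (Y : ℝ) ^ ((k : ℝ) * (k + 1) * exp (-12))
        ≤ (N ^ (7 / 16 : ℝ)) ^ ((k : ℝ) * (k + 1) * exp (-12)) :=
          rpow_le_rpow hY0.le hY2 (by positivity)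
      _ = N ^ (7 / 16 * ((k : ℝ) * (k + 1) * exp (-12))) := by rw [← rpow_mul hN0.le]
      _ ≤ _ := by
          refine rpow_le_rpow_of_exponent_le hN1 ?_
          have h1 : (k : ℝ) * (k + 1) ≤ (24 * l) * (26 * l) := by
            apply mul_le_mul hk2 (by linarith) (by positivity) (by linarith)
          have h2 := mul_le_mul h1 hexp (Real.exp_pos _).le (by positivity)
          nlinarith
  have hnat : 2 * s * (2 * s) = 676 * k ^ 4 := by rw [hs]; ring
  have hsr : (s : ℝ) = 13 * (k : ℝ) ^ 2 := by rw [hs]; push_cast; ring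
  rw [hnat] at hmain
  have hYexp : (Y : ℝ) ^ (2 * (2 * s * (2 * s - 1))) * ((Y : ℝ) ^ (26 * (k : ℝ) ^ 2 - k * (k + 1) / 2 + k * (k + 1) / 2 * exp (-12))) ^ 2
      * (Y : ℝ) ^ (k * (k + 1)) = ((Y : ℝ) ^ 2) ^ (676 * k ^ 4) * (Y : ℝ) ^ ((k : ℝ) * (k + 1) * exp (-12)) := by
    rw [← rpow_natCast (Y : ℝ) (2 * (2 * s * (2 * s - 1))), ← pow_mul (Y : ℝ), ← rpow_natCast (Y : ℝ) (k * (k + 1)),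
      ← rpow_natCast (Y : ℝ) (2 * (676 * k ^ 4)), ← rpow_natCast _ 2, ← rpow_mul hY0.le, ← rpow_add hY0, ← rpow_add hY0,
      ← rpow_add hY0]
    congr 1
    push_cast [Nat.cast_sub (show 1 ≤ 2 * s by omega)]
    rw [hsr]; ring
  have hcst : (k : ℝ) ^ (720 * k ^ 4) * (9 ^ k * (s : ℝ) ^ (2 * k)) ≤ ((k : ℝ) ^ 2) ^ (676 * k ^ 4) := by
    have b1 : 9 * (s : ℝ) ^ 2 ≤ (k : ℝ) ^ 16 := by
      rw [hsr]
      have : (1521 : ℝ) ≤ (k : ℝ) ^ 12 := by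
        calc (1521 : ℝ) ≤ 2 ^ 12 := by norm_num
          _ ≤ _ := pow_le_pow_left₀ (by norm_num) hk' 12
      calc 9 * (13 * (k : ℝ) ^ 2) ^ 2 = 1521 * k ^ 4 := by ring
        _ ≤ (k : ℝ) ^ 12 * k ^ 4 := by gcongr
        _ = _ := by ring
    calc (k : ℝ) ^ (720 * k ^ 4) * (9 ^ k * (s : ℝ) ^ (2 * k))
        = (k : ℝ) ^ (720 * k ^ 4) * (9 * (s : ℝ) ^ 2) ^ k := by rw [mul_pow, ← pow_mul]
      _ ≤ (k : ℝ) ^ (720 * k ^ 4) * ((k : ℝ) ^ 16) ^ k := by gcongr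
      _ = (k : ℝ) ^ (720 * k ^ 4 + 16 * k) := by rw [← pow_mul, ← pow_add]
      _ ≤ (k : ℝ) ^ (2 * (676 * k ^ 4)) := by
          refine pow_le_pow_right₀ (by linarith) ?_
          have : k ≤ k ^ 4 := Nat.le_self_pow (by norm_num) k
          omega
      _ = _ := by rw [← pow_mul]
  have htN : N ^ (l ^ 2 / 16) * t ^ (-(l / 8)) = (N ^ (-(l ^ 2 / (10816 * k ^ 4)) : ℝ)) ^ (676 * k ^ 4) := by
    rw [ht, ← rpow_mul hN0.le, ← rpow_add hN0,
      ← rpow_natCast (N ^ (-(l ^ 2 / (10816 * k ^ 4)) : ℝ)) (676 * k ^ 4), ← rpow_mul hN0.le]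
    congr 1
    push_cast; field_simp; ring
  refine le_of_pow_le_pow_left₀ (n := 676 * k ^ 4) (by positivity) (by positivity) ?_
  calc W ^ (676 * k ^ 4) ≤ _ := hmain
    _ ≤ (Y : ℝ) ^ (2 * (2 * s * (2 * s - 1))) * ((k : ℝ) ^ (360 * k ^ 4) *
      (Y : ℝ) ^ (26 * (k : ℝ) ^ 2 - k * (k + 1) / 2 + k * (k + 1) / 2 * exp (-12))) ^ 2 *
      (9 ^ k * (s : ℝ) ^ (2 * k) * (Y : ℝ) ^ (k * (k + 1)) * t ^ (-(l / 8))) := by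
        refine mul_le_mul (mul_le_mul_of_nonneg_left (pow_le_pow_left₀ hJ0 hJ 2) (by positivity)) hprod
          (Finset.prod_nonneg fun j _ => Sg_nonneg _ _) (by positivity)
    _ = ((Y : ℝ) ^ (2 * (2 * s * (2 * s - 1))) * ((Y : ℝ) ^ (26 * (k : ℝ) ^ 2 - k * (k + 1) / 2 + k * (k + 1) / 2 * exp (-12))) ^ 2
      * (Y : ℝ) ^ (k * (k + 1))) * ((k : ℝ) ^ (720 * k ^ 4) * (9 ^ k * (s : ℝ) ^ (2 * k))) * t ^ (-(l / 8)) := by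
        rw [mul_pow, ← pow_mul, show 360 * k ^ 4 * 2 = 720 * k ^ 4 by ring]; ring
    _ ≤ (((Y : ℝ) ^ 2) ^ (676 * k ^ 4) * N ^ (l ^ 2 / 16)) * ((k : ℝ) ^ 2) ^ (676 * k ^ 4) * t ^ (-(l / 8)) := by
        rw [hYexp]
        gcongr
    _ = _ := by
        rw [mul_pow, mul_pow, ← htN]; ring

lemma ee_lip (a b : ℝ) : ‖ee a - ee b‖ ≤ 2 * π * |a - b| := by
  have h : ee a - ee b = ee b * (ee (a - b) - 1) := by
    rw [mul_sub, ← ee_add]; simp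
  rw [h, norm_mul, ee_norm, one_mul, ee, mul_comm]
  refine (Real.norm_exp_I_mul_ofReal_sub_one_le).trans ?_
  rw [Real.norm_eq_abs, abs_mul, abs_of_pos (by positivity)]

lemma shift_one (g : ℕ → ℂ) {N M : ℕ} (h : N ≤ M) :
    ∑ n ∈ Ioc N M, g n - ∑ n ∈ Ioc N M, g (n + 1) = g (N + 1) - g (M + 1) := by
  induction M, h using Nat.le_induction with
  | base => simp
  | succ M hM ih =>
    rw [sum_Ioc_succ_top (by omega), sum_Ioc_succ_top (by omega)]
    linear_combination ih

lemma shift_sum (g : ℕ → ℂ) (hg : ∀ n, ‖g n‖ ≤ 1) {N M : ℕ} (hNM : N ≤ M) (h : ℕ) :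
    ‖∑ n ∈ Ioc N M, g n - ∑ n ∈ Ioc N M, g (n + h)‖ ≤ 2 * h := by
  induction h with
  | zero => simp
  | succ h ih =>
    have h1 := shift_one (fun n => g (n + h)) hNM
    have e : ∑ n ∈ Ioc N M, g n - ∑ n ∈ Ioc N M, g (n + (h + 1))
        = (∑ n ∈ Ioc N M, g n - ∑ n ∈ Ioc N M, g (n + h)) + (g (N + 1 + h) - g (M + 1 + h)) := by
      rw [← h1]
      have : ∀ n, g (n + (h + 1)) = g (n + 1 + h) := fun n => by congr 1; ring
      simp only [this]; ring
    rw [e]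
    refine (norm_add_le _ _).trans ?_
    have h2 := norm_sub_le (g (N + 1 + h)) (g (M + 1 + h))
    have h3 := hg (N + 1 + h)
    have h4 := hg (M + 1 + h)
    push_cast; linarith

lemma shift_avg (g : ℕ → ℂ) (hg : ∀ n, ‖g n‖ ≤ 1) {N M Y : ℕ} (hNM : N ≤ M) (hY : 1 ≤ Y) (A : ℝ)
    (hA : ∀ n ∈ Ioc N M, ‖∑ x ∈ Ioc 0 (Y : ℤ), ∑ y ∈ Ioc 0 (Y : ℤ), g (n + (x * y).toNat)‖
      ≤ (Y : ℝ) ^ 2 * A) :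
    ‖∑ n ∈ Ioc N M, g n‖ ≤ 2 * (Y : ℝ) ^ 2 + (M - N) * A := by
  have hY' : (1 : ℝ) ≤ Y := by exact_mod_cast hY
  set S := ∑ n ∈ Ioc N M, g n with hS
  have h1 : ‖(Y : ℂ) ^ 2 * S - ∑ n ∈ Ioc N M, ∑ x ∈ Ioc 0 (Y : ℤ), ∑ y ∈ Ioc 0 (Y : ℤ), g (n + (x * y).toNat)‖
      ≤ (Y : ℝ) ^ 2 * (2 * (Y : ℝ) ^ 2) := by
    have e : (Y : ℂ) ^ 2 * S - ∑ n ∈ Ioc N M, ∑ x ∈ Ioc 0 (Y : ℤ), ∑ y ∈ Ioc 0 (Y : ℤ), g (n + (x * y).toNat)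
        = ∑ x ∈ Ioc 0 (Y : ℤ), ∑ y ∈ Ioc 0 (Y : ℤ), (S - ∑ n ∈ Ioc N M, g (n + (x * y).toNat)) := by
      simp only [sum_sub_distrib, sum_const, Int.card_Ioc, sub_zero, Int.toNat_natCast, nsmul_eq_mul]
      rw [sum_comm]
      have : ∀ x ∈ Ioc 0 (Y : ℤ), ∑ n ∈ Ioc N M, ∑ y ∈ Ioc 0 (Y : ℤ), g (n + (x * y).toNat) =
        ∑ y ∈ Ioc 0 (Y : ℤ), ∑ n ∈ Ioc N M, g (n + (x * y).toNat) := fun x _ => sum_comm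
      rw [sum_congr rfl this]; ring
    rw [e]
    have hb : ∀ x ∈ Ioc 0 (Y : ℤ), ∀ y ∈ Ioc 0 (Y : ℤ),
        ‖S - ∑ n ∈ Ioc N M, g (n + (x * y).toNat)‖ ≤ 2 * (Y : ℝ) ^ 2 := by
      intro x hx y hy
      simp only [mem_Ioc] at hx hy
      refine (shift_sum g hg hNM _).trans ?_
      have : ((x * y).toNat : ℤ) ≤ (Y : ℤ) ^ 2 := by
        rw [Int.toNat_of_nonneg (by nlinarith)]
        nlinarith
      have : (((x * y).toNat : ℕ) : ℝ) ≤ (Y : ℝ) ^ 2 := by exact_mod_cast this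
      linarith
    calc _ ≤ ∑ x ∈ Ioc 0 (Y : ℤ), ∑ y ∈ Ioc 0 (Y : ℤ), 2 * (Y : ℝ) ^ 2 :=
          (norm_sum_le _ _).trans (sum_le_sum fun x hx =>
            (norm_sum_le _ _).trans (sum_le_sum fun y hy => hb x hx y hy))
      _ = _ := by
          simp only [sum_const, Int.card_Ioc, sub_zero, Int.toNat_natCast, nsmul_eq_mul]; ring
  have h2 : ‖∑ n ∈ Ioc N M, ∑ x ∈ Ioc 0 (Y : ℤ), ∑ y ∈ Ioc 0 (Y : ℤ), g (n + (x * y).toNat)‖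
      ≤ (M - N) * ((Y : ℝ) ^ 2 * A) := by
    refine (norm_sum_le _ _).trans ((sum_le_sum hA).trans ?_)
    simp [Nat.cast_sub hNM]
  have h3 : ‖(Y : ℂ) ^ 2 * S‖ ≤ (Y : ℝ) ^ 2 * (2 * (Y : ℝ) ^ 2 + (M - N) * A) := by
    have := norm_add_le _ _ |>.trans (add_le_add h1 h2)
    rw [sub_add_cancel] at this
    linarith
  rw [norm_mul, norm_pow, Complex.norm_natCast] at h3
  exact le_of_mul_le_mul_left h3 (by positivity)

lemma log_taylor {z : ℝ} (hz0 : 0 ≤ z) (hz : z ≤ 1 / 2) (k : ℕ) :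
    |log (1 + z) - ∑ i ∈ range k, (-1) ^ i * z ^ (i + 1) / (i + 1)| ≤ 2 * z ^ (k + 1) := by
  have h := Real.abs_log_sub_add_sum_range_le (x := -z) (by rw [abs_neg, abs_of_nonneg hz0]; linarith) k
  rw [abs_neg, abs_of_nonneg hz0, sub_neg_eq_add] at h
  have e : log (1 + z) - ∑ i ∈ range k, (-1) ^ i * z ^ (i + 1) / (i + 1) =
      ∑ i ∈ range k, (-z) ^ (i + 1) / ((i : ℝ) + 1) + log (1 + z) := by
    rw [sub_eq_add_neg, ← sum_neg_distrib, add_comm]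
    congr 1
    refine sum_congr rfl fun i _ => ?_
    rw [neg_pow z, pow_succ]; ring
  rw [e]
  refine h.trans ?_
  rw [div_le_iff₀ (by linarith)]
  have : 0 ≤ z ^ (k + 1) := by positivity
  nlinarith

noncomputable def gg (t r : ℝ) : ℂ := ee (-(t / (2 * π)) * log r)

noncomputable def al (t : ℝ) (n : ℝ) (k : ℕ) : Fin k → ℝ :=
  fun j => -(t / (2 * π)) * ((-1) ^ j.val / ((j.val + 1 : ℕ) * n ^ (j.val + 1)))

lemma gg_shift {t n : ℝ} (ht : 0 < t) (hn : 0 < n) (k : ℕ) {x y : ℤ} (hx : 0 < x) (hy : 0 < y)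
    (hz : (x * y : ℝ) / n ≤ 1 / 2) :
    ‖gg t (n + ((x * y).toNat : ℕ)) - gg t n * ee (br (al t n k) (mo k x) (mo k y))‖
      ≤ t * (2 * ((x * y : ℝ) / n) ^ (k + 1)) := by
  have hx' : (0 : ℝ) < x := by exact_mod_cast hx
  have hy' : (0 : ℝ) < y := by exact_mod_cast hy
  have hc : (((x * y).toNat : ℕ) : ℝ) = x * y := by
    have : (((x * y).toNat : ℕ) : ℤ) = x * y := Int.toNat_of_nonneg (by positivity)
    have h2 : ((((x * y).toNat : ℕ) : ℤ) : ℝ) = ((x * y : ℤ) : ℝ) := by rw [this]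
    push_cast at h2; exact_mod_cast h2
  rw [hc, gg, gg, ← ee_add]
  refine (ee_lip _ _).trans ?_
  set z : ℝ := (x * y : ℝ) / n with hzd
  have hz0 : 0 ≤ z := by positivity
  have e1 : log (n + x * y) = log n + log (1 + z) := by
    rw [← Real.log_mul hn.ne' (by positivity)]
    congr 1; rw [hzd]; field_simp
  have e2 : br (al t n k) (mo k x) (mo k y) =
      -(t / (2 * π)) * ∑ i ∈ range k, (-1) ^ i * z ^ (i + 1) / (i + 1) := by
    rw [br, mul_sum, sum_range]
    refine sum_congr rfl fun j _ => ?_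
    simp only [al, mo, hzd]
    push_cast
    rw [div_pow, mul_pow]
    field_simp
  rw [e1, e2, show -(t / (2 * π)) * (log n + log (1 + z)) - (-(t / (2 * π)) * log n +
    -(t / (2 * π)) * ∑ i ∈ range k, (-1) ^ i * z ^ (i + 1) / (i + 1))
    = -(t / (2 * π)) * (log (1 + z) - ∑ i ∈ range k, (-1) ^ i * z ^ (i + 1) / (i + 1)) by ring,
    abs_mul, abs_neg, abs_of_pos (by positivity), ← mul_assoc, mul_div_cancel₀ _ (by positivity)]
  exact mul_le_mul_of_nonneg_left (log_taylor hz0 hz k) ht.le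

lemma inner_bound {N t l n : ℝ} {Y k : ℕ} (hN : 2 ^ 96 ≤ N) (ht : t = N ^ l) (hl : 1 / 2 ≤ l)
    (hk1 : 8 * l + 7 ≤ k) (hk2 : k ≤ 24 * l) (hn1 : N ≤ n) (hn2 : n ≤ 2 * N)
    (hY1 : N ^ (7 / 16 : ℝ) / 2 ≤ Y) (hY2 : Y ≤ N ^ (7 / 16 : ℝ))
    (hT1 : 2 * π * (2 + 1.75 * log t) ≤ 4.5 * t ^ (1 / 4 : ℝ))
    (hT2 : 13 * (k : ℝ) ^ 2 ≤ 3 * t ^ (1 / 8 : ℝ)) :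
    ‖∑ x ∈ Ioc 0 (Y : ℤ), ∑ y ∈ Ioc 0 (Y : ℤ), gg t (n + ((x * y).toNat : ℕ))‖
      ≤ (Y : ℝ) ^ 2 * (k ^ 2 * N ^ (-(l ^ 2 / (10816 * k ^ 4)) : ℝ) + 2 / N) := by
  have hN0 : 0 < N := by linarith
  have hN1 : 1 ≤ N := by linarith
  have ht0 : 0 < t := by rw [ht]; positivity
  have hn0 : 0 < n := by linarith
  have hk0 : 2 ≤ k := by
    have : (2 : ℝ) ≤ k := by linarith
    exact_mod_cast this
  have hW := W_bound hN ht hl (by linarith) hk0 hk2 hn1 hn2 (al t n k) (fun j => by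
    rw [al, abs_mul, abs_neg, abs_of_pos (by positivity), abs_div, abs_pow, abs_neg, abs_one, one_pow,
      abs_of_pos (by positivity)]
    field_simp) hY1 hY2 hT1 hT2
  have hNz : N ^ (-(1 / 8) : ℝ) ≤ 1 / 2 := by
    rw [rpow_neg hN0.le, ← one_div]
    refine one_div_le_one_div_of_le (by norm_num) ?_
    calc (2 : ℝ) ≤ ((2 : ℝ) ^ (96 : ℝ)) ^ (1 / 8 : ℝ) := by
          rw [← rpow_mul (by norm_num)]; norm_num
      _ ≤ _ := rpow_le_rpow (by positivity) (by exact_mod_cast hN) (by norm_num)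
  have hpt : ∀ x ∈ Ioc 0 (Y : ℤ), ∀ y ∈ Ioc 0 (Y : ℤ),
      ‖gg t (n + ((x * y).toNat : ℕ)) - gg t n * ee (br (al t n k) (mo k x) (mo k y))‖ ≤ 2 / N := by
    intro x hx y hy
    simp only [mem_Ioc] at hx hy
    have hx' : (0 : ℝ) < x := by exact_mod_cast hx.1
    have hy' : (0 : ℝ) < y := by exact_mod_cast hy.1
    have hxY : (x : ℝ) ≤ Y := by exact_mod_cast hx.2
    have hyY : (y : ℝ) ≤ Y := by exact_mod_cast hy.2
    have hz : (x * y : ℝ) / n ≤ N ^ (-(1 / 8) : ℝ) := by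
      rw [div_le_iff₀ hn0]
      calc (x * y : ℝ) ≤ N ^ (7 / 16 : ℝ) * N ^ (7 / 16 : ℝ) :=
            mul_le_mul (hxY.trans hY2) (hyY.trans hY2) hy'.le (by positivity)
        _ = N ^ (-(1 / 8) : ℝ) * N ^ (1 : ℝ) := by rw [← rpow_add hN0, ← rpow_add hN0]; norm_num
        _ ≤ _ := by rw [rpow_one]; gcongr
    refine (gg_shift ht0 hn0 k hx.1 hy.1 (hz.trans hNz)).trans ?_
    calc t * (2 * ((x * y : ℝ) / n) ^ (k + 1)) ≤ t * (2 * (N ^ (-(1 / 8) : ℝ)) ^ (k + 1)) := by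
          gcongr
      _ = 2 * N ^ (l + (-(1 / 8)) * ((k + 1 : ℕ) : ℝ)) := by
          rw [rpow_add hN0, ← ht, rpow_mul hN0.le, rpow_natCast]; ring
      _ ≤ 2 * N ^ (-1 : ℝ) := by
          refine mul_le_mul_of_nonneg_left (rpow_le_rpow_of_exponent_le hN1 ?_) (by norm_num)
          push_cast; linarith
      _ = 2 / N := by rw [rpow_neg_one]; ring
  have hsum : ‖∑ x ∈ Ioc 0 (Y : ℤ), ∑ y ∈ Ioc 0 (Y : ℤ),
      (gg t (n + ((x * y).toNat : ℕ)) - gg t n * ee (br (al t n k) (mo k x) (mo k y)))‖ ≤ (Y : ℝ) ^ 2 * (2 / N) := by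
    calc _ ≤ ∑ x ∈ Ioc 0 (Y : ℤ), ∑ y ∈ Ioc 0 (Y : ℤ), 2 / N :=
          (norm_sum_le _ _).trans (sum_le_sum fun x hx =>
            (norm_sum_le _ _).trans (sum_le_sum fun y hy => hpt x hx y hy))
      _ = _ := by
          simp only [sum_const, Int.card_Ioc, sub_zero, Int.toNat_natCast, nsmul_eq_mul]; ring
  simp only [sum_sub_distrib, ← mul_sum] at hsum
  have hgW : ‖gg t n * ∑ x ∈ Ioc 0 (Y : ℤ), ∑ y ∈ Ioc 0 (Y : ℤ),
      ee (br (al t n k) (mo k x) (mo k y))‖ ≤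
      (Y : ℝ) ^ 2 * k ^ 2 * N ^ (-(l ^ 2 / (10816 * k ^ 4)) : ℝ) := by
    rw [norm_mul, gg, ee_norm, one_mul]; exact hW
  have := (norm_add_le _ _).trans (add_le_add hsum hgW)
  rw [sub_add_cancel] at this
  refine this.trans (le_of_eq (by ring))

lemma zsum_aux {t l : ℝ} {N M k : ℕ} (hN : (2 : ℝ) ^ 96 ≤ N) (ht : t = (N : ℝ) ^ l) (hl : 1 / 2 ≤ l)
    (hk1 : 8 * l + 7 ≤ k) (hk2 : k ≤ 24 * l) (hNM : N ≤ M) (hM : M ≤ 2 * N)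
    (hT1 : 2 * π * (2 + 1.75 * log t) ≤ 4.5 * t ^ (1 / 4 : ℝ))
    (hT2 : 13 * (k : ℝ) ^ 2 ≤ 3 * t ^ (1 / 8 : ℝ)) :
    ‖∑ n ∈ Ioc N M, gg t n‖ ≤ (k ^ 2 + 4) * (N : ℝ) ^ (1 - 1 / (10816 * 24 ^ 4) / l ^ 2) := by
  have hN0 : (0 : ℝ) < N := by linarith
  have hN1 : (1 : ℝ) ≤ N := by linarith
  have hk0 : (2 : ℝ) ≤ k := by linarith
  have hNp : 2 ≤ (N : ℝ) ^ (7 / 16 : ℝ) := by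
    calc (2 : ℝ) ≤ ((2 : ℝ) ^ (96 : ℝ)) ^ (7 / 16 : ℝ) := by
          rw [← rpow_mul (by norm_num), show (96 : ℝ) * (7 / 16) = 42 by norm_num]; norm_num
      _ ≤ _ := rpow_le_rpow (by positivity) (by exact_mod_cast hN) (by norm_num)
  set Y : ℕ := ⌊(N : ℝ) ^ (7 / 16 : ℝ)⌋₊ with hY
  have hY2 : (Y : ℝ) ≤ (N : ℝ) ^ (7 / 16 : ℝ) := Nat.floor_le (by positivity)
  have hY1 : (N : ℝ) ^ (7 / 16 : ℝ) / 2 ≤ Y := by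
    have := Nat.lt_floor_add_one ((N : ℝ) ^ (7 / 16 : ℝ))
    rw [← hY] at this; linarith
  have hY0 : 1 ≤ Y := by
    have : (0 : ℝ) < Y := by linarith
    exact_mod_cast this
  set e : ℝ := l ^ 2 / (10816 * k ^ 4) with he
  set d : ℝ := 1 / (10816 * 24 ^ 4) / l ^ 2 with hd
  have hde : d ≤ e := by
    rw [hd, he, div_div, div_le_div_iff₀ (by positivity) (by positivity)]
    have : (k : ℝ) ^ 4 ≤ (24 * l) ^ 4 := pow_le_pow_left₀ (by linarith) hk2 4
    nlinarith
  have hd8 : d ≤ 1 / 8 := by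
    rw [hd, div_div, div_le_iff₀ (by positivity)]
    have : 1 / 4 ≤ l ^ 2 := by nlinarith
    linarith
  have key := shift_avg (fun n => gg t n) (fun n => by rw [gg, ee_norm]) hNM hY0
    (k ^ 2 * (N : ℝ) ^ (-e) + 2 / N) (fun n hn => by
      simp only [mem_Ioc] at hn
      have h1 : (N : ℝ) ≤ n := by exact_mod_cast hn.1.le
      have h2 : (n : ℝ) ≤ 2 * N := by exact_mod_cast hn.2.trans hM
      have := inner_bound hN ht hl hk1 hk2 h1 h2 hY1 hY2 hT1 hT2
      simpa only [Nat.cast_add] using this)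
  refine key.trans ?_
  have hP : 1 ≤ (N : ℝ) ^ (1 - d) := one_le_rpow hN1 (by linarith)
  have a1 : (Y : ℝ) ^ 2 ≤ (N : ℝ) ^ (1 - d) := by
    calc (Y : ℝ) ^ 2 ≤ ((N : ℝ) ^ (7 / 16 : ℝ)) ^ 2 := pow_le_pow_left₀ (by positivity) hY2 2
      _ = (N : ℝ) ^ (7 / 8 : ℝ) := by rw [← rpow_natCast, ← rpow_mul hN0.le]; norm_num
      _ ≤ _ := rpow_le_rpow_of_exponent_le hN1 (by linarith)
  have hMN : (M : ℝ) - N ≤ N := by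
    have : (M : ℝ) ≤ 2 * N := by exact_mod_cast hM
    linarith
  have a2 : ((M : ℝ) - N) * (k ^ 2 * (N : ℝ) ^ (-e) + 2 / N) ≤ N * (k ^ 2 * (N : ℝ) ^ (-e) + 2 / N) :=
    mul_le_mul_of_nonneg_right hMN (by positivity)
  have a3 : N * (k ^ 2 * (N : ℝ) ^ (-e) + 2 / N) = k ^ 2 * (N : ℝ) ^ (1 - e) + 2 := by
    rw [sub_eq_add_neg, rpow_add hN0, rpow_one]; field_simp
  have a4 : (k : ℝ) ^ 2 * (N : ℝ) ^ (1 - e) ≤ k ^ 2 * (N : ℝ) ^ (1 - d) :=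
    mul_le_mul_of_nonneg_left (rpow_le_rpow_of_exponent_le hN1 (by linarith)) (by positivity)
  linarith

theorem zsum : ∃ C c T : ℝ, 0 < C ∧ 0 < c ∧ 10 ≤ T ∧ ∀ t : ℝ, T ≤ t → ∀ N M : ℕ, 1 ≤ N → (N : ℝ) ≤ t ^ 2 →
    N ≤ M → M ≤ 2 * N →
    ‖∑ n ∈ Ioc N M, gg t n‖ ≤ C * (log t) ^ 2 * (N : ℝ) ^ (1 - c * (log N / log t) ^ 2) := by
  have hE1 : ∀ᶠ t : ℝ in atTop, 2 * π * (2 + 1.75 * log t) ≤ 4.5 * t ^ (1 / 4 : ℝ) := by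
    have h1 : (fun t : ℝ => 2 * π * (2 + 1.75 * log t)) =o[atTop] (fun t : ℝ => t ^ (1 / 4 : ℝ)) := by
      refine Asymptotics.IsLittleO.const_mul_left (Asymptotics.IsLittleO.add ?_ ?_) _
      · exact Asymptotics.isLittleO_const_left.mpr (Or.inr
          (tendsto_norm_atTop_atTop.comp (tendsto_rpow_atTop (by norm_num))))
      · exact (isLittleO_log_rpow_atTop (by norm_num)).const_mul_left _
    filter_upwards [h1.bound (show (0 : ℝ) < 4.5 by norm_num), eventually_gt_atTop 0] with t ht ht0
    rw [Real.norm_eq_abs, Real.norm_of_nonneg (by positivity)] at ht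
    exact (le_abs_self _).trans ht
  have hE2 : ∀ᶠ t : ℝ in atTop, 13 * (24 * log t) ^ 2 ≤ 3 * t ^ (1 / 8 : ℝ) := by
    have h1 : (fun t : ℝ => (log t) ^ (2 : ℝ)) =o[atTop] (fun t : ℝ => t ^ (1 / 8 : ℝ)) :=
      isLittleO_log_rpow_rpow_atTop 2 (by norm_num)
    filter_upwards [h1.bound (show (0 : ℝ) < 3 / (13 * 24 ^ 2) by norm_num), eventually_gt_atTop 0] with t ht ht0
    rw [Real.norm_eq_abs, Real.norm_of_nonneg (by positivity), rpow_two] at ht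
    have := (le_abs_self _).trans ht
    linarith
  obtain ⟨T, hT⟩ := eventually_atTop.mp (hE1.and hE2)
  refine ⟨2 ^ 96 + 580, 1 / (10816 * 24 ^ 4), max T 10, by norm_num, by norm_num, le_max_right _ _, ?_⟩
  intro t ht N M hN1 hNt hNM hM
  obtain ⟨hT1, hT2⟩ := hT t ((le_max_left _ _).trans ht)
  have ht10 : 10 ≤ t := (le_max_right _ _).trans ht
  have hlt : 1 ≤ log t := by
    rw [Real.le_log_iff_exp_le (by linarith)]
    have := Real.exp_one_lt_d9
    linarith
  have hN1' : (1 : ℝ) ≤ N := by exact_mod_cast hN1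
  have hlN : log N ≤ 2 * log t := by
    have := Real.log_le_log (by linarith) hNt
    rwa [Real.log_pow] at this
  have hlN0 : 0 ≤ log N := Real.log_nonneg hN1'
  have hL2 : 1 ≤ log t ^ 2 := one_le_pow₀ hlt
  by_cases hbig : (2 : ℝ) ^ 96 ≤ N
  · have hlNpos : 1 ≤ log N := by
      rw [Real.le_log_iff_exp_le (by linarith)]
      have := Real.exp_one_lt_d9
      linarith
    set l : ℝ := log t / log N with hl
    have hl2 : 1 / 2 ≤ l := by rw [hl, le_div_iff₀ (by linarith)]; linarith
    have hllt : l ≤ log t := div_le_self (by linarith) hlNpos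
    have htl : t = (N : ℝ) ^ l := by
      rw [rpow_def_of_pos (by linarith), hl, mul_div_cancel₀ _ (by linarith), Real.exp_log (by linarith)]
    have hk1 := Nat.le_ceil (8 * l + 7)
    have hk2 := Nat.ceil_lt_add_one (show 0 ≤ 8 * l + 7 by linarith)
    set k := ⌈8 * l + 7⌉₊
    have hk24 : (k : ℝ) ≤ 24 * l := by linarith
    have hksq : (k : ℝ) ^ 2 ≤ (24 * log t) ^ 2 := pow_le_pow_left₀ (by positivity) (by linarith) 2
    have := zsum_aux hbig htl hl2 hk1 hk24 hNM hM hT1 (by linarith)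
    refine this.trans ?_
    have e : 1 / (10816 * 24 ^ 4) / l ^ 2 = 1 / (10816 * 24 ^ 4) * (log N / log t) ^ 2 := by
      rw [hl, ← inv_div (log N), inv_pow, div_inv_eq_mul]
    rw [e]
    refine mul_le_mul_of_nonneg_right ?_ (by positivity)
    nlinarith
  · have hr : (log N / log t) ^ 2 ≤ 4 := by
      have : log N / log t ≤ 2 := by rw [div_le_iff₀ (by linarith)]; exact hlN
      have h0 : 0 ≤ log N / log t := by positivity
      nlinarith
    have hP : 1 ≤ (N : ℝ) ^ (1 - 1 / (10816 * 24 ^ 4) * (log N / log t) ^ 2) :=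
      one_le_rpow hN1' (by linarith)
    calc ‖∑ n ∈ Ioc N M, gg t n‖ ≤ ∑ n ∈ Ioc N M, 1 :=
          (norm_sum_le _ _).trans (sum_le_sum fun n _ => by rw [gg, ee_norm])
      _ = (M : ℝ) - N := by simp [Nat.cast_sub hNM]
      _ ≤ N := by
          have : (M : ℝ) ≤ 2 * N := by exact_mod_cast hM
          linarith
      _ ≤ (2 ^ 96 + 580) * 1 * 1 := by linarith
      _ ≤ _ := by gcongr

noncomputable def vv (n : ℕ) (s : ℂ) : ℂ :=
  (s - 1) * ((n + 1 : ℕ) : ℂ) ^ (-s) + (((n + 1 : ℕ) : ℂ) ^ (1 - s) - (n : ℂ) ^ (1 - s))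

lemma cpow_lip {n : ℕ} (hn : 1 ≤ n) {s : ℂ} (hs : 0 < s.re) {u : ℝ} (hu : (n : ℝ) ≤ u) (hu2 : u ≤ (n + 1 : ℝ)) :
    ‖((n + 1 : ℕ) : ℂ) ^ (-s) - (u : ℂ) ^ (-s)‖ ≤ ‖s‖ * (n : ℝ) ^ (-s.re - 1) := by
  have hn' : (1 : ℝ) ≤ n := by exact_mod_cast hn
  have h := Convex.norm_image_sub_le_of_norm_hasDerivWithin_le (f := fun v : ℝ => (v : ℂ) ^ (-s))
    (f' := fun v : ℝ => (-s) * (v : ℂ) ^ (-s - 1)) (s := Set.Icc (n : ℝ) (n + 1)) (C := ‖s‖ * (n : ℝ) ^ (-s.re - 1))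
    (x := u) (y := n + 1) (fun v hv => by
      have hv0 : v ≠ 0 := by have := hv.1; intro h; linarith
      have hs0 : -s ≠ 0 := by intro h; rw [neg_eq_zero] at h; rw [h] at hs; simp at hs
      exact (hasDerivAt_ofReal_cpow_const hv0 hs0).hasDerivWithinAt) (fun v hv => by
      rw [norm_mul, norm_neg, Complex.norm_cpow_eq_rpow_re_of_pos (by linarith [hv.1])]
      refine mul_le_mul_of_nonneg_left ?_ (norm_nonneg _)
      simp only [Complex.sub_re, Complex.neg_re, Complex.one_re]
      exact rpow_le_rpow_of_nonpos (by linarith) hv.1 (by linarith))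
    (convex_Icc _ _) ⟨hu, hu2⟩ ⟨by linarith, le_rfl⟩
  push_cast at h ⊢
  refine h.trans ?_
  refine mul_le_of_le_one_right (by positivity) ?_
  rw [Real.norm_of_nonneg (by linarith)]; linarith

lemma vv_bound {n : ℕ} (hn : 1 ≤ n) {s : ℂ} (hs : 0 < s.re) :
    ‖vv n s‖ ≤ ‖s - 1‖ * (‖s‖ * (n : ℝ) ^ (-s.re - 1)) := by
  have hn' : (1 : ℝ) ≤ n := by exact_mod_cast hn
  by_cases hs1 : s = 1
  · subst hs1; simp [vv]
  have h := Convex.norm_image_sub_le_of_norm_hasDerivWithin_le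
    (f := fun v : ℝ => (s - 1) * ((n + 1 : ℕ) : ℂ) ^ (-s) * v + (v : ℂ) ^ (1 - s))
    (f' := fun v : ℝ => (s - 1) * (((n + 1 : ℕ) : ℂ) ^ (-s) - (v : ℂ) ^ (-s)))
    (s := Set.Icc (n : ℝ) (n + 1)) (C := ‖s - 1‖ * (‖s‖ * (n : ℝ) ^ (-s.re - 1)))
    (x := n) (y := n + 1) (fun v hv => by
      have hv0 : v ≠ 0 := by have := hv.1; intro h; linarith
      have hne : 1 - s ≠ 0 := sub_ne_zero.mpr (Ne.symm hs1)
      have h2 := (hasDerivAt_ofReal_cpow_const hv0 hne).hasDerivWithinAt (s := Set.Icc (n : ℝ) (n + 1))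
      have h3 := ((Complex.ofRealCLM.hasDerivAt (x := v)).const_mul ((s - 1) * ((n + 1 : ℕ) : ℂ) ^ (-s))).hasDerivWithinAt
        (s := Set.Icc (n : ℝ) (n + 1))
      refine (h3.add h2).congr_deriv ?_
      rw [show 1 - s - 1 = -s by ring]; simp; ring) (fun v hv => by
      rw [norm_mul]
      exact mul_le_mul_of_nonneg_left (cpow_lip hn hs hv.1 hv.2) (norm_nonneg _))
    (convex_Icc _ _) ⟨le_rfl, by linarith⟩ ⟨by linarith, le_rfl⟩
  rw [add_sub_cancel_left, norm_one, mul_one] at h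
  refine le_trans (le_of_eq ?_) h
  rw [vv]; congr 1; push_cast; ring

lemma vv_sum (N : ℕ) (s : ℂ) (M : ℕ) :
    ∑ i ∈ range M, vv (N + i) s = (s - 1) * ∑ n ∈ Ioc N (N + M), (n : ℂ) ^ (-s)
      + ((N + M : ℕ) : ℂ) ^ (1 - s) - (N : ℂ) ^ (1 - s) := by
  induction M with
  | zero => simp
  | succ M ih =>
    rw [sum_range_succ, ih, ← add_assoc, sum_Ioc_succ_top (by omega), vv]
    ring

lemma vv_summable {N : ℕ} (hN : 1 ≤ N) {a : ℝ} (ha : 0 < a) :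
    Summable fun i : ℕ => ((N + i : ℕ) : ℝ) ^ (-a - 1) := by
  have h : Summable fun i : ℕ => (i : ℝ) ^ (-a - 1) := Real.summable_nat_rpow.mpr (by linarith)
  have := (summable_nat_add_iff N).mpr h
  simpa only [add_comm N] using this

lemma zeta1_approx {N : ℕ} (hN : 1 ≤ N) {s : ℂ} (hs : 0 < s.re) :
    riemannZeta₁ s = (s - 1) * ∑ n ∈ Ioc 0 N, (n : ℂ) ^ (-s) + (N : ℂ) ^ (1 - s) + ∑' i, vv (N + i) s := by
  have hN0 : (N : ℂ) ≠ 0 := by exact_mod_cast (by omega : N ≠ 0)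
  have hU : IsOpen {s : ℂ | 0 < s.re} := isOpen_lt continuous_const Complex.continuous_re
  have hdiff : DifferentiableOn ℂ (fun s => ∑' i, vv (N + i) s) {s : ℂ | 0 < s.re} := by
    intro z hz
    have hz' : 0 < z.re := hz
    have hV : IsOpen ({s : ℂ | z.re / 2 < s.re} ∩ Metric.ball z 1) :=
      (isOpen_lt continuous_const Complex.continuous_re).inter Metric.isOpen_ball
    have hzV : z ∈ ({s : ℂ | z.re / 2 < s.re} ∩ Metric.ball z 1) := ⟨by simp; linarith, Metric.mem_ball_self one_pos⟩
    have := Complex.differentiableOn_tsum_of_summable_norm (F := fun i s => vv (N + i) s)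
      (u := fun i : ℕ => (‖z‖ + 2) * ((‖z‖ + 1) * ((N + i : ℕ) : ℝ) ^ (-(z.re / 2) - 1)))
      (((vv_summable hN (by linarith : 0 < z.re / 2)).mul_left _).mul_left _)
      (U := {s : ℂ | z.re / 2 < s.re} ∩ Metric.ball z 1) (fun i => by
        have h1 : (N + i : ℕ) ≠ 0 := by omega
        have h2 : ((N + i + 1 : ℕ) : ℂ) ≠ 0 := by exact_mod_cast (by omega : N + i + 1 ≠ 0)
        have h3 : ((N + i : ℕ) : ℂ) ≠ 0 := by exact_mod_cast h1
        have : Differentiable ℂ (fun s => vv (N + i) s) := by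
          unfold vv
          refine ((differentiable_id.sub_const 1).mul (differentiable_neg.const_cpow (Or.inl h2))).add
            (((differentiable_id.const_sub 1).const_cpow (Or.inl h2)).sub
              ((differentiable_id.const_sub 1).const_cpow (Or.inl h3)))
        exact this.differentiableOn) hV (fun i w hw => by
        have hw1 : z.re / 2 < w.re := hw.1
        have hw2 : ‖w - z‖ < 1 := by simpa [dist_eq_norm] using hw.2
        have hwn : ‖w‖ ≤ ‖z‖ + 1 := by
          have := norm_add_le (w - z) z
          rw [sub_add_cancel] at this; linarith
        refine (vv_bound (by omega) (by linarith)).trans ?_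
        have h1 : ‖w - 1‖ ≤ ‖z‖ + 2 := (norm_sub_le _ _).trans (by rw [norm_one]; linarith)
        have hNi : (1 : ℝ) ≤ ((N + i : ℕ) : ℝ) := by exact_mod_cast (by omega)
        gcongr) 
    exact ((this.differentiableAt (hV.mem_nhds hzV))).differentiableWithinAt
  have hd2 : Differentiable ℂ (fun s : ℂ => (s - 1) * ∑ n ∈ Ioc 0 N, (n : ℂ) ^ (-s) + (N : ℂ) ^ (1 - s)) := by
    refine ((differentiable_id.sub_const 1).mul ?_).add ((differentiable_id.const_sub 1).const_cpow (Or.inl hN0))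
    refine Differentiable.fun_sum fun n hn => ?_
    have : (n : ℂ) ≠ 0 := by
      have := (Finset.mem_Ioc.mp hn).1
      exact_mod_cast this.ne'
    exact differentiable_neg.const_cpow (Or.inl this)
  have hgt : ∀ s : ℂ, 1 < s.re → riemannZeta₁ s = (s - 1) * ∑ n ∈ Ioc 0 N, (n : ℂ) ^ (-s) + (N : ℂ) ^ (1 - s)
      + ∑' i, vv (N + i) s := by
    intro s hs
    have hs1 : s ≠ 1 := by intro h; rw [h] at hs; simp at hs
    have hsum : Summable fun i => vv (N + i) s := by
      refine Summable.of_norm_bounded (((vv_summable hN (by linarith : 0 < s.re)).mul_left ‖s‖).mul_left ‖s - 1‖) fun i => ?_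
      exact vv_bound (by omega) (by linarith)
    have t1 := hsum.hasSum.tendsto_sum_nat
    simp only [vv_sum] at t1
    have hz : HasSum (fun n : ℕ => ((n : ℂ)) ^ (-s)) (riemannZeta s) := by
      rw [zeta_eq_tsum_one_div_nat_cpow hs]
      have := (Complex.summable_one_div_nat_cpow.mpr hs).hasSum
      simpa only [Complex.cpow_neg, one_div] using this
    have t2 : Tendsto (fun M : ℕ => ∑ n ∈ Ioc 0 M, (n : ℂ) ^ (-s)) atTop (nhds (riemannZeta s)) := by
      have := hz.tendsto_sum_nat.comp (tendsto_add_atTop_nat 1)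
      refine this.congr fun M => ?_
      simp only [Function.comp]
      rw [Finset.range_eq_Ico, sum_eq_sum_Ico_succ_bot (by omega)]
      have : ((0 : ℕ) : ℂ) ^ (-s) = 0 := by
        rw [Nat.cast_zero, Complex.zero_cpow]
        intro h; rw [neg_eq_zero] at h; rw [h] at hs; simp at hs; linarith
      rw [this, zero_add]
      rfl
    have t3 : Tendsto (fun M : ℕ => ((M : ℕ) : ℂ) ^ (1 - s)) atTop (nhds 0) := by
      rw [tendsto_zero_iff_norm_tendsto_zero]
      have h1 := (tendsto_rpow_neg_atTop (show 0 < s.re - 1 by linarith)).comp (tendsto_natCast_atTop_atTop (R := ℝ))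
      refine h1.congr' ?_
      filter_upwards [eventually_gt_atTop 0] with M hM
      simp only [Function.comp]
      rw [Complex.norm_natCast_cpow_of_pos hM]; simp
    have t4 : Tendsto (fun M : ℕ => (s - 1) * ∑ n ∈ Ioc N (N + M), (n : ℂ) ^ (-s)
      + ((N + M : ℕ) : ℂ) ^ (1 - s) - (N : ℂ) ^ (1 - s)) atTop
      (nhds ((s - 1) * (riemannZeta s - ∑ n ∈ Ioc 0 N, (n : ℂ) ^ (-s)) + 0 - (N : ℂ) ^ (1 - s))) := by
      have hadd : Tendsto (fun M : ℕ => N + M) atTop atTop := tendsto_atTop_mono (fun M => Nat.le_add_left M N) tendsto_id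
      refine Tendsto.sub_const (Tendsto.add (Tendsto.const_mul _ ?_) (t3.comp hadd)) _
      refine ((t2.comp hadd).sub_const _).congr fun M => ?_
      simp only [Function.comp]
      rw [← sum_Ioc_consecutive _ (Nat.zero_le N) (by omega : N ≤ N + M)]
      ring
    have := tendsto_nhds_unique t1 t4
    rw [this, riemannZeta_eq_inv_sub_mul hs1]
    have : s - 1 ≠ 0 := sub_ne_zero.mpr hs1
    field_simp
    ring
  have hA1 : AnalyticOnNhd ℂ riemannZeta₁ {s : ℂ | 0 < s.re} :=
    differentiable_riemannZeta₁.differentiableOn.analyticOnNhd hU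
  have hA2 : AnalyticOnNhd ℂ (fun s : ℂ => (s - 1) * ∑ n ∈ Ioc 0 N, (n : ℂ) ^ (-s) + (N : ℂ) ^ (1 - s)
      + ∑' i, vv (N + i) s) {s : ℂ | 0 < s.re} :=
    (hd2.differentiableOn.add hdiff).analyticOnNhd hU
  have hconn : IsPreconnected {s : ℂ | 0 < s.re} := (convex_halfSpace_re_gt 0).isPreconnected
  exact hA1.eqOn_of_preconnected_of_eventuallyEq hA2 hconn (z₀ := 2) (by simp)
    (eventually_of_mem ((isOpen_lt continuous_const Complex.continuous_re).mem_nhds (by norm_num : (1 : ℝ) < (2 : ℂ).re)) hgt) hs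

lemma tail_bound {N : ℕ} (hN : 1 ≤ N) {s : ℂ} (hs : 1 / 2 ≤ s.re) :
    ‖∑' i, vv (N + i) s‖ ≤ ‖s - 1‖ * (‖s‖ * (4 / √N)) := by
  have hterm : ∀ i : ℕ, ((N + i : ℕ) : ℝ) ^ (-s.re - 1) ≤ 4 * (1 / √((N + i : ℕ) : ℝ) - 1 / √((N + (i + 1) : ℕ) : ℝ)) := by
    intro i
    have hm : (1 : ℝ) ≤ ((N + i : ℕ) : ℝ) := by exact_mod_cast (by omega)
    rw [show ((N + (i + 1) : ℕ) : ℝ) = ((N + i : ℕ) : ℝ) + 1 by push_cast; ring]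
    set m : ℝ := ((N + i : ℕ) : ℝ)
    have hm0 : 0 < m := by linarith
    set a := √m with ha
    set b := √(m + 1) with hb
    have ha2 : a ^ 2 = m := Real.sq_sqrt hm0.le
    have hb2 : b ^ 2 = m + 1 := Real.sq_sqrt (by linarith)
    have ha0 : 0 < a := Real.sqrt_pos.mpr hm0
    have hb0 : 0 < b := Real.sqrt_pos.mpr (by linarith)
    have hba : b ≤ 3 / 2 * a := by
      rw [← abs_of_pos hb0, ← abs_of_pos (show 0 < 3 / 2 * a by positivity)]
      exact sq_le_sq.mp (by nlinarith)
    calc m ^ (-s.re - 1) ≤ m ^ (-(3 / 2) : ℝ) := rpow_le_rpow_of_exponent_le hm (by linarith)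
      _ = 1 / a ^ 3 := by
          rw [ha, Real.sqrt_eq_rpow, ← rpow_natCast, ← rpow_mul hm0.le, one_div, ← rpow_neg hm0.le]; norm_num
      _ ≤ _ := by
          rw [div_sub_div _ _ ha0.ne' hb0.ne', ← mul_div_assoc, div_le_div_iff₀ (by positivity) (by positivity)]
          have h1 : (b - a) * (b + a) = 1 := by nlinarith
          have hpos : 0 < b - a := by
            by_contra h
            have : (b - a) * (b + a) ≤ 0 := mul_nonpos_of_nonpos_of_nonneg (by linarith) (by positivity)
            linarith
          have h2 : 1 ≤ (b - a) * (5 / 2 * a) := by nlinarith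
          have h3 : a * b ≤ 3 / 2 * a ^ 2 := by nlinarith
          have h4 : a ^ 2 ≤ a ^ 2 * ((b - a) * (5 / 2 * a)) := le_mul_of_one_le_right (by positivity) h2
          nlinarith [mul_pos hpos (pow_pos ha0 3)]
  have hsumt : HasSum (fun i : ℕ => (1 / √((N + i : ℕ) : ℝ) - 1 / √((N + (i + 1) : ℕ) : ℝ))) (1 / √N) := by
    rw [hasSum_iff_tendsto_nat_of_nonneg]
    · have h : ∀ n : ℕ, ∑ i ∈ range n, (1 / √((N + i : ℕ) : ℝ) - 1 / √((N + (i + 1) : ℕ) : ℝ))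
          = 1 / √N - 1 / √((N + n : ℕ) : ℝ) := fun n =>
        sum_range_sub' (fun i => 1 / √((N + i : ℕ) : ℝ)) n
      simp only [h]
      have : Tendsto (fun n : ℕ => 1 / √((N + n : ℕ) : ℝ)) atTop (nhds 0) := by
        simp only [one_div]
        refine tendsto_inv_atTop_zero.comp (Real.tendsto_sqrt_atTop.comp ?_)
        exact tendsto_natCast_atTop_atTop.comp (tendsto_atTop_mono (fun M => Nat.le_add_left M N) tendsto_id)
      simpa using this.const_sub (1 / √N)
    · intro i
      have : (0 : ℝ) < ((N + i : ℕ) : ℝ) := by exact_mod_cast (by omega)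
      rw [sub_nonneg]
      refine one_div_le_one_div_of_le (Real.sqrt_pos.mpr this) (Real.sqrt_le_sqrt ?_)
      exact_mod_cast (by omega)
  have h := tsum_of_norm_bounded (((hsumt.mul_left 4).mul_left ‖s‖).mul_left ‖s - 1‖)
    (f := fun i => vv (N + i) s) (fun i => by
      refine (vv_bound (by omega) (by linarith)).trans ?_
      have := hterm i
      gcongr)
  refine h.trans (le_of_eq (by ring))

lemma abel_bd (a : ℕ → ℝ) (b : ℕ → ℂ) (K : ℝ) {N M : ℕ} (hNM : N ≤ M) (ha : ∀ n, N ≤ n → a (n + 1) ≤ a n)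
    (ha0 : ∀ n, 0 ≤ a n) (hK : ∀ m, N ≤ m → m ≤ M → ‖∑ n ∈ Ioc N m, b n‖ ≤ K) :
    ‖∑ n ∈ Ioc N M, (a n : ℂ) * b n‖ ≤ a N * K := by
  have key : ∀ m, N ≤ m → m ≤ M →
      ‖∑ n ∈ Ioc N m, (a n : ℂ) * b n - a m * ∑ n ∈ Ioc N m, b n‖ ≤ (a N - a m) * K := by
    intro m hm
    induction m, hm using Nat.le_induction with
    | base => simp
    | succ m hm ih =>
      intro hmM
      have h1 := ih (by omega)
      have h2 := hK m hm (by omega)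
      have e : ∑ n ∈ Ioc N (m + 1), (a n : ℂ) * b n - a (m + 1) * ∑ n ∈ Ioc N (m + 1), b n
          = (∑ n ∈ Ioc N m, (a n : ℂ) * b n - a m * ∑ n ∈ Ioc N m, b n)
            + ((a m - a (m + 1) : ℝ) : ℂ) * ∑ n ∈ Ioc N m, b n := by
        rw [sum_Ioc_succ_top (by omega), sum_Ioc_succ_top (by omega)]
        push_cast; ring
      rw [e]
      refine (norm_add_le _ _).trans ?_
      rw [norm_mul, Complex.norm_of_nonneg (by linarith [ha m hm])]
      have := mul_le_mul_of_nonneg_left h2 (by linarith [ha m hm] : 0 ≤ a m - a (m + 1))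
      linarith
  have h1 := key M hNM le_rfl
  have h2 : ‖(a M : ℂ) * ∑ n ∈ Ioc N M, b n‖ ≤ a M * K := by
    rw [norm_mul, Complex.norm_of_nonneg (ha0 M)]
    exact mul_le_mul_of_nonneg_left (hK M hNM le_rfl) (ha0 M)
  have := (norm_add_le _ _).trans (add_le_add h1 h2)
  rw [sub_add_cancel] at this
  linarith

lemma cpow_gg {n : ℕ} (hn : 1 ≤ n) (s : ℂ) : (n : ℂ) ^ (-s) = (((n : ℝ) ^ (-s.re) : ℝ) : ℂ) * gg s.im n := by
  have hn0 : (0 : ℝ) < n := by exact_mod_cast hn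
  have hn0' : (n : ℂ) ≠ 0 := by exact_mod_cast (by omega : n ≠ 0)
  rw [Complex.cpow_def_of_ne_zero hn0', gg, ee, rpow_def_of_pos hn0, Complex.ofReal_exp, ← Complex.exp_add,
    ← Complex.natCast_log]
  congr 1
  have hpi : (π : ℝ) ≠ 0 := pi_ne_zero
  have : (2 * π * (-(s.im / (2 * π)) * log n) : ℝ) = -(s.im * log n) := by field_simp
  rw [this]
  nth_rewrite 1 [← Complex.re_add_im s]
  push_cast; ring

noncomputable def th (t : ℝ) : ℝ := (log (log t) / log t) ^ (2 / 3 : ℝ)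

lemma expo_bd {x θ c L L' l : ℝ} (hx : 0 ≤ x) (hθ : 0 ≤ θ) (hc : 0 < c) (hL' : 0 < L') (hLL : L' ≤ L)
    (hl : θ * √θ * L = l) : x * (θ - c * (x / L') ^ 2) ≤ l / √c := by
  have hL : 0 < L := by linarith
  have hl0 : 0 ≤ l := by rw [← hl]; positivity
  have hsc : 0 < √c := Real.sqrt_pos.mpr hc
  rcases le_total (θ * L' ^ 2) (c * x ^ 2) with h | h
  · have : θ - c * (x / L') ^ 2 ≤ 0 := by
      rw [div_pow, ← mul_div_assoc, sub_nonpos, le_div_iff₀ (by positivity)]; exact h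
    exact (mul_nonpos_of_nonneg_of_nonpos hx this).trans (by positivity)
  · have h1 : √c * x ≤ √θ * L' := by
      have := Real.sqrt_le_sqrt h
      rwa [Real.sqrt_mul hc.le, Real.sqrt_mul hθ, Real.sqrt_sq hx, Real.sqrt_sq hL'.le] at this
    rw [le_div_iff₀ hsc]
    calc x * (θ - c * (x / L') ^ 2) * √c ≤ x * θ * √c := by
          gcongr
          have : 0 ≤ c * (x / L') ^ 2 := by positivity
          linarith
      _ = θ * (√c * x) := by ring
      _ ≤ θ * (√θ * L') := by gcongr
      _ ≤ θ * (√θ * L) := by gcongr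
      _ = l := by rw [← hl]; ring

lemma th_spec {t : ℝ} (hL : 0 < log t) (hl : 0 < log (log t)) :
    th t * √(th t) * log t = log (log t) := by
  have h : 0 < log (log t) / log t := by positivity
  rw [th, Real.sqrt_eq_rpow, ← rpow_mul h.le, ← rpow_add h]
  norm_num
  field_simp

lemma block_bd {C c T : ℝ} (hC : 0 < C) (hc : 0 < c)
    (hz : ∀ t : ℝ, T ≤ t → ∀ N M : ℕ, 1 ≤ N → (N : ℝ) ≤ t ^ 2 → N ≤ M → M ≤ 2 * N →
      ‖∑ n ∈ Ioc N M, gg t n‖ ≤ C * (log t) ^ 2 * (N : ℝ) ^ (1 - c * (log N / log t) ^ 2))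
    {s : ℂ} {t : ℝ} (hT : T ≤ s.im) (hs10 : 10 ≤ s.im) (hst : s.im ≤ t) (hre0 : 0 ≤ s.re)
    (hre : 1 - th t ≤ s.re) (hll : 0 < log (log t)) {N : ℕ} (hN : 1 ≤ N) (hNs : (N : ℝ) ≤ s.im ^ 2) :
    ‖∑ n ∈ Ioc N (2 * N), (n : ℂ) ^ (-s)‖ ≤ C * (log t) ^ (2 + 1 / √c) := by
  have hN0 : (0 : ℝ) < N := by exact_mod_cast hN
  have hlN : 0 ≤ log N := Real.log_nonneg (by exact_mod_cast hN)
  have hL' : 0 < log s.im := Real.log_pos (by linarith)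
  have hLL : log s.im ≤ log t := Real.log_le_log (by linarith) hst
  have hL : 0 < log t := by linarith
  have e : ∑ n ∈ Ioc N (2 * N), (n : ℂ) ^ (-s)
      = ∑ n ∈ Ioc N (2 * N), (((n : ℝ) ^ (-s.re) : ℝ) : ℂ) * gg s.im n :=
    sum_congr rfl fun n hn => cpow_gg (by have := (Finset.mem_Ioc.mp hn).1; omega) s
  rw [e]
  refine (abel_bd (fun n => (n : ℝ) ^ (-s.re)) (fun n => gg s.im n)
    (C * (log s.im) ^ 2 * (N : ℝ) ^ (1 - c * (log N / log s.im) ^ 2)) (by omega)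
    (fun n hn => ?_) (fun n => by positivity) (fun m hm1 hm2 => hz s.im hT N m hN hNs hm1 hm2)).trans ?_
  · refine rpow_le_rpow_of_nonpos (by exact_mod_cast (by omega : 0 < n)) ?_ (by linarith)
    push_cast; linarith
  have hth0 : 0 ≤ th t := by rw [th]; positivity
  have hE := expo_bd hlN hth0 hc hL' hLL (th_spec hL hll)
  have hpow : (N : ℝ) ^ (-s.re) * (N : ℝ) ^ (1 - c * (log N / log s.im) ^ 2) ≤ (log t) ^ (1 / √c) := by
    rw [← rpow_add hN0, rpow_def_of_pos hN0, rpow_def_of_pos hL]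
    refine Real.exp_le_exp.mpr (le_trans ?_ (hE.trans (le_of_eq (by ring))))
    refine mul_le_mul_of_nonneg_left ?_ hlN
    linarith
  calc (N : ℝ) ^ (-s.re) * (C * (log s.im) ^ 2 * (N : ℝ) ^ (1 - c * (log N / log s.im) ^ 2))
      = C * (log s.im) ^ 2 * ((N : ℝ) ^ (-s.re) * (N : ℝ) ^ (1 - c * (log N / log s.im) ^ 2)) := by ring
    _ ≤ C * (log t) ^ 2 * (log t) ^ (1 / √c) := by gcongr
    _ = _ := by rw [rpow_add hL, rpow_two]; ring

lemma dyadic (f : ℕ → ℂ) (J : ℕ) :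
    ∑ n ∈ Ioc 0 (2 ^ J), f n = f 1 + ∑ j ∈ range J, ∑ n ∈ Ioc (2 ^ j) (2 * 2 ^ j), f n := by
  induction J with
  | zero =>
    rw [pow_zero, show Ioc 0 1 = {1} from rfl]; simp
  | succ J ih =>
    rw [sum_range_succ, ← add_assoc, ← ih, pow_succ', sum_Ioc_consecutive _ (by positivity) (by omega)]

lemma zeta_bd_pos : ∃ A T : ℝ, 1 ≤ A ∧ 10 ≤ T ∧ ∀ t : ℝ, T ≤ t → ∀ s : ℂ, T ≤ s.im → s.im ≤ t →
    1 - th t ≤ s.re → s.re ≤ 2 → ‖riemannZeta s‖ ≤ (log t) ^ A := by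
  obtain ⟨C, c, T, hC, hc, hT10, hz⟩ := zsum
  have hE1 : ∀ᶠ t : ℝ in atTop, 4 * C + 30 ≤ log t := tendsto_log_atTop.eventually_ge_atTop _
  have hE2 : ∀ᶠ t : ℝ in atTop, th t ≤ 1 / 2 := by
    have h1 : Tendsto (fun t : ℝ => th t) atTop (nhds 0) := by
      have h2 : Tendsto (fun x : ℝ => log x / x) atTop (nhds 0) := by
        have := Real.isLittleO_log_id_atTop.tendsto_div_nhds_zero
        exact this
      have h3 := (h2.comp tendsto_log_atTop).rpow_const (p := (2 / 3 : ℝ)) (Or.inr (by norm_num))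
      rw [zero_rpow (by norm_num)] at h3
      exact h3
    exact h1.eventually_le_const (by norm_num)
  obtain ⟨T1, hT1⟩ := eventually_atTop.mp (hE1.and hE2)
  have hA0 : 0 < 1 / √c := by positivity
  refine ⟨4 + 1 / √c, max T (max T1 10), by linarith, (le_max_right _ _).trans (le_max_right _ _), ?_⟩
  intro t ht s hTs hst hre hre2
  obtain ⟨hL1, hth⟩ := hT1 t (((le_max_left _ _).trans (le_max_right _ _)).trans ht)
  have hTs' : T ≤ s.im := (le_max_left _ _).trans hTs
  have hs10 : 10 ≤ s.im := ((le_max_right _ _).trans (le_max_right _ _)).trans hTs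
  set L := log t with hL
  have hL30 : 30 ≤ L := by linarith
  have hll : 0 < log L := Real.log_pos (by linarith)
  have hre12 : 1 / 2 ≤ s.re := by linarith
  have hs1 : s ≠ 1 := by intro h; rw [h] at hs10; simp at hs10; linarith
  have hs1' : s - 1 ≠ 0 := sub_ne_zero.mpr hs1
  have hfl : ⌊s.im ^ 2⌋₊ ≠ 0 := by
    have : 1 ≤ ⌊s.im ^ 2⌋₊ := Nat.le_floor (by push_cast; nlinarith)
    omega
  set J := Nat.log 2 ⌊s.im ^ 2⌋₊ with hJ
  have hJ1 : ((2 ^ J : ℕ) : ℝ) ≤ s.im ^ 2 :=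
    (Nat.cast_le.mpr (Nat.pow_log_le_self 2 hfl)).trans (Nat.floor_le (by positivity))
  have hJ2 : s.im ^ 2 ≤ 2 * ((2 ^ J : ℕ) : ℝ) := by
    have h1 := Nat.lt_pow_succ_log_self (by norm_num : 1 < 2) ⌊s.im ^ 2⌋₊
    have h2 := Nat.lt_floor_add_one (s.im ^ 2)
    have h3 : ((⌊s.im ^ 2⌋₊ + 1 : ℕ) : ℝ) ≤ ((2 ^ (J + 1) : ℕ) : ℝ) := by exact_mod_cast h1
    push_cast at h3 ⊢
    rw [pow_succ (2 : ℝ) J] at h3; linarith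
  have hJL : (J : ℝ) ≤ 4 * L := by
    have h1 := Real.log_le_log (by positivity) hJ1
    push_cast at h1
    rw [Real.log_pow, Real.log_pow] at h1
    have h2 : log s.im ≤ L := Real.log_le_log (by linarith) hst
    have h3 := Real.log_two_gt_d9
    have : (0 : ℝ) ≤ J := by positivity
    push_cast at h1
    nlinarith
  set N : ℕ := 2 ^ J with hN
  have hN1 : 1 ≤ N := Nat.one_le_two_pow
  have hN1' : (1 : ℝ) ≤ N := by exact_mod_cast hN1
  have hsn : ‖s‖ ≤ 2 * s.im := by
    refine (Complex.norm_le_abs_re_add_abs_im s).trans ?_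
    rw [abs_of_nonneg (by linarith), abs_of_nonneg (by linarith)]; linarith
  have hs1n : s.im ≤ ‖s - 1‖ := by
    have := Complex.abs_im_le_norm (s - 1)
    simp only [Complex.sub_im, Complex.one_im, sub_zero] at this
    exact (le_abs_self _).trans this
  set B := C * L ^ (2 + 1 / √c) with hB
  have hsum : ‖∑ n ∈ Ioc 0 N, (n : ℂ) ^ (-s)‖ ≤ 1 + J * B := by
    rw [hN, dyadic]
    refine (norm_add_le _ _).trans (add_le_add (by simp) ?_)
    refine (norm_sum_le _ _).trans ?_
    have : ∀ j ∈ range J, ‖∑ n ∈ Ioc (2 ^ j : ℕ) (2 * 2 ^ j), (n : ℂ) ^ (-s)‖ ≤ B := by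
      intro j hj
      refine block_bd hC hc hz hTs' hs10 hst (by linarith) hre hll Nat.one_le_two_pow ?_
      refine le_trans ?_ hJ1
      exact_mod_cast Nat.pow_le_pow_right (by norm_num) (Finset.mem_range.mp hj).le
    refine (sum_le_sum this).trans (le_of_eq (by simp))
  have hN2 : ‖(N : ℂ) ^ (1 - s)‖ ≤ ‖s - 1‖ := by
    rw [Complex.norm_natCast_cpow_of_pos hN1]
    refine le_trans ?_ hs1n
    calc (N : ℝ) ^ (1 - s).re ≤ (N : ℝ) ^ (1 / 2 : ℝ) := by
          refine rpow_le_rpow_of_exponent_le hN1' ?_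
          simp only [Complex.sub_re, Complex.one_re]; linarith
      _ ≤ (s.im ^ 2) ^ (1 / 2 : ℝ) := rpow_le_rpow (by positivity) hJ1 (by norm_num)
      _ = s.im := by rw [← Real.sqrt_eq_rpow, Real.sqrt_sq (by linarith)]
  have htail := tail_bound hN1 hre12
  have h8 : ‖s‖ * (4 / √N) ≤ 16 := by
    have h1 : s.im ≤ 2 * √N := by
      refine Real.le_sqrt_of_sq_le ?_ |>.trans (le_of_eq (show √(4 * N) = 2 * √N by
        rw [Real.sqrt_mul (by norm_num), show (4 : ℝ) = 2 ^ 2 by norm_num, Real.sqrt_sq (by norm_num)]))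
      linarith
    have h2 : 0 < √(N : ℝ) := Real.sqrt_pos.mpr (by linarith)
    rw [← mul_div_assoc, div_le_iff₀ h2]; linarith
  have hmain : ‖riemannZeta₁ s‖ ≤ ‖s - 1‖ * (1 + J * B + 1 + 16) := by
    rw [zeta1_approx hN1 (by linarith : 0 < s.re)]
    refine (norm_add_le _ _).trans ?_
    have a1 := norm_add_le ((s - 1) * ∑ n ∈ Ioc 0 N, (n : ℂ) ^ (-s)) ((N : ℂ) ^ (1 - s))
    rw [norm_mul] at a1
    have a2 := mul_le_mul_of_nonneg_left hsum (norm_nonneg (s - 1))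
    have a3 := mul_le_mul_of_nonneg_left h8 (norm_nonneg (s - 1))
    linarith
  rw [riemannZeta_eq_inv_sub_mul hs1, norm_mul, norm_inv]
  have hpos : 0 < ‖s - 1‖ := norm_pos_iff.mpr hs1'
  rw [inv_mul_le_iff₀ hpos]
  refine hmain.trans (mul_le_mul_of_nonneg_left ?_ hpos.le)
  have hL0 : 0 < L := by linarith
  have hP : L ^ (4 + 1 / √c) = L * (L * L ^ (2 + 1 / √c)) := by
    rw [show 4 + 1 / √c = 1 + (1 + (2 + 1 / √c)) by ring, rpow_add hL0, rpow_add hL0 1, rpow_one]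
  have hQ : 1 ≤ L ^ (2 + 1 / √c) := one_le_rpow (by linarith) (by linarith)
  set Q := L ^ (2 + 1 / √c)
  rw [hP, hB]
  have b1 : (J : ℝ) * (C * Q) ≤ 4 * L * (C * Q) := by gcongr
  have b2 : 1 ≤ L * Q := by nlinarith
  have b3 : (4 * C + 30) * (L * Q) ≤ L * (L * Q) := by gcongr
  linarith

theorem zeta_bd : ∃ A T : ℝ, 1 ≤ A ∧ 10 ≤ T ∧ ∀ t : ℝ, T ≤ t → ∀ s : ℂ, T ≤ |s.im| → |s.im| ≤ t →
    1 - th t ≤ s.re → s.re ≤ 2 → ‖riemannZeta s‖ ≤ (log t) ^ A := by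
  obtain ⟨A, T, hA, hT, h⟩ := zeta_bd_pos
  refine ⟨A, T, hA, hT, fun t ht s h1 h2 h3 h4 => ?_⟩
  rcases le_total 0 s.im with h0 | h0
  · rw [abs_of_nonneg h0] at h1 h2
    exact h t ht s h1 h2 h3 h4
  · rw [abs_of_nonpos h0] at h1 h2
    have := h t ht (conj s) (by simpa using h1) (by simpa using h2) (by simpa using h3) (by simpa using h4)
    rwa [riemannZeta_conj, RCLike.norm_conj] at this

lemma logder_bd {f : ℂ → ℂ} {r M : ℝ} (hM : 0 < M) (hf : DifferentiableOn ℂ f (Metric.ball 0 r))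
    (h0 : ∀ z ∈ Metric.ball (0:ℂ) r, f z ≠ 0)
    (hB : ∀ z ∈ Metric.ball (0:ℂ) r, ‖f z‖ ≤ ‖f 0‖ * exp M) {z : ℂ} (hz : ‖z‖ < r) :
    ‖deriv f z / f z‖ ≤ 8 * r * M / (r - ‖z‖) ^ 2 := by
  have hr : 0 < r := (norm_nonneg z).trans_lt hz
  have hmem0 : (0:ℂ) ∈ Metric.ball (0:ℂ) r := Metric.mem_ball_self hr
  have hd : DifferentiableOn ℂ (fun z => deriv f z / f z) (Metric.ball 0 r) :=
    (hf.deriv Metric.isOpen_ball).div hf h0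
  obtain ⟨h, hh0, hh⟩ := hd.isExactOn_ball.with_val_at 0 0
  have hfd : ∀ w ∈ Metric.ball (0:ℂ) r, HasDerivAt f (deriv f w) w := fun w hw =>
    (hf.differentiableAt (Metric.isOpen_ball.mem_nhds hw)).hasDerivAt
  have hconst : ∀ w ∈ Metric.ball (0:ℂ) r, f w * Complex.exp (-h w) = f 0 := by
    have hk : ∀ w ∈ Metric.ball (0:ℂ) r, HasDerivAt (fun w => f w * Complex.exp (-h w)) 0 w := by
      intro w hw
      have h1 := (hfd w hw).mul ((hh w hw).neg.cexp)
      have h2 := h0 w hw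
      have h3 : deriv f w * Complex.exp (-h w) + f w * (Complex.exp (-h w) * -(deriv f w / f w)) = 0 := by
        linear_combination -(Complex.exp (-h w)) * (div_mul_cancel₀ (deriv f w) h2)
      rw [← h3]
      exact h1
    intro w hw
    have h3 : ‖(fun w => f w * Complex.exp (-h w)) w - (fun w => f w * Complex.exp (-h w)) 0‖ ≤ 0 * ‖w - 0‖ :=
      (convex_ball (0:ℂ) r).norm_image_sub_le_of_norm_hasDerivWithin_le (f' := fun _ => 0)
        (fun x hx => (hk x hx).hasDerivWithinAt) (by simp) hmem0 hw
    simp only [zero_mul, norm_le_zero_iff, hh0, neg_zero, Complex.exp_zero, mul_one] at h3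
    exact sub_eq_zero.mp h3
  have hre : Set.MapsTo h (Metric.ball 0 r) {z | z.re ≤ M} := by
    intro w hw
    have h1 : f w = f 0 * Complex.exp (h w) := by
      rw [← hconst w hw, mul_assoc, ← Complex.exp_add]; simp
    have h2 := hB w hw
    rw [h1, norm_mul, Complex.norm_exp] at h2
    have h3 : 0 < ‖f 0‖ := norm_pos_iff.mpr (h0 0 hmem0)
    exact Real.exp_le_exp.mp (le_of_mul_le_mul_left h2 h3)
  have hhd : DifferentiableOn ℂ h (Metric.ball 0 r) := fun w hw =>
    (hh w hw).differentiableAt.differentiableWithinAt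
  have hzm : z ∈ Metric.ball (0:ℂ) r := by simpa using hz
  rw [← (hh z hzm).deriv]
  set ρ := (r - ‖z‖) / 2 with hρ
  have hρ0 : 0 < ρ := by rw [hρ]; linarith
  have hsub : Metric.closedBall z ρ ⊆ Metric.ball 0 r := by
    intro w hw
    rw [Metric.mem_closedBall, dist_eq_norm] at hw
    rw [mem_ball_zero_iff]
    have := norm_le_norm_add_norm_sub' w z
    rw [hρ] at hw
    linarith
  have hc := Complex.norm_deriv_le_of_forall_mem_sphere_norm_le (c := z) (R := ρ) (C := 4 * M * r / (r - ‖z‖))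
    (f := h) hρ0
    ((hhd.mono (by rw [closure_ball _ hρ0.ne']; exact hsub)).diffContOnCl) ?_
  · refine hc.trans (le_of_eq ?_)
    have : r - ‖z‖ ≠ 0 := by linarith
    rw [hρ]; field_simp; ring
  · intro w hw
    have hwb := hsub (Metric.sphere_subset_closedBall hw)
    have h1 := Complex.borelCaratheodory_zero hM hhd hre hr hwb hh0
    rw [mem_sphere_iff_norm] at hw
    have h2 := norm_le_norm_add_norm_sub' w z
    rw [mem_ball_zero_iff] at hwb
    have h4 : 0 < r - ‖z‖ := by linarith
    refine h1.trans ?_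
    rw [div_le_div_iff₀ (by linarith) h4]
    have h3 : r - ‖z‖ ≤ 2 * (r - ‖w‖) := by rw [hw, hρ] at h2; linarith
    nlinarith [mul_le_mul hwb.le h3 h4.le hr.le, norm_nonneg w]

lemma blaschke {f : ℂ → ℂ} {U : Set ℂ} {R B : ℝ} {ρ : ℂ} (hR : 0 < R) (hU : IsOpen U)
    (hUR : Metric.closedBall 0 R ⊆ U) (hf : DifferentiableOn ℂ f U)
    (hB : ∀ z ∈ Metric.sphere (0:ℂ) R, ‖f z‖ ≤ B) (hf0 : f 0 ≠ 0) (hρ : f ρ = 0) (hρR : ‖ρ‖ < R) :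
    ∃ g : ℂ → ℂ, DifferentiableOn ℂ g U ∧ (∀ z ∈ Metric.sphere (0:ℂ) R, ‖g z‖ ≤ B) ∧
      ‖f 0‖ * R = ‖g 0‖ * ‖ρ‖ ∧ (∀ z, ‖z‖ < R → g z = 0 → f z = 0) ∧
      deriv f 0 / f 0 = deriv g 0 / g 0 - 1 / ρ + conj ρ / R ^ 2 := by
  have hρ0 : ρ ≠ 0 := by rintro rfl; exact hf0 hρ
  have hρU : ρ ∈ U := hUR (by simpa using hρR.le)
  have hRc : (R : ℂ) ≠ 0 := by exact_mod_cast hR.ne'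
  set q := dslope f ρ with hq
  have hfq : ∀ z, f z = (z - ρ) * q z := by
    intro z
    have := sub_smul_dslope f ρ z
    rw [hρ, sub_zero, smul_eq_mul] at this
    exact this.symm
  have hqd : DifferentiableOn ℂ q U := (Complex.differentiableOn_dslope (hU.mem_nhds hρU)).mpr hf
  have hgd : DifferentiableOn ℂ (fun z => q z * ((R ^ 2 - conj ρ * z) / R)) U := hqd.mul (by fun_prop)
  have hne : ∀ z : ℂ, ‖z‖ < R → (R : ℂ) ^ 2 - conj ρ * z ≠ 0 := by
    intro z hz h
    have h1 : (R:ℂ) ^ 2 = conj ρ * z := sub_eq_zero.mp h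
    have h2 := congrArg norm h1
    simp only [norm_pow, Complex.norm_real, norm_mul, RCLike.norm_conj, Real.norm_eq_abs, sq_abs] at h2
    nlinarith [norm_nonneg z, norm_nonneg ρ]
  refine ⟨fun z => q z * ((R ^ 2 - conj ρ * z) / R), hgd, ?_, ?_, ?_, ?_⟩
  · intro z hz
    have hz' : ‖z‖ = R := by simpa using hz
    have h1 : (R:ℂ) ^ 2 - conj ρ * z = z * conj (z - ρ) := by
      rw [map_sub, mul_sub, Complex.mul_conj, Complex.normSq_eq_norm_sq, hz']
      push_cast; ring
    have h2 : ‖q z * ((R ^ 2 - conj ρ * z) / R)‖ = ‖f z‖ := by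
      rw [h1, hfq z]
      simp only [norm_mul, norm_div, RCLike.norm_conj, hz', Complex.norm_real, Real.norm_eq_abs, abs_of_pos hR]
      field_simp
    rw [h2]; exact hB z hz
  · rw [hfq 0]
    simp only [zero_sub, mul_zero, sub_zero, norm_mul, norm_neg, norm_div, norm_pow, Complex.norm_real, Real.norm_eq_abs, abs_of_pos hR]
    field_simp
  · intro z hz hg
    have := mul_eq_zero.mp hg
    rw [hfq z]
    rcases this with h | h
    · simp [h]
    · exact absurd h (div_ne_zero (hne z hz) hRc)
  · have h0U : (0:ℂ) ∈ U := hUR (by simpa using hR.le)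
    have hq0 : HasDerivAt q (deriv q 0) 0 := (hqd.differentiableAt (hU.mem_nhds h0U)).hasDerivAt
    have hqn : q 0 ≠ 0 := by
      intro h; apply hf0; rw [hfq 0, h, mul_zero]
    have e1 : deriv f 0 = 1 * q 0 + (0 - ρ) * deriv q 0 := by
      have : f = fun z => (z - ρ) * q z := funext hfq
      rw [this]
      exact (((hasDerivAt_id (0:ℂ)).sub_const ρ).mul hq0).deriv
    have e2 : deriv (fun z => q z * ((R ^ 2 - conj ρ * z) / R)) 0
        = deriv q 0 * ((R ^ 2 - conj ρ * 0) / R) + q 0 * ((-(conj ρ * 1)) / R) := by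
      have h3 : HasDerivAt (fun z : ℂ => ((R:ℂ) ^ 2 - conj ρ * z) / R) ((-(conj ρ * 1)) / R) 0 :=
        (((hasDerivAt_id (0:ℂ)).const_mul (conj ρ)).const_sub _).div_const _
      exact (hq0.mul h3).deriv
    rw [e1, e2, hfq 0]
    field_simp
    ring

/-- Lower bound for the real part of the logarithmic derivative at the centre. -/
lemma landau1 {U : Set ℂ} {R B : ℝ} (hR : 0 < R) (hU : IsOpen U)
    (hUR : Metric.closedBall 0 R ⊆ U) (k : ℕ) : ∀ f : ℂ → ℂ, DifferentiableOn ℂ f U →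
    (∀ z ∈ Metric.sphere (0:ℂ) R, ‖f z‖ ≤ B) → f 0 ≠ 0 → B < 2 ^ k * ‖f 0‖ →
    (∀ z : ℂ, ‖z‖ < R / 2 → f z = 0 → z.re ≤ 0) →
    -(deriv f 0 / f 0).re ≤ 16 * (log (B / ‖f 0‖) + 1) / R := by
  have hmax : ∀ f : ℂ → ℂ, DifferentiableOn ℂ f U →
      (∀ z ∈ Metric.sphere (0:ℂ) R, ‖f z‖ ≤ B) → ∀ z : ℂ, ‖z‖ ≤ R → ‖f z‖ ≤ B := by
    intro f hf hB z hz
    refine Complex.norm_le_of_forall_mem_frontier_norm_le (U := Metric.ball (0:ℂ) R) Metric.isBounded_ball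
      ((hf.mono (by rw [closure_ball _ hR.ne']; exact hUR)).diffContOnCl) ?_ ?_
    · intro z hz
      rw [frontier_ball _ hR.ne'] at hz
      exact hB z hz
    · rw [closure_ball _ hR.ne']; simpa using hz
  induction k with
  | zero =>
    intro f hf hB h0 hlt _
    exfalso
    have := hmax f hf hB 0 (by simpa using hR.le)
    linarith
  | succ k ih =>
    intro f hf hB h0 hlt hre
    have hf0 : 0 < ‖f 0‖ := norm_pos_iff.mpr h0
    have hfB : ‖f 0‖ ≤ B := hmax f hf hB 0 (by simpa using hR.le)
    by_cases hz : ∃ ρ : ℂ, ‖ρ‖ < R / 2 ∧ f ρ = 0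
    · obtain ⟨ρ, hρR, hρ⟩ := hz
      obtain ⟨g, hg, hgB, hg0, hgz, hgd⟩ := blaschke hR hU hUR hf hB h0 hρ (by linarith)
      have hρ0 : ρ ≠ 0 := by rintro rfl; exact h0 hρ
      have hρp : 0 < ‖ρ‖ := norm_pos_iff.mpr hρ0
      have hg2 : 2 * ‖f 0‖ ≤ ‖g 0‖ := by
        have h1 := norm_nonneg (g 0)
        nlinarith
      have hgp : 0 < ‖g 0‖ := by linarith
      have h1 := ih g hg hgB (norm_pos_iff.mp hgp) (by
          rw [pow_succ] at hlt
          have : (0:ℝ) < 2 ^ k := by positivity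
          nlinarith) (fun z hz h => hre z hz (hgz z (by linarith) h))
      have h2 : (1 / ρ).re = ρ.re / ‖ρ‖ ^ 2 := by
        rw [one_div, Complex.inv_re, Complex.normSq_eq_norm_sq]
      have h3 : (conj ρ / (R:ℂ) ^ 2).re = ρ.re / R ^ 2 := by
        rw [← Complex.ofReal_pow, Complex.div_ofReal_re, Complex.conj_re]
      have h4 : ρ.re / ‖ρ‖ ^ 2 ≤ ρ.re / R ^ 2 := by
        have := hre ρ hρR hρ
        rw [div_le_div_iff₀ (by positivity) (by positivity)]
        have h5 : ‖ρ‖ ^ 2 ≤ R ^ 2 := by gcongr; linarith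
        nlinarith
      rw [hgd, Complex.add_re, Complex.sub_re, h2, h3]
      have h6 : log (B / ‖g 0‖) ≤ log (B / ‖f 0‖) := by
        have : 0 < B := hf0.trans_le hfB
        apply Real.log_le_log (by positivity)
        gcongr
        linarith
      have h7 : 16 * (log (B / ‖g 0‖) + 1) / R ≤ 16 * (log (B / ‖f 0‖) + 1) / R := by gcongr
      linarith
    · push Not at hz
      have hlog : 0 ≤ log (B / ‖f 0‖) := Real.log_nonneg (by rw [le_div_iff₀ hf0]; linarith)
      have h1 := logder_bd (f := f) (r := R / 2) (M := log (B / ‖f 0‖) + 1) (z := 0) (by linarith)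
        (hf.mono (fun z hz => hUR (by
          rw [mem_ball_zero_iff] at hz; rw [mem_closedBall_zero_iff]; linarith)))
        (fun z hz' => hz z (by simpa using hz')) (fun z hz' => by
          rw [mem_ball_zero_iff] at hz'
          refine (hmax f hf hB z (by linarith)).trans ?_
          rw [Real.exp_add, Real.exp_log (by have : 0 < B := hf0.trans_le hfB
                                             positivity)]
          have : 1 ≤ exp 1 := Real.one_le_exp (by norm_num)
          have h8 : ‖f 0‖ * (B / ‖f 0‖ * exp 1) = B * exp 1 := by field_simp
          rw [h8]
          nlinarith) (by simpa using hR)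
      have h2 := (Complex.abs_re_le_norm _).trans h1
      have h3 := (neg_le_abs _).trans h2
      refine h3.trans (le_of_eq ?_)
      rw [norm_zero, sub_zero, div_eq_div_iff (by positivity) hR.ne']; ring

/-- Version with one marked zero. -/
lemma landau2 {U : Set ℂ} {R B : ℝ} (hR : 0 < R) (hU : IsOpen U)
    (hUR : Metric.closedBall 0 R ⊆ U) {f : ℂ → ℂ} (hf : DifferentiableOn ℂ f U)
    (hB : ∀ z ∈ Metric.sphere (0:ℂ) R, ‖f z‖ ≤ B) (h0 : f 0 ≠ 0)
    (hre : ∀ z : ℂ, ‖z‖ < R / 2 → f z = 0 → z.re ≤ 0) :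
    -(deriv f 0 / f 0).re ≤ 16 * (log (B / ‖f 0‖) + 1) / R ∧
    ∀ a : ℝ, 0 < a → a ≤ R / 4 → f (-a : ℝ) = 0 →
      -(deriv f 0 / f 0).re ≤ 16 * (log (B / ‖f 0‖) + 1) / R - (15 / 16) / a := by
  have key : ∀ g : ℂ → ℂ, DifferentiableOn ℂ g U →
      (∀ z ∈ Metric.sphere (0:ℂ) R, ‖g z‖ ≤ B) → g 0 ≠ 0 → 
      (∀ z : ℂ, ‖z‖ < R / 2 → g z = 0 → z.re ≤ 0) →
      -(deriv g 0 / g 0).re ≤ 16 * (log (B / ‖g 0‖) + 1) / R := by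
    intro g hg hgB hg0 hgre
    have hp : 0 < ‖g 0‖ := norm_pos_iff.mpr hg0
    obtain ⟨k, hk⟩ := pow_unbounded_of_one_lt (B / ‖g 0‖) (by norm_num : (1:ℝ) < 2)
    rw [div_lt_iff₀ hp] at hk
    exact landau1 hR hU hUR k g hg hgB hg0 hk hgre
  refine ⟨key f hf hB h0 hre, ?_⟩
  intro a ha haR hfa
  have hna : ‖((-a : ℝ) : ℂ)‖ = a := by rw [Complex.norm_real, norm_neg, Real.norm_eq_abs, abs_of_pos ha]
  obtain ⟨g, hg, hgB, hg0, hgz, hgd⟩ := blaschke hR hU hUR hf hB h0 hfa (by rw [hna]; linarith)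
  have hf0 : 0 < ‖f 0‖ := norm_pos_iff.mpr h0
  rw [hna] at hg0
  have hg2 : ‖f 0‖ ≤ ‖g 0‖ := by
    have h1 := norm_nonneg (g 0)
    nlinarith
  have hgp : 0 < ‖g 0‖ := by linarith
  have h1 := key g hg hgB (norm_pos_iff.mp hgp) (fun z hz h => hre z hz (hgz z (by linarith) h))
  have hBp : 0 < B := by
    have h2 : ‖g 0‖ ≤ B := by
      refine Complex.norm_le_of_forall_mem_frontier_norm_le (U := Metric.ball (0:ℂ) R) Metric.isBounded_ball
        ((hg.mono (by rw [closure_ball _ hR.ne']; exact hUR)).diffContOnCl) ?_ ?_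
      · intro z hz
        rw [frontier_ball _ hR.ne'] at hz
        exact hgB z hz
      · rw [closure_ball _ hR.ne']; simpa using hR.le
    linarith
  have h6 : log (B / ‖g 0‖) ≤ log (B / ‖f 0‖) := by
    apply Real.log_le_log (by positivity)
    gcongr
  have h7 : 16 * (log (B / ‖g 0‖) + 1) / R ≤ 16 * (log (B / ‖f 0‖) + 1) / R := by gcongr
  have h8 : deriv f 0 / f 0 = deriv g 0 / g 0 + ((1 / a - a / R ^ 2 : ℝ) : ℂ) := by
    rw [hgd, Complex.conj_ofReal]; push_cast
    have : (a:ℂ) ≠ 0 := by exact_mod_cast ha.ne'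
    field_simp; ring
  rw [h8, Complex.add_re, Complex.ofReal_re]
  have h9 : a / R ^ 2 ≤ 1 / 16 / a := by
    rw [div_le_div_iff₀ (by positivity) ha]
    nlinarith
  have h10 : 1 / a = 15 / 16 / a + 1 / 16 / a := by ring
  linarith


lemma norm_LS_le {f : ℕ → ℂ} {b : ℕ → ℝ} (hfb : ∀ n, ‖f n‖ ≤ b n) {s : ℂ}
    (hb : LSeriesSummable (fun n => (b n : ℂ)) s) :
    ‖LSeries f s‖ ≤ ‖LSeries (fun n => (b n : ℂ)) (s.re : ℂ)‖ := by
  have hb0 : ∀ n, 0 ≤ b n := fun n => (norm_nonneg _).trans (hfb n)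
  have hn : ∀ n, ‖LSeries.term f s n‖ ≤ ‖LSeries.term (fun n => (b n : ℂ)) s n‖ := fun n =>
    LSeries.norm_term_le s (by simpa [abs_of_nonneg (hb0 n)] using hfb n)
  have h1 : Summable (fun n => ‖LSeries.term (fun n => (b n : ℂ)) s n‖) := hb.norm
  have h2 : Summable (fun n => ‖LSeries.term f s n‖) := h1.of_nonneg_of_le (fun _ => norm_nonneg _) hn
  have h3 : LSeries (fun n => (b n : ℂ)) (s.re : ℂ) = ((∑' n, ‖LSeries.term (fun n => (b n : ℂ)) s n‖ : ℝ) : ℂ) := by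
    rw [LSeries, Complex.ofReal_tsum]
    congr 1; ext n
    rw [LSeries.norm_term_eq, LSeries.term_def]
    split_ifs with h
    · simp
    · rw [Complex.norm_real, Real.norm_eq_abs, abs_of_nonneg (hb0 n)]
      push_cast
      rw [Complex.ofReal_cpow (by positivity)]
      simp
  rw [h3, Complex.norm_real, Real.norm_eq_abs, abs_of_nonneg (tsum_nonneg fun _ => norm_nonneg _)]
  calc ‖LSeries f s‖ ≤ ∑' n, ‖LSeries.term f s n‖ := norm_tsum_le_tsum_norm h2
    _ ≤ _ := h2.tsum_le_tsum hn h1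

lemma zeta_eq1 {s : ℂ} (hs : s ≠ 1) : riemannZeta s = (s - 1)⁻¹ * riemannZeta₁ s :=
  riemannZeta_eq_inv_sub_mul hs

lemma zeta1_ne {s : ℂ} (hs : 1 ≤ s.re) : riemannZeta₁ s ≠ 0 := by
  by_cases h : s = 1
  · rw [h, riemannZeta₁_one]; exact one_ne_zero
  · intro h0
    have := riemannZeta_ne_zero_of_one_le_re hs
    rw [zeta_eq1 h, h0, mul_zero] at this
    exact this rfl

lemma logder_zeta {s : ℂ} (hs : s ≠ 1) (h1 : riemannZeta₁ s ≠ 0) :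
    deriv riemannZeta s / riemannZeta s = -(s - 1)⁻¹ + deriv riemannZeta₁ s / riemannZeta₁ s := by
  have hs' : s - 1 ≠ 0 := sub_ne_zero.mpr hs
  have h2 : HasDerivAt (fun z : ℂ => (z - 1)⁻¹ * riemannZeta₁ z)
      (-1 / (s - 1) ^ 2 * riemannZeta₁ s + (s - 1)⁻¹ * deriv riemannZeta₁ s) s :=
    (((hasDerivAt_id s).sub_const 1).inv hs').mul (differentiable_riemannZeta₁ s).hasDerivAt
  have h3 : riemannZeta =ᶠ[nhds s] fun z : ℂ => (z - 1)⁻¹ * riemannZeta₁ z := by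
    filter_upwards [isOpen_ne.mem_nhds hs] with z hz using zeta_eq1 hz
  rw [h3.deriv_eq, h2.deriv, zeta_eq1 hs]
  field_simp

lemma zeta_real : ∃ C : ℝ, 1 ≤ C ∧ ∀ s : ℂ, 1 < s.re → s.re ≤ 2 →
    ‖riemannZeta s‖ ≤ C / (s.re - 1) ∧ (s.re - 1) / C ≤ ‖riemannZeta s‖ ∧
    -(deriv riemannZeta s.re / riemannZeta s.re).re ≤ 1 / (s.re - 1) + C ∧
    ‖deriv riemannZeta s / riemannZeta s‖ ≤ C / (s.re - 1) := by
  have hK : IsCompact ((fun x : ℝ => (x : ℂ)) '' Set.Icc 1 2) := isCompact_Icc.image Complex.continuous_ofReal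
  have hc1 := differentiable_riemannZeta₁.continuous.continuousOn (s := (fun x : ℝ => (x : ℂ)) '' Set.Icc 1 2)
  have hd1 : ContinuousOn (fun s => deriv riemannZeta₁ s / riemannZeta₁ s) ((fun x : ℝ => (x : ℂ)) '' Set.Icc 1 2) := by
    apply ContinuousOn.div _ hc1
    · rintro _ ⟨x, hx, rfl⟩
      exact zeta1_ne (by simpa using hx.1)
    · exact differentiable_riemannZeta₁.contDiff.continuous_deriv (n := 1) le_rfl |>.continuousOn
  obtain ⟨C1, hC1⟩ := hK.exists_bound_of_continuousOn hc1
  obtain ⟨C2, hC2⟩ := hK.exists_bound_of_continuousOn hd1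
  have key : ∀ x : ℝ, 1 < x → x ≤ 2 → ‖riemannZeta x‖ ≤ C1 / (x - 1) ∧
      ‖deriv riemannZeta x / riemannZeta x + ((1 / (x - 1) : ℝ) : ℂ)‖ ≤ C2 := by
    intro x hx hx2
    have hmem : (x : ℂ) ∈ ((fun x : ℝ => (x : ℂ)) '' Set.Icc 1 2) := ⟨x, ⟨hx.le, hx2⟩, rfl⟩
    have hx1 : (x : ℂ) ≠ 1 := by exact_mod_cast hx.ne'
    constructor
    · rw [zeta_eq1 hx1, norm_mul, norm_inv, mul_comm, ← div_eq_mul_inv]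
      have : ‖(x : ℂ) - 1‖ = x - 1 := by
        rw [← Complex.ofReal_one, ← Complex.ofReal_sub, Complex.norm_real, Real.norm_eq_abs, abs_of_pos (by linarith)]
      rw [this]
      exact div_le_div_of_nonneg_right (hC1 _ hmem) (by linarith)
    · rw [logder_zeta hx1 (zeta1_ne (by simpa using hx.le))]
      have := hC2 _ hmem
      have e : -((x:ℂ) - 1)⁻¹ + deriv riemannZeta₁ x / riemannZeta₁ x + ((1 / (x - 1) : ℝ) : ℂ)
          = deriv riemannZeta₁ x / riemannZeta₁ x := by push_cast; ring
      rw [e]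
      exact this
  refine ⟨max 1 (max C1 (1 + C2)), le_max_left _ _, ?_⟩
  intro s hs hs2
  have hC : C1 ≤ max 1 (max C1 (1 + C2)) := (le_max_left _ _).trans (le_max_right _ _)
  have hC' : 1 + C2 ≤ max 1 (max C1 (1 + C2)) := (le_max_right _ _).trans (le_max_right _ _)
  have hC1' : 1 ≤ max 1 (max C1 (1 + C2)) := le_max_left _ _
  set C := max 1 (max C1 (1 + C2))
  have hp : 0 < s.re - 1 := by linarith
  obtain ⟨k1, k2⟩ := key s.re hs hs2
  have hre : 1 < ((s.re : ℝ) : ℂ).re := by simpa using hs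
  have hz : ‖riemannZeta s.re‖ ≤ C / (s.re - 1) := k1.trans (by gcongr)
  have hone : (1 : ℕ → ℂ) = fun n => (((fun _ => 1 : ℕ → ℝ) n : ℝ) : ℂ) := by ext; simp
  have hA : ‖riemannZeta s‖ ≤ ‖riemannZeta s.re‖ := by
    rw [← LSeries_one_eq_riemannZeta hs, ← LSeries_one_eq_riemannZeta hre]
    have := norm_LS_le (f := 1) (b := fun _ => 1) (s := s) (by simp) (by rw [← hone]; exact LSeriesSummable_one_iff.mpr hs)
    rw [← hone] at this
    exact this
  have hsC2 := (norm_nonneg _).trans k2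
  refine ⟨hA.trans hz, ?_, ?_, ?_⟩
  · have h1 := LSeries_one_mul_Lseries_moebius hs
    rw [LSeries_one_eq_riemannZeta hs] at h1
    have h2 := norm_LS_le (f := fun n => ((ArithmeticFunction.moebius n : ℤ) : ℂ)) (b := fun _ => 1) (s := s)
      (fun n => by
        rw [Complex.norm_intCast]
        exact_mod_cast ArithmeticFunction.abs_moebius_le_one) (by rw [← hone]; exact LSeriesSummable_one_iff.mpr hs)
    rw [← hone, LSeries_one_eq_riemannZeta hre] at h2
    have h3 := congrArg norm h1
    rw [norm_mul, norm_one] at h3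
    have h4 := h2.trans hz
    rw [div_le_iff₀ (by linarith)]
    rw [le_div_iff₀ hp] at h4
    have h5 := norm_nonneg (riemannZeta s)
    nlinarith
  · have h1 := (Complex.abs_re_le_norm _).trans k2
    rw [Complex.add_re, Complex.ofReal_re] at h1
    have := (abs_le.mp h1).1
    linarith
  · have h0 := ArithmeticFunction.LSeries_vonMangoldt_eq_deriv_riemannZeta_div hs
    have h0' := ArithmeticFunction.LSeries_vonMangoldt_eq_deriv_riemannZeta_div hre
    have h2 := norm_LS_le (f := fun n => ((ArithmeticFunction.vonMangoldt n : ℝ) : ℂ)) (b := fun n => ArithmeticFunction.vonMangoldt n) (s := s)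
      (fun n => by simp [abs_of_nonneg ArithmeticFunction.vonMangoldt_nonneg])
      (ArithmeticFunction.LSeriesSummable_vonMangoldt hs)
    rw [h0, h0', neg_div, neg_div, norm_neg, norm_neg] at h2
    refine h2.trans ?_
    have h3 := norm_sub_le (deriv riemannZeta s.re / riemannZeta s.re + ((1 / (s.re - 1) : ℝ) : ℂ)) ((1 / (s.re - 1) : ℝ) : ℂ)
    rw [add_sub_cancel_right, Complex.norm_real, Real.norm_eq_abs, abs_of_pos (by positivity)] at h3
    refine h3.trans ?_
    have h4 : C2 ≤ C2 / (s.re - 1) := by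
      rw [le_div_iff₀ hp]
      nlinarith
    have h5 : (1 + C2) / (s.re - 1) ≤ C / (s.re - 1) := by gcongr
    rw [add_div] at h5
    linarith

lemma cos341 (σ t : ℝ) (hσ : 1 < σ) :
    0 ≤ 3 * (-(deriv riemannZeta σ / riemannZeta σ).re)
      + 4 * (-(deriv riemannZeta (σ + t * Complex.I) / riemannZeta (σ + t * Complex.I)).re)
      + (-(deriv riemannZeta (σ + (2 * t : ℝ) * Complex.I) / riemannZeta (σ + (2 * t : ℝ) * Complex.I)).re) := by
  have hs : ∀ u : ℝ, 1 < ((σ : ℂ) + u * Complex.I).re := by intro u; simpa using hσ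
  have hsum : ∀ u : ℝ, HasSum (fun n => (LSeries.term (fun n => ((ArithmeticFunction.vonMangoldt n : ℝ) : ℂ)) ((σ : ℂ) + u * Complex.I) n).re)
      (-(deriv riemannZeta ((σ : ℂ) + u * Complex.I) / riemannZeta ((σ : ℂ) + u * Complex.I)).re) := by
    intro u
    have h1 := (ArithmeticFunction.LSeriesSummable_vonMangoldt (hs u)).hasSum
    have h2 := ArithmeticFunction.LSeries_vonMangoldt_eq_deriv_riemannZeta_div (hs u)
    rw [LSeries] at h2
    rw [h2, neg_div] at h1
    have := Complex.hasSum_re h1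
    simpa using this
  have h0 := hsum 0
  have h1 := hsum t
  have h2 := hsum (2 * t)
  rw [Complex.ofReal_zero, zero_mul, add_zero] at h0
  have h3 := ((h0.mul_left 3).add (h1.mul_left 4)).add h2
  refine h3.nonneg fun n => ?_
  rcases Nat.eq_zero_or_pos n with rfl | hn
  · simp
  have hterm : ∀ u : ℝ, (LSeries.term (fun n => ((ArithmeticFunction.vonMangoldt n : ℝ) : ℂ)) ((σ : ℂ) + u * Complex.I) n).re
      = ArithmeticFunction.vonMangoldt n * (n : ℝ) ^ (-σ) * Real.cos (u * log n) := by
    intro u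
    rw [LSeries.term_of_ne_zero hn.ne', div_eq_mul_inv, ← Complex.cpow_neg, Complex.re_ofReal_mul, mul_assoc]
    congr 1
    have hn0 : (n : ℂ) ≠ 0 := by exact_mod_cast hn.ne'
    rw [Complex.cpow_def_of_ne_zero hn0, Complex.exp_re, Complex.natCast_log.symm]
    have hre : ∀ l : ℝ, ((l : ℂ) * -((σ : ℂ) + u * Complex.I)).re = l * -σ := by intro l; simp
    have him : ∀ l : ℝ, ((l : ℂ) * -((σ : ℂ) + u * Complex.I)).im = -(u * l) := by intro l; simp; ring
    rw [hre, him, Real.cos_neg, Real.rpow_def_of_pos (by exact_mod_cast hn)]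
  have e0 := hterm 0
  rw [Complex.ofReal_zero, zero_mul, add_zero, zero_mul, Real.cos_zero] at e0
  rw [e0, hterm t, hterm (2 * t), mul_assoc 2 t, Real.cos_two_mul]
  have hp : 0 ≤ ArithmeticFunction.vonMangoldt n * (n : ℝ) ^ (-σ) :=
    mul_nonneg ArithmeticFunction.vonMangoldt_nonneg (by positivity)
  have : 3 * (ArithmeticFunction.vonMangoldt n * (n : ℝ) ^ (-σ) * 1) + 4 * (ArithmeticFunction.vonMangoldt n * (n : ℝ) ^ (-σ) * Real.cos (t * log n)) + ArithmeticFunction.vonMangoldt n * (n : ℝ) ^ (-σ) * (2 * Real.cos (t * log n) ^ 2 - 1)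
     = ArithmeticFunction.vonMangoldt n * (n : ℝ) ^ (-σ) * (2 * (1 + Real.cos (t * log n)) ^ 2) := by ring
  rw [this]
  positivity


noncomputable def zf (t : ℝ) : ℝ := th t / log (log t)

lemma ll_tendsto : Tendsto (fun t : ℝ => log (log t) / log t) atTop (nhds 0) := by
  have h2 : Tendsto (fun x : ℝ => log x / x) atTop (nhds 0) :=
    Real.isLittleO_log_id_atTop.tendsto_div_nhds_zero
  exact h2.comp tendsto_log_atTop

lemma th_tendsto : Tendsto th atTop (nhds 0) := by
  have h3 := ll_tendsto.rpow_const (p := (2 / 3 : ℝ)) (Or.inr (by norm_num))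
  rw [zero_rpow (by norm_num)] at h3
  exact h3

lemma zf_ev {a : ℝ} (C : ℝ) (ha : 0 < a) (hC : 0 < C) : ∀ᶠ t : ℝ in atTop,
    1 ≤ log (log t) ∧ 1 ≤ log t ∧ 0 < th t ∧ 0 < zf t ∧ C ≤ a * zf t * log t ∧ th t ≤ 1 / 4 ∧
    8 * a ≤ log (log t) ∧ C * (a * zf t) ≤ 1 ∧ C ≤ log (log t) ∧ zf t ≤ th t := by
  have hll : Tendsto (fun t : ℝ => log (log t)) atTop atTop := tendsto_log_atTop.comp tendsto_log_atTop
  filter_upwards [hll.eventually_ge_atTop 1, tendsto_log_atTop.eventually_ge_atTop 1,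
    th_tendsto.eventually_le_const (by norm_num : (0:ℝ) < 1 / 4), hll.eventually_ge_atTop (8 * a),
    th_tendsto.eventually_le_const (by positivity : (0:ℝ) < 1 / (C * a)), hll.eventually_ge_atTop C,
    ll_tendsto.eventually_le_const (by positivity : (0:ℝ) < (C / a) ^ (-3 : ℝ))] with t h1 h2 h3 h4 h5 h6 h7
  have hth : 0 < th t := by unfold th; positivity
  have hzf : 0 < zf t := by unfold zf; positivity
  have hzt : zf t ≤ th t := div_le_self hth.le h1
  refine ⟨h1, h2, hth, hzf, ?_, h3, h4, ?_, h6, hzt⟩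
  · have e : zf t * log t = (log (log t) / log t) ^ (-(1/3) : ℝ) := by
      have hx : 0 < log (log t) / log t := by positivity
      rw [show (-(1/3) : ℝ) = 2 / 3 - 1 by norm_num, rpow_sub hx, rpow_one]
      unfold zf th
      field_simp
    have e2 : C / a ≤ (log (log t) / log t) ^ (-(1/3) : ℝ) := by
      have h8 := rpow_le_rpow_of_nonpos (z := (-(1/3) : ℝ)) (by positivity) h7 (by norm_num)
      rw [← rpow_mul (by positivity)] at h8
      norm_num at h8
      norm_num
      exact h8
    rw [div_le_iff₀ ha] at e2
    rw [mul_assoc, e]; linarith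
  · rw [le_div_iff₀ (by positivity)] at h5
    calc C * (a * zf t) ≤ C * (a * th t) := by gcongr
      _ = th t * (C * a) := by ring
      _ ≤ 1 := h5

lemma local_bd : ∃ K T : ℝ, 0 < K ∧ 10 ≤ T ∧ ∀ a : ℝ, 0 < a → ∀ᶠ t : ℝ in atTop, ∀ γ : ℝ, T ≤ |γ| → |γ| + 1 ≤ t →
    -(deriv riemannZeta ((1 + a * zf t : ℝ) + γ * Complex.I) / riemannZeta ((1 + a * zf t : ℝ) + γ * Complex.I)).re ≤ K / zf t ∧
    ∀ δ : ℝ, 0 ≤ δ → a * zf t + δ ≤ th t / 4 → riemannZeta ((1 - δ : ℝ) + γ * Complex.I) = 0 →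
    -(deriv riemannZeta ((1 + a * zf t : ℝ) + γ * Complex.I) / riemannZeta ((1 + a * zf t : ℝ) + γ * Complex.I)).re
      ≤ K / zf t - (15 / 16) / (a * zf t + δ) := by
  obtain ⟨A, T, hA, hT, hz⟩ := zeta_bd
  obtain ⟨C, hC, hzr⟩ := zeta_real
  refine ⟨16 * (A + 1), T + 1, by positivity, by linarith, ?_⟩
  intro a ha
  filter_upwards [zf_ev (C * exp 1) ha (by positivity), eventually_ge_atTop T] with t ⟨h1, h2, hth, hzf, h3, h4, h5, h6, h7, h8⟩ htT
  intro γ hγ hγt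
  set η := a * zf t with hη
  set s0 : ℂ := ((1 + η : ℝ) : ℂ) + γ * Complex.I with hs0
  have hη0 : 0 < η := by positivity
  have hs0re : s0.re = 1 + η := by simp [hs0]
  have hs0im : s0.im = γ := by simp [hs0]
  have hη8 : η ≤ th t / 8 := by
    rw [hη, zf, mul_div_assoc', div_le_div_iff₀ (by linarith) (by norm_num)]
    nlinarith
  set f : ℂ → ℂ := fun z => riemannZeta (s0 + z) with hf
  have hU : IsOpen {z : ℂ | s0 + z ≠ 1} := isOpen_ne_fun (by fun_prop) (by fun_prop)
  have him : ∀ z : ℂ, ‖z‖ ≤ th t → T ≤ |(s0 + z).im| ∧ |(s0 + z).im| ≤ t := by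
    intro z hz
    have h9 := (Complex.abs_im_le_norm z).trans hz
    rw [Complex.add_im, hs0im]
    have h10 := abs_add_le γ z.im
    have h11 := abs_sub_abs_le_abs_sub γ (-z.im)
    rw [sub_neg_eq_add, abs_neg] at h11
    constructor <;> linarith
  have hUR : Metric.closedBall (0:ℂ) (th t) ⊆ {z : ℂ | s0 + z ≠ 1} := by
    intro z hz h
    have := (him z (by simpa using hz)).1
    rw [h] at this
    simp at this
    linarith
  have hfd : DifferentiableOn ℂ f {z : ℂ | s0 + z ≠ 1} := by
    intro z hz
    have h12 : DifferentiableAt ℂ riemannZeta (s0 + z) := differentiableAt_riemannZeta hz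
    exact (h12.comp z (by fun_prop : DifferentiableAt ℂ (fun z => s0 + z) z)).differentiableWithinAt
  have hB : ∀ z ∈ Metric.sphere (0:ℂ) (th t), ‖f z‖ ≤ (log t) ^ A := by
    intro z hz'
    have hz'' : ‖z‖ = th t := by simpa using hz'
    have h9 := (abs_le.mp ((Complex.abs_re_le_norm z).trans hz''.le))
    obtain ⟨i1, i2⟩ := him z hz''.le
    refine hz t htT _ i1 i2 ?_ ?_ <;> rw [Complex.add_re, hs0re] <;> linarith [h9.1, h9.2]
  have hzr0 := hzr s0 (by rw [hs0re]; linarith) (by rw [hs0re]; linarith)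
  rw [hs0re, add_sub_cancel_left] at hzr0
  have hf0n : η / C ≤ ‖f 0‖ := by simpa [hf] using hzr0.2.1
  have hf0p : 0 < ‖f 0‖ := lt_of_lt_of_le (by positivity) hf0n
  have hre : ∀ z : ℂ, ‖z‖ < th t / 2 → f z = 0 → z.re ≤ 0 := by
    intro z _ hzz
    by_contra hcon
    push Not at hcon
    exact riemannZeta_ne_zero_of_one_le_re (by rw [Complex.add_re, hs0re]; linarith) hzz
  obtain ⟨l1, l2⟩ := landau2 hth hU hUR hfd hB (norm_pos_iff.mp hf0p) hre
  have hlog : 16 * (log ((log t) ^ A / ‖f 0‖) + 1) / th t ≤ 16 * (A + 1) / zf t := by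
    have hL : 0 < log t := by linarith
    have e1 : log ((log t) ^ A / ‖f 0‖) ≤ (A + 1) * log (log t) - 1 := by
      rw [← Real.log_exp (_ - 1)]
      apply Real.log_le_log (by positivity)
      rw [Real.exp_sub, mul_comm (A + 1), ← rpow_def_of_pos hL, rpow_add hL, rpow_one, div_le_div_iff₀ hf0p (by positivity), mul_assoc]
      gcongr
      calc exp 1 ≤ (η * log t) / C := by
            rw [le_div_iff₀ (by linarith)]; linarith
        _ = log t * (η / C) := by ring
        _ ≤ log t * ‖f 0‖ := by gcongr
    have e2 : 16 * (A + 1) / zf t = 16 * ((A + 1) * log (log t)) / th t := by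
      unfold zf; field_simp
    rw [e2]; gcongr; linarith
  have hderiv : deriv f 0 / f 0 = deriv riemannZeta s0 / riemannZeta s0 := by
    have := deriv_comp_const_add riemannZeta s0 0
    simp only [add_zero] at this
    simp only [hf, add_zero, this]
  rw [hderiv] at l1 l2
  refine ⟨l1.trans hlog, ?_⟩
  intro δ hδ hδ2 hz0
  have := l2 (η + δ) (by linarith) hδ2 (by
    rw [hf, ← hz0]; simp only; congr 1; rw [hs0]; push_cast; ring)
  linarith

lemma zero_free : ∃ a T : ℝ, 0 < a ∧ 10 ≤ T ∧ ∀ᶠ t : ℝ in atTop, ∀ ρ : ℂ, T ≤ |ρ.im| → 3 * |ρ.im| ≤ t →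
    riemannZeta ρ = 0 → ρ.re ≤ 1 - a * zf t := by
  obtain ⟨K, T, hK, hT, hl⟩ := local_bd
  obtain ⟨C, hC, hzr⟩ := zeta_real
  set a := 1 / (40 * K) with ha
  have ha0 : 0 < a := by positivity
  refine ⟨a / 7, T, by positivity, hT, ?_⟩
  filter_upwards [hl a ha0, zf_ev (24 * C) ha0 (by positivity)] with t hl' ⟨h1, h2, hth, hzf, h3, h4, h5, h6, h7, h8⟩
  intro ρ hρT hρt hρ0
  by_contra hcon
  push Not at hcon
  set δ := 1 - ρ.re with hδ
  have hδ0 : 0 ≤ δ := by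
    by_contra h
    exact riemannZeta_ne_zero_of_one_le_re (by linarith) hρ0
  set η := a * zf t with hη
  have hη0 : 0 < η := by positivity
  have hη8 : η ≤ th t / 8 := by
    rw [hη, zf, mul_div_assoc', div_le_div_iff₀ (by linarith) (by norm_num)]
    nlinarith
  have hδη : δ ≤ η / 7 := by
    have : a / 7 * zf t = η / 7 := by rw [hη]; ring
    linarith
  have hρe : ((1 - δ : ℝ) : ℂ) + ρ.im * Complex.I = ρ := by
    rw [hδ, sub_sub_cancel]; exact Complex.re_add_im ρ
  have b1 := (hl' ρ.im hρT (by linarith)).2 δ hδ0 (by linarith) (by rw [hρe]; exact hρ0)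
  have b2 := (hl' (2 * ρ.im) (by rw [abs_mul, abs_two]; linarith [abs_nonneg ρ.im]) (by
    rw [abs_mul, abs_two]; linarith)).1
  have b0 := (hzr ((1 + η : ℝ) : ℂ) (by rw [Complex.ofReal_re]; linarith) (by rw [Complex.ofReal_re]; linarith)).2.2.1
  rw [Complex.ofReal_re, add_sub_cancel_left] at b0
  have c := cos341 (1 + η) ρ.im (by linarith)
  have hKz : K / zf t = 1 / 40 / η := by
    rw [hη, ha]; field_simp
  rw [hKz] at b1 b2
  have hd : 15 / 16 / (8 / 7 * η) ≤ 15 / 16 / (η + δ) := by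
    gcongr
    linarith
  have hd2 : 15 / 16 / (8 / 7 * η) = (105 / 128) / η := by field_simp; norm_num
  have hC' : C ≤ 1 / 24 / η := by
    rw [le_div_iff₀ hη0]; linarith
  have e1 : (1 : ℝ) / 24 / η = (1 / 24) * (1 / η) := by ring
  have e2 : (1 : ℝ) / 40 / η = (1 / 40) * (1 / η) := by ring
  have e3 : (105 : ℝ) / 128 / η = (105 / 128) * (1 / η) := by ring
  have hp : 0 < 1 / η := by positivity
  rw [hd2] at hd
  linarith


noncomputable def GG (s : ℂ) : ℂ := -(deriv riemannZeta₁ s / riemannZeta₁ s) - riemannZeta₀ s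

lemma GG_eq {s : ℂ} (hs : s ≠ 1) (h1 : riemannZeta₁ s ≠ 0) :
    GG s = -(deriv riemannZeta s / riemannZeta s) - riemannZeta s := by
  rw [logder_zeta hs h1, GG, riemannZeta_eq_inv_sub_add hs]
  ring

lemma GG_diff {s : ℂ} (h1 : riemannZeta₁ s ≠ 0) : DifferentiableAt ℂ GG s := by
  have h : Differentiable ℂ (deriv riemannZeta₁) := differentiable_riemannZeta₁.deriv
  exact (((h s).div (differentiable_riemannZeta₁ s) h1).neg).sub (differentiable_riemannZeta₀ s)

lemma GG_small (T : ℝ) : ∃ ε C : ℝ, 0 < ε ∧ ∀ s : ℂ, |s.im| ≤ T → 1 - ε ≤ s.re → s.re ≤ 2 →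
    riemannZeta₁ s ≠ 0 ∧ ‖GG s‖ ≤ C := by
  set K : Set ℂ := Set.Icc 1 2 ×ℂ Set.Icc (-T) T with hK
  have hKc : IsCompact K := isCompact_Icc.reProdIm isCompact_Icc
  have hV : IsOpen {s : ℂ | riemannZeta₁ s ≠ 0} :=
    isOpen_ne_fun differentiable_riemannZeta₁.continuous continuous_const
  have hKV : K ⊆ {s : ℂ | riemannZeta₁ s ≠ 0} := fun s hs => zeta1_ne hs.1.1
  obtain ⟨ε, hε, hsub⟩ := hKc.exists_cthickening_subset_open hV hKV
  have hcc : IsCompact (Metric.cthickening ε K) := hKc.cthickening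
  have hcont : ContinuousOn GG (Metric.cthickening ε K) := fun s hs =>
    (GG_diff (hsub hs)).continuousAt.continuousWithinAt
  obtain ⟨C, hC⟩ := hcc.exists_bound_of_continuousOn hcont
  refine ⟨ε, C, hε, fun s h1 h2 h3 => ?_⟩
  have hm : s ∈ Metric.cthickening ε K := by
    refine Metric.mem_cthickening_of_dist_le s (⟨max 1 s.re, s.im⟩ : ℂ) ε K ?_ ?_
    · rw [hK, Complex.mem_reProdIm]
      exact ⟨⟨le_max_left _ _, max_le (by norm_num) h3⟩, abs_le.mp h1⟩
    · rw [Complex.dist_of_im_eq (by simp), Real.dist_eq]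
      simp only
      rw [abs_sub_comm, abs_of_nonneg (by linarith [le_max_right 1 s.re])]
      rcases max_cases 1 s.re with ⟨h, _⟩ | ⟨h, _⟩ <;> rw [h] <;> linarith
  exact ⟨hsub hm, hC s hm⟩

set_option maxHeartbeats 800000 in
lemma zld_bd : ∃ a A T : ℝ, 0 < a ∧ 1 ≤ A ∧ 10 ≤ T ∧ ∀ᶠ t : ℝ in atTop, ∀ s : ℂ, T ≤ |s.im| → |s.im| ≤ t / 4 →
    1 - a * zf t ≤ s.re → s.re ≤ 2 → riemannZeta s ≠ 0 ∧ ‖deriv riemannZeta s / riemannZeta s‖ ≤ (log t) ^ 3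
      ∧ ‖riemannZeta s‖ ≤ (log t) ^ A := by
  obtain ⟨a, T0, ha, hT0, hzf⟩ := zero_free
  obtain ⟨A, T1, hA, hT1, hz⟩ := zeta_bd
  obtain ⟨C, hC, hzr⟩ := zeta_real
  refine ⟨a / 2, A, T0 + T1, by positivity, hA, by linarith, ?_⟩
  filter_upwards [hzf, eventually_ge_atTop T1, eventually_ge_atTop 100, zf_ev (C * exp 1) ha (by positivity),
    zf_ev 1 ha (by positivity), tendsto_log_atTop.eventually_ge_atTop (64 * (A + 1) + C)] with t hzf htT ht100
      ⟨h1, h2, hth, hzf0, h3, h4, h5, h6, h7, h8⟩ h9 hbig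
  intro s hsT hst hsre hsre2
  have h1η : 1 ≤ a * zf t * log t := h9.2.2.2.2.1
  set η := a * zf t with hη
  have hη0 : 0 < η := by positivity
  have hη8 : η ≤ th t / 8 := by
    rw [hη, zf, mul_div_assoc', div_le_div_iff₀ (by linarith) (by norm_num)]
    nlinarith
  have hsη : 1 - η / 2 ≤ s.re := by
    have : a / 2 * zf t = η / 2 := by rw [hη]; ring
    linarith
  have hL : 0 < log t := by linarith
  have hinv : 1 / η ≤ log t := by rw [div_le_iff₀ hη0]; linarith
  have hsb := hz t htT s (by linarith) (by linarith) (by linarith) hsre2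
  have hnz : riemannZeta s ≠ 0 := by
    intro h
    have := hzf s (by linarith) (by linarith) h
    linarith
  refine ⟨hnz, ?_, hsb⟩
  rcases le_or_gt (1 + η) s.re with hcase | hcase
  · have h10 := (hzr s (by linarith) hsre2).2.2.2
    calc _ ≤ C / (s.re - 1) := h10
      _ ≤ C / η := by gcongr; linarith
      _ = C * (1 / η) := by ring
      _ ≤ log t * log t := by
        gcongr
        linarith
      _ ≤ (log t) ^ 3 := by nlinarith [mul_pos hL hL]
  · set s0 : ℂ := ((1 + η : ℝ) : ℂ) + s.im * Complex.I with hs0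
    have hs0re : s0.re = 1 + η := by simp [hs0]
    have hs0im : s0.im = s.im := by simp [hs0]
    set f : ℂ → ℂ := fun z => riemannZeta (s0 + z) with hf
    have hball : ∀ z ∈ Metric.ball (0:ℂ) (2 * η), T1 ≤ |(s0 + z).im| ∧ T0 ≤ |(s0 + z).im| ∧ |(s0 + z).im| ≤ t ∧
        3 * |(s0 + z).im| ≤ t ∧ 1 - η < (s0 + z).re ∧ (s0 + z).re ≤ 2 := by
      intro z hz
      rw [mem_ball_zero_iff] at hz
      have i1 := (Complex.abs_im_le_norm z).trans hz.le
      have i2 := abs_lt.mp ((Complex.abs_re_le_norm z).trans_lt hz)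
      have h10 := abs_add_le s.im z.im
      have h11 := abs_sub_abs_le_abs_sub s.im (-z.im)
      rw [sub_neg_eq_add, abs_neg] at h11
      rw [Complex.add_im, Complex.add_re, hs0im, hs0re]
      refine ⟨?_, ?_, ?_, ?_, ?_, ?_⟩ <;> linarith [i2.1, i2.2]
    have hzr0 := hzr s0 (by rw [hs0re]; linarith) (by rw [hs0re]; linarith)
    rw [hs0re, add_sub_cancel_left] at hzr0
    have hf0n : η / C ≤ ‖f 0‖ := by simpa [hf] using hzr0.2.1
    set z : ℂ := s - s0 with hzdef
    have hzn : ‖z‖ ≤ 3 / 2 * η := by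
      have : z = ((s.re - (1 + η) : ℝ) : ℂ) := by
        apply Complex.ext <;> simp [hzdef, hs0re, hs0im]
      rw [this, Complex.norm_real, Real.norm_eq_abs, abs_le]
      constructor <;> linarith
    have hM : 0 < (A + 1) * log (log t) := by positivity
    have key := logder_bd (f := f) (r := 2 * η) (z := z) hM ?_ ?_ ?_ (by linarith)
    · have e1 : deriv f z / f z = deriv riemannZeta s / riemannZeta s := by
        have := deriv_comp_const_add riemannZeta s0 z
        simp only [hf, this]
        rw [hzdef, add_sub_cancel]
      rw [e1] at key
      have hll : log (log t) ≤ log t := (Real.log_le_sub_one_of_pos hL).trans (by linarith)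
      calc _ ≤ 8 * (2 * η) * ((A + 1) * log (log t)) / (2 * η - ‖z‖) ^ 2 := key
        _ ≤ 8 * (2 * η) * ((A + 1) * log t) / (η / 2) ^ 2 := by
          gcongr
          linarith
        _ = (64 * (A + 1)) * log t * (1 / η) := by field_simp; ring
        _ ≤ log t * log t * log t := by gcongr; linarith
        _ = _ := by ring
    · intro w hw
      have hne : s0 + w ≠ 1 := by
        intro h
        have := (hball w hw).1
        rw [h] at this
        simp at this
        linarith
      have h12 : DifferentiableAt ℂ riemannZeta (s0 + w) := differentiableAt_riemannZeta hne
      exact (h12.comp w (by fun_prop : DifferentiableAt ℂ (fun z => s0 + z) w)).differentiableWithinAt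
    · intro w hw h
      obtain ⟨_, i2, _, i4, i5, _⟩ := hball w hw
      have := hzf (s0 + w) i2 i4 h
      linarith
    · intro w hw
      obtain ⟨i1, i2, i3, i4, i5, i6⟩ := hball w hw
      refine (hz t htT (s0 + w) i1 i3 (by linarith) i6).trans ?_
      rw [mul_comm (A + 1), ← rpow_def_of_pos hL, rpow_add hL, rpow_one]
      have : 1 ≤ log t * ‖f 0‖ := by
        calc 1 ≤ (η * log t) / C := by
              rw [le_div_iff₀ (by linarith)]
              have := Real.one_le_exp (x := 1) (by norm_num)
              have := mul_le_mul_of_nonneg_left this (by linarith : 0 ≤ C)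
              linarith
          _ = log t * (η / C) := by ring
          _ ≤ log t * ‖f 0‖ := by gcongr
      have hp : 0 ≤ (log t) ^ A := by positivity
      calc (log t) ^ A = (log t) ^ A * 1 := (mul_one _).symm
        _ ≤ (log t) ^ A * (log t * ‖f 0‖) := mul_le_mul_of_nonneg_left this hp
        _ = _ := by ring

lemma GG_bd : ∃ c A : ℝ, 0 < c ∧ 1 ≤ A ∧ ∀ᶠ t : ℝ in atTop, ∀ s : ℂ, |s.im| ≤ t / 4 →
    1 - c * zf t ≤ s.re → s.re ≤ 2 → riemannZeta₁ s ≠ 0 ∧ ‖GG s‖ ≤ (log t) ^ A := by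
  obtain ⟨a, A, T, ha, hA, hT, h⟩ := zld_bd
  obtain ⟨ε, C, hε, hs⟩ := GG_small T
  refine ⟨a, A + 4, ha, by linarith, ?_⟩
  filter_upwards [h, zf_ev (1 / ε) ha (by positivity), tendsto_log_atTop.eventually_ge_atTop (C + 2)] with t h
    ⟨h1, h2, hth, hzf0, h3, h4, h5, h6, h7, h8⟩ hbig
  intro s h1 h2 h3'
  have hL : 0 < log t := by linarith
  rcases le_or_gt |s.im| T with hc | hc
  · have h7 : a * zf t ≤ ε := by
      rw [one_div, inv_mul_le_iff₀ hε] at h6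
      linarith
    obtain ⟨i1, i2⟩ := hs s hc (by linarith) h3'
    refine ⟨i1, i2.trans ?_⟩
    calc C ≤ log t := by linarith
      _ = (log t) ^ (1:ℝ) := (rpow_one _).symm
      _ ≤ _ := rpow_le_rpow_of_exponent_le (by linarith) (by linarith)
  · obtain ⟨i1, i2, i3⟩ := h s hc.le h1 h2 h3'
    have hs1 : s ≠ 1 := by rintro rfl; simp at hc; linarith
    have hz1 : riemannZeta₁ s ≠ 0 := by
      intro h0; rw [zeta_eq1 hs1, h0, mul_zero] at i1; exact i1 rfl
    refine ⟨hz1, ?_⟩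
    rw [GG_eq hs1 hz1]
    refine (norm_sub_le _ _).trans ?_
    rw [norm_neg]
    have hlog2 : 2 ≤ log t := by
      have h10 : 0 ≤ C := (norm_nonneg _).trans (hs 1 (by simp; linarith) (by simp; linarith) (by simp)).2
      linarith
    have e1 : (log t) ^ 3 ≤ (log t) ^ (A + 3) := by
      rw [← rpow_natCast]
      exact rpow_le_rpow_of_exponent_le (by linarith) (by push_cast; linarith)
    have e2 : (log t) ^ A ≤ (log t) ^ (A + 3) := rpow_le_rpow_of_exponent_le (by linarith) (by linarith)
    have e3 : (log t) ^ (A + 4) = (log t) ^ (A + 3) * log t := by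
      rw [show A + 4 = (A + 3) + 1 by ring, rpow_add hL, rpow_one]
    have hp : 0 < (log t) ^ (A + 3) := by positivity
    rw [e3]
    nlinarith


noncomputable def ker (s : ℂ) : ℂ := 1 / s - 1 / (s + 1)

lemma ker_bd {s : ℂ} (hs : 1 / 2 ≤ s.re) : ‖ker s‖ ≤ 2 * (1 + s.im ^ 2)⁻¹ := by
  have h0 : s ≠ 0 := by rintro rfl; norm_num at hs
  have h1 : s + 1 ≠ 0 := by
    intro h
    have := congrArg Complex.re h
    simp at this; linarith
  have e : ker s = 1 / (s * (s + 1)) := by unfold ker; field_simp; ring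
  have a1 : √(1 + s.im ^ 2) / 2 ≤ ‖s‖ := by
    rw [Complex.norm_eq_sqrt_sq_add_sq, div_le_iff₀ (by norm_num)]
    apply Real.sqrt_le_iff.mpr
    refine ⟨by positivity, ?_⟩
    rw [mul_pow, Real.sq_sqrt (by positivity)]
    nlinarith [sq_nonneg s.im]
  have a2 : √(1 + s.im ^ 2) ≤ ‖s + 1‖ := by
    rw [Complex.norm_eq_sqrt_sq_add_sq]
    apply Real.sqrt_le_sqrt
    simp only [Complex.add_re, Complex.one_re, Complex.add_im, Complex.one_im, add_zero]
    nlinarith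
  have h3 : 0 < √(1 + s.im ^ 2) := by positivity
  rw [e, norm_div, norm_mul, norm_one]
  calc 1 / (‖s‖ * ‖s + 1‖) ≤ 1 / (√(1 + s.im ^ 2) / 2 * √(1 + s.im ^ 2)) := by gcongr
    _ = 2 * (1 + s.im ^ 2)⁻¹ := by
      rw [div_mul_eq_mul_div, Real.mul_self_sqrt (by positivity)]; field_simp

lemma ker_diff {s : ℂ} (hs : 0 < s.re) : DifferentiableAt ℂ ker s := by
  have h0 : s ≠ 0 := by rintro rfl; norm_num at hs
  have h1 : s + 1 ≠ 0 := by
    intro h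
    have := congrArg Complex.re h
    simp at this; linarith
  unfold ker
  exact ((differentiableAt_const _).div differentiableAt_id h0).sub
    ((differentiableAt_const _).div (by fun_prop) h1)

lemma line_re (σ y : ℝ) : ((σ : ℂ) + y * Complex.I).re = σ := by simp
lemma line_im (σ y : ℝ) : ((σ : ℂ) + y * Complex.I).im = y := by simp

lemma ker_cont {σ : ℝ} (hσ : 1 / 2 ≤ σ) : Continuous (fun y : ℝ => ker (σ + y * Complex.I)) := by
  rw [continuous_iff_continuousAt]
  intro y
  have h := (ker_diff (s := σ + y * Complex.I) (by rw [line_re]; linarith)).continuousAt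
  exact ContinuousAt.comp (f := fun y : ℝ => (σ : ℂ) + y * Complex.I) h (by fun_prop)

lemma ker_int {σ : ℝ} (hσ : 1 / 2 ≤ σ) : Integrable (fun y : ℝ => ker (σ + y * Complex.I)) := by
  refine (integrable_inv_one_add_sq.const_mul 2).mono' (ker_cont hσ).aestronglyMeasurable ?_
  refine Eventually.of_forall fun y => ?_
  have := ker_bd (s := σ + y * Complex.I) (by rw [line_re]; exact hσ)
  rw [line_im] at this
  exact this

lemma perron_ker {σ x : ℝ} (hσ : 1 / 2 ≤ σ) (hx : 0 < x) :
    ∫ y : ℝ, (x : ℂ) ^ (-((σ : ℂ) + y * Complex.I)) * ker (σ + y * Complex.I) = ((2 * π * max (1 - x) 0 : ℝ) : ℂ) := by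
  set f : ℝ → ℂ := fun t => Set.indicator (Set.Ioc 0 1) (fun _ => 1 : ℝ → ℂ) t - Set.indicator (Set.Ioc 0 1) (fun t => (t:ℂ) ^ (1:ℂ) : ℝ → ℂ) t with hf
  have hm : ∀ s : ℂ, 0 < s.re → HasMellin f s (ker s) := by
    intro s hs
    have h1 := hasMellin_one_Ioc hs
    have h2 := hasMellin_cpow_Ioc 1 (s := s) (by simp; linarith)
    have h3 := hasMellin_sub h1.1 h2.1
    rw [h1.2, h2.2] at h3
    exact h3
  have hfe : ∀ t : ℝ, 0 < t → f t = ((max (1 - t) 0 : ℝ) : ℂ) := by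
    intro t ht
    rcases le_or_gt t 1 with h | h
    · have hmem : t ∈ Set.Ioc (0:ℝ) 1 := ⟨ht, h⟩
      simp only [hf, Set.indicator_of_mem hmem, Complex.cpow_one]
      rw [max_eq_left (by linarith)]; push_cast; rfl
    · have hmem : t ∉ Set.Ioc (0:ℝ) 1 := fun h' => by linarith [h'.2]
      simp only [hf, Set.indicator_of_notMem hmem]
      rw [max_eq_right (by linarith)]; simp
  have hmell : ∀ y : ℝ, mellin f ((σ : ℂ) + y * Complex.I) = ker (σ + y * Complex.I) := fun y =>
    (hm _ (by rw [line_re]; linarith)).2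
  have hinv := mellinInv_mellin_eq σ f hx (hm (σ : ℂ) (by simp; linarith)).1 (by
      unfold Complex.VerticalIntegrable
      simp only [hmell]
      exact ker_int hσ) (by
      have hc : ContinuousAt (fun t : ℝ => ((max (1 - t) 0 : ℝ) : ℂ)) x := by fun_prop
      refine hc.congr ?_
      filter_upwards [lt_mem_nhds hx] with t ht using (hfe t ht).symm)
  rw [mellinInv, hfe x hx] at hinv
  simp only [hmell, smul_eq_mul] at hinv
  have hpi : (2 * π : ℝ) ≠ 0 := by positivity
  rw [Complex.ofReal_mul, ← hinv, Complex.real_smul, ← mul_assoc, ← Complex.ofReal_mul, mul_one_div_cancel hpi]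
  simp

lemma GG_series {s : ℂ} (hs : 1 < s.re) :
    GG s = ∑' n, LSeries.term (fun n => ((ArithmeticFunction.vonMangoldt n - 1 : ℝ) : ℂ)) s n ∧
    LSeriesSummable (fun n => ((ArithmeticFunction.vonMangoldt n - 1 : ℝ) : ℂ)) s := by
  have hs1 : s ≠ 1 := by rintro rfl; simp at hs
  have e : (fun n => ((ArithmeticFunction.vonMangoldt n - 1 : ℝ) : ℂ)) =
      (fun n => ((ArithmeticFunction.vonMangoldt n : ℝ) : ℂ)) - (1 : ℕ → ℂ) := by ext n; simp
  have h1 := ArithmeticFunction.LSeriesSummable_vonMangoldt hs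
  have h2 : LSeriesSummable 1 s := LSeriesSummable_one_iff.mpr hs
  refine ⟨?_, by rw [e]; exact h1.sub h2⟩
  have h3 := LSeries_sub h1 h2
  rw [GG_eq hs1 (zeta1_ne hs.le), e]
  rw [ArithmeticFunction.LSeries_vonMangoldt_eq_deriv_riemannZeta_div hs, LSeries_one_eq_riemannZeta hs, neg_div] at h3
  rw [← h3]; rfl

lemma perron {σ X : ℝ} (hσ : 1 < σ) (hX : 0 < X) :
    ∫ y : ℝ, GG (σ + y * Complex.I) * (X : ℂ) ^ ((σ : ℂ) + y * Complex.I) * ker (σ + y * Complex.I)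
     = ((2 * π * ∑ n ∈ Ioc 0 ⌊X⌋₊, (ArithmeticFunction.vonMangoldt n - 1) * (1 - n / X) : ℝ) : ℂ) := by
  set a : ℕ → ℝ := fun n => ArithmeticFunction.vonMangoldt n - 1 with ha
  set F : ℕ → ℝ → ℂ := fun n y => LSeries.term (fun n => (a n : ℂ)) ((σ : ℂ) + y * Complex.I) n *
    (X : ℂ) ^ ((σ : ℂ) + y * Complex.I) * ker (σ + y * Complex.I) with hF
  have hXc : (X : ℂ) ≠ 0 := by exact_mod_cast hX.ne'
  have hFn : ∀ n : ℕ, 0 < n → ∀ y, F n y = (a n : ℂ) * (((n / X : ℝ) : ℂ) ^ (-((σ : ℂ) + y * Complex.I)) * ker (σ + y * Complex.I)) := by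
    intro n hn y
    have hnc : (n : ℂ) ≠ 0 := by exact_mod_cast hn.ne'
    simp only [hF]
    rw [LSeries.term_of_ne_zero hn.ne', Complex.cpow_neg, Complex.ofReal_div, Complex.div_cpow_ofReal_nonneg (by positivity) hX.le]
    rw [Complex.ofReal_natCast, inv_div]
    ring
  have hF0 : ∀ y, F 0 y = 0 := by intro y; simp [hF]
  have hnorm : ∀ n y, ‖F n y‖ = ‖LSeries.term (fun n => (a n : ℂ)) (σ : ℂ) n‖ * X ^ σ * ‖ker (σ + y * Complex.I)‖ := by
    intro n y
    simp only [hF, norm_mul]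
    rw [LSeries.norm_term_eq, LSeries.norm_term_eq, Complex.norm_cpow_eq_rpow_re_of_pos hX, line_re, Complex.ofReal_re]
  have hint : ∀ n, Integrable (F n) := by
    intro n
    have hms : AEStronglyMeasurable (F n) := by
      apply Continuous.aestronglyMeasurable
      rcases Nat.eq_zero_or_pos n with rfl | hn
      · have : F 0 = fun _ => 0 := funext hF0
        rw [this]; exact continuous_const
      · have : F n = _ := funext (hFn n hn)
        rw [this]
        refine continuous_const.mul (Continuous.mul ?_ (ker_cont (by linarith)))
        refine Continuous.const_cpow (by fun_prop) (Or.inl ?_)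
        exact_mod_cast (div_pos (by exact_mod_cast hn) hX).ne'
    refine ((ker_int (σ := σ) (by linarith)).norm.const_mul (‖LSeries.term (fun n => (a n : ℂ)) (σ : ℂ) n‖ * X ^ σ)).mono' hms ?_
    exact Eventually.of_forall fun y => (hnorm n y).le
  have hsum : Summable fun n => ∫ y, ‖F n y‖ := by
    simp_rw [hnorm]
    simp_rw [integral_const_mul]
    apply Summable.mul_right
    apply Summable.mul_right
    exact (GG_series (s := (σ : ℂ)) (by simpa using hσ)).2.norm
  have key := hasSum_integral_of_summable_integral_norm hint hsum
  have e1 : ∀ y : ℝ, ∑' n, F n y = GG (σ + y * Complex.I) * (X : ℂ) ^ ((σ : ℂ) + y * Complex.I) * ker (σ + y * Complex.I) := by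
    intro y
    simp only [hF]
    rw [tsum_mul_right, tsum_mul_right, ← (GG_series (s := (σ : ℂ) + y * Complex.I) (by rw [line_re]; exact hσ)).1]
  simp_rw [e1] at key
  rw [← key.tsum_eq]
  have e2 : ∀ n : ℕ, ∫ y, F n y = if n ∈ Ioc 0 ⌊X⌋₊ then ((2 * π * (a n * (1 - n / X)) : ℝ) : ℂ) else 0 := by
    intro n
    rcases Nat.eq_zero_or_pos n with rfl | hn
    · simp [hF0]
    · simp_rw [hFn n hn]
      rw [integral_const_mul, perron_ker (by linarith) (div_pos (by exact_mod_cast hn) hX)]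
      have hiff : n ∈ Ioc 0 ⌊X⌋₊ ↔ (n : ℝ) ≤ X := by
        rw [mem_Ioc, Nat.le_floor_iff hX.le]; simp [hn]
      split_ifs with h
      · rw [hiff] at h
        rw [max_eq_left (by rw [sub_nonneg, div_le_one hX]; exact h)]
        push_cast; ring
      · rw [hiff] at h
        push Not at h
        rw [max_eq_right (by rw [sub_nonpos, one_le_div hX]; exact h.le)]
        simp
  simp_rw [e2]
  rw [tsum_eq_sum (s := Ioc 0 ⌊X⌋₊) (fun n hn => if_neg hn), mul_sum, Complex.ofReal_sum]
  exact sum_congr rfl fun n hn => if_pos hn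


noncomputable def HX (X : ℝ) (s : ℂ) : ℂ := GG s * (X : ℂ) ^ s * ker s

lemma HX_bd {X M : ℝ} (hX : 0 < X) {s : ℂ} (hs : 1 / 2 ≤ s.re) (hM : ‖GG s‖ ≤ M) :
    ‖HX X s‖ ≤ M * X ^ s.re * (2 * (1 + s.im ^ 2)⁻¹) := by
  unfold HX
  rw [norm_mul, norm_mul, Complex.norm_cpow_eq_rpow_re_of_pos hX]
  have := ker_bd hs
  have h0 : 0 ≤ M := (norm_nonneg _).trans hM
  gcongr

lemma HX_diff {X : ℝ} (hX : 0 < X) {s : ℂ} (hs : 0 < s.re) (h : riemannZeta₁ s ≠ 0) :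
    DifferentiableAt ℂ (HX X) s := by
  unfold HX
  have hX' : (X : ℂ) ≠ 0 := by exact_mod_cast hX.ne'
  refine ((GG_diff h).mul ?_).mul (ker_diff hs)
  exact differentiableAt_id.const_cpow (Or.inl hX')

lemma HX_cont {X σ : ℝ} (hX : 0 < X) (hs : 1 ≤ σ) :
    Continuous (fun y : ℝ => HX X (σ + y * Complex.I)) := by
  rw [continuous_iff_continuousAt]
  intro y
  have h := (HX_diff hX (s := σ + y * Complex.I) (by rw [line_re]; linarith)
    (zeta1_ne (by rw [line_re]; exact hs))).continuousAt
  exact ContinuousAt.comp (f := fun y : ℝ => (σ : ℂ) + y * Complex.I) h (by fun_prop)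

lemma arctan_tail {T : ℝ} (hT : 0 < T) : π / 2 - arctan T ≤ 1 / T := by
  have := arctan_inv_of_pos hT
  rw [← this, one_div]
  have h : 0 ≤ arctan T⁻¹ := arctan_nonneg.mpr (by positivity)
  have := le_tan h (arctan_lt_pi_div_two _)
  rwa [tan_arctan] at this

lemma HX_tails {X M T σ : ℝ} (hX : 0 < X) (hT : 0 < T) (hσ : 1 ≤ σ)
    (hM : ∀ y : ℝ, ‖GG (σ + y * Complex.I)‖ ≤ M) :
    ‖(∫ y : ℝ, HX X (σ + y * Complex.I)) - ∫ y in (-T)..T, HX X (σ + y * Complex.I)‖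
      ≤ 4 * M * X ^ σ / T := by
  have hb : ∀ y : ℝ, ‖HX X (σ + y * Complex.I)‖ ≤ (M * X ^ σ * 2) * (1 + y ^ 2)⁻¹ := by
    intro y
    have := HX_bd hX (s := σ + y * Complex.I) (by rw [line_re]; linarith) (hM y)
    rw [line_re, line_im] at this
    linarith
  have hint0 := integrable_inv_one_add_sq.const_mul (M * X ^ σ * 2)
  have hint : Integrable (fun y : ℝ => HX X (σ + y * Complex.I)) :=
    hint0.mono' (HX_cont hX hσ).aestronglyMeasurable (Eventually.of_forall hb)
  have h1 := intervalIntegral.integral_Iic_sub_Iic (a := -T) (b := T) hint.integrableOn hint.integrableOn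
  have h2 := intervalIntegral.integral_Iic_add_Ioi (b := T) (hint.integrableOn) (hint.integrableOn)
  have h3 : ‖∫ y in Set.Iic (-T), HX X (σ + y * Complex.I)‖ ≤ (M * X ^ σ * 2) * (1 / T) := by
    refine (norm_integral_le_of_norm_le hint0.integrableOn (Eventually.of_forall hb)).trans ?_
    rw [integral_const_mul, integral_Iic_inv_one_add_sq, arctan_neg]
    have := arctan_tail hT
    have hM0 : 0 ≤ M := (norm_nonneg _).trans (hM 0)
    have : 0 ≤ M * X ^ σ * 2 := by positivity
    gcongr
    linarith
  have h4 : ‖∫ y in Set.Ioi T, HX X (σ + y * Complex.I)‖ ≤ (M * X ^ σ * 2) * (1 / T) := by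
    refine (norm_integral_le_of_norm_le hint0.integrableOn (Eventually.of_forall hb)).trans ?_
    rw [integral_const_mul, integral_Ioi_inv_one_add_sq]
    have := arctan_tail hT
    have hM0 : 0 ≤ M := (norm_nonneg _).trans (hM 0)
    gcongr
  have e : (∫ y : ℝ, HX X (σ + y * Complex.I)) - ∫ y in (-T)..T, HX X (σ + y * Complex.I)
      = (∫ y in Set.Iic (-T), HX X (σ + y * Complex.I)) + ∫ y in Set.Ioi T, HX X (σ + y * Complex.I) := by
    rw [← h1, ← h2]; ring
  rw [e]
  refine (norm_add_le _ _).trans ?_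
  calc _ ≤ _ := add_le_add h3 h4
    _ = _ := by ring

lemma HX_shift {X B T δ κ : ℝ} (hX : 1 ≤ X) (hT : 1 ≤ T) (hδ : 0 < δ) (hδ2 : δ ≤ 1 / 2)
    (hκ : 1 < κ) (hκ2 : κ ≤ 2)
    (hB : ∀ s : ℂ, |s.im| ≤ T → 1 - δ ≤ s.re → s.re ≤ 2 → riemannZeta₁ s ≠ 0 ∧ ‖GG s‖ ≤ B) :
    ‖∫ y in (-T)..T, HX X (κ + y * Complex.I)‖ ≤ 2 * π * B * X ^ (1 - δ) + 8 * B * X ^ κ / T := by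
  have hX0 : 0 < X := by linarith
  have hB0 : 0 ≤ B := (norm_nonneg _).trans (hB 1 (by simp; linarith) (by simp; linarith) (by simp)).2
  have hrect := Complex.integral_boundary_rect_eq_zero_of_differentiableOn (HX X)
    ⟨1 - δ, -T⟩ ⟨κ, T⟩ (by
      intro s hs
      rw [Complex.mem_reProdIm] at hs
      simp only at hs
      rw [Set.uIcc_of_le (by linarith), Set.uIcc_of_le (by linarith)] at hs
      obtain ⟨⟨a1, a2⟩, b1, b2⟩ := hs
      exact (HX_diff hX0 (by linarith) (hB s (abs_le.mpr ⟨b1, b2⟩) a1 (by linarith)).1).differentiableWithinAt)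
  simp only [smul_eq_mul] at hrect
  have hh : ∀ u : ℝ, |u| = T →
      ‖∫ x in (1 - δ)..κ, HX X (x + u * Complex.I)‖ ≤ 4 * B * X ^ κ / T := by
    intro u hu
    have : ∀ x ∈ Set.uIoc (1 - δ) κ, ‖HX X (x + u * Complex.I)‖ ≤ 2 * B * X ^ κ / T := by
      intro x hx
      rw [Set.uIoc_of_le (by linarith)] at hx
      have := HX_bd hX0 (s := x + u * Complex.I) (by rw [line_re]; linarith [hx.1])
        (hB _ (by rw [line_im]; exact hu.le) (by rw [line_re]; exact hx.1.le) (by rw [line_re]; linarith [hx.2])).2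
      rw [line_re, line_im, ← sq_abs, hu] at this
      refine this.trans ?_
      have e1 : X ^ x ≤ X ^ κ := rpow_le_rpow_of_exponent_le hX hx.2
      have e2 : (1 + T ^ 2)⁻¹ ≤ T⁻¹ := by gcongr; nlinarith
      calc B * X ^ x * (2 * (1 + T ^ 2)⁻¹) ≤ B * X ^ κ * (2 * T⁻¹) := by gcongr
        _ = _ := by ring
    refine (intervalIntegral.norm_integral_le_of_norm_le_const this).trans ?_
    have h2 : |κ - (1 - δ)| ≤ 2 := by rw [abs_of_nonneg (by linarith)]; linarith
    calc 2 * B * X ^ κ / T * |κ - (1 - δ)| ≤ 2 * B * X ^ κ / T * 2 := by gcongr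
      _ = _ := by ring
  have h1 := hh (-T) (by rw [abs_neg, abs_of_pos (by linarith)])
  have h2 := hh T (abs_of_pos (by linarith))
  have h3 : ‖∫ y in (-T)..T, HX X ((1 - δ : ℝ) + y * Complex.I)‖ ≤ 2 * π * B * X ^ (1 - δ) := by
    have hb : ∀ y ∈ Set.Ioc (-T) T, ‖HX X ((1 - δ : ℝ) + y * Complex.I)‖
        ≤ (2 * B * X ^ (1 - δ)) * (1 + y ^ 2)⁻¹ := by
      intro y hy
      have := HX_bd hX0 (s := (1 - δ : ℝ) + y * Complex.I) (by rw [line_re]; linarith)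
        (hB _ (by rw [line_im]; exact abs_le.mpr ⟨hy.1.le, hy.2⟩) (by rw [line_re])
          (by rw [line_re]; linarith)).2
      rw [line_re, line_im] at this
      linarith
    refine (intervalIntegral.norm_integral_le_of_norm_le (by linarith) (Eventually.of_forall hb)
      ((integrable_inv_one_add_sq.const_mul _).intervalIntegrable)).trans ?_
    rw [intervalIntegral.integral_const_mul, integral_inv_one_add_sq, arctan_neg]
    have := (arctan_lt_pi_div_two T).le
    calc _ ≤ 2 * B * X ^ (1 - δ) * π := by gcongr; linarith
      _ = _ := by ring
  set R := ∫ y in (-T)..T, HX X (κ + y * Complex.I) with hR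
  set L := ∫ y in (-T)..T, HX X ((1 - δ : ℝ) + y * Complex.I) with hL
  set U := ∫ x in (1 - δ)..κ, HX X (x + (-T : ℝ) * Complex.I) with hU
  set V := ∫ x in (1 - δ)..κ, HX X (x + (T : ℝ) * Complex.I) with hV
  have e : Complex.I * R = Complex.I * L - U + V := by linear_combination hrect
  have e2 : ‖R‖ = ‖Complex.I * L - U + V‖ := by rw [← e, norm_mul, Complex.norm_I, one_mul]
  rw [e2]
  calc ‖Complex.I * L - U + V‖ ≤ ‖Complex.I * L‖ + ‖U‖ + ‖V‖ :=
        (norm_add_le _ _).trans (add_le_add_left (norm_sub_le _ _) _)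
    _ ≤ 2 * π * B * X ^ (1 - δ) + 4 * B * X ^ κ / T + 4 * B * X ^ κ / T := by
        rw [norm_mul, Complex.norm_I, one_mul]; gcongr
    _ = _ := by ring

lemma shift_bd : ∃ K : ℝ, 1 ≤ K ∧ ∀ X B T δ : ℝ, 3 ≤ X → 1 ≤ T → 0 < δ → δ ≤ 1 / 2 →
    (∀ s : ℂ, |s.im| ≤ T → 1 - δ ≤ s.re → s.re ≤ 2 → riemannZeta₁ s ≠ 0 ∧ ‖GG s‖ ≤ B) →
    |∑ n ∈ Ioc 0 ⌊X⌋₊, (ArithmeticFunction.vonMangoldt n - 1) * (1 - n / X)|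
      ≤ K * (X * (log X + B) / T + B * X ^ (1 - δ)) := by
  obtain ⟨C, hC, hz⟩ := zeta_real
  refine ⟨8 * C, by linarith, fun X B T δ hX hT hδ hδ2 hB => ?_⟩
  have hX0 : 0 < X := by linarith
  have hB0 : 0 ≤ B := (norm_nonneg _).trans (hB 1 (by simp; linarith) (by simp; linarith) (by simp)).2
  have hl : 1 < log X := by
    rw [lt_log_iff_exp_lt hX0]; linarith [exp_one_lt_d9]
  set κ := 1 + 1 / log X with hκ
  have hk1 : 1 < κ := by have : 0 < 1 / log X := by positivity
                         linarith
  have hk2 : κ ≤ 2 := by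
    have : 1 / log X ≤ 1 := by rw [div_le_one (by linarith)]; exact hl.le
    linarith
  have hXk : X ^ κ ≤ 3 * X := by
    rw [hκ, rpow_add hX0, rpow_one, rpow_def_of_pos hX0 (1 / log X), mul_one_div_cancel (by linarith)]
    nlinarith [exp_one_lt_d9]
  have hM : ∀ y : ℝ, ‖GG (κ + y * Complex.I)‖ ≤ 2 * C * log X := by
    intro y
    have hs1 : ((κ : ℂ) + y * Complex.I) ≠ 1 := by
      intro h
      have := congrArg Complex.re h
      rw [line_re, Complex.one_re] at this; linarith
    rw [GG_eq hs1 (zeta1_ne (by rw [line_re]; exact hk1.le))]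
    have := hz (κ + y * Complex.I) (by rw [line_re]; exact hk1) (by rw [line_re]; exact hk2)
    rw [line_re] at this
    have e : C / (κ - 1) = C * log X := by rw [hκ]; simp
    rw [e] at this
    calc _ ≤ ‖-(deriv riemannZeta (κ + y * Complex.I) / riemannZeta (κ + y * Complex.I))‖ + _ := norm_sub_le _ _
      _ ≤ C * log X + C * log X := by rw [norm_neg]; exact add_le_add this.2.2.2 this.1
      _ = _ := by ring
  have h1 := HX_tails hX0 (by linarith : 0 < T) hk1.le hM
  have h2 := HX_shift (by linarith : 1 ≤ X) hT hδ hδ2 hk1 hk2 hB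
  have h3 := perron hk1 hX0
  change ∫ y : ℝ, HX X (κ + y * Complex.I) = _ at h3
  set S := ∑ n ∈ Ioc 0 ⌊X⌋₊, (ArithmeticFunction.vonMangoldt n - 1) * (1 - n / X) with hS
  have h4 : 2 * π * |S| ≤ 4 * (2 * C * log X) * X ^ κ / T + (2 * π * B * X ^ (1 - δ) + 8 * B * X ^ κ / T) := by
    have : ‖∫ y : ℝ, HX X (κ + y * Complex.I)‖ = 2 * π * |S| := by
      rw [h3, Complex.norm_real, norm_eq_abs, abs_mul, abs_of_pos (by positivity)]
    rw [← this]
    calc _ = ‖((∫ y : ℝ, HX X (κ + y * Complex.I)) - ∫ y in (-T)..T, HX X (κ + y * Complex.I))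
          + ∫ y in (-T)..T, HX X (κ + y * Complex.I)‖ := by rw [sub_add_cancel]
      _ ≤ _ := (norm_add_le _ _).trans (add_le_add h1 h2)
  have hp := pi_gt_three
  have hl0 : 0 < log X := by linarith
  have h5 : 4 * (2 * C * log X) * X ^ κ / T + 8 * B * X ^ κ / T ≤ 24 * C * (X * (log X + B) / T) := by
    calc 4 * (2 * C * log X) * X ^ κ / T + 8 * B * X ^ κ / T
        = (8 * C * log X + 8 * B) * X ^ κ / T := by ring
      _ ≤ (8 * C * log X + 8 * (C * B)) * (3 * X) / T := by
        gcongr; nlinarith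
      _ = _ := by ring
  have h6 : 0 ≤ X * (log X + B) / T := by positivity
  have h7 : 0 ≤ B * X ^ (1 - δ) := by positivity
  have h8 : 2 * π * |S| ≤ 2 * π * (8 * C * (X * (log X + B) / T + B * X ^ (1 - δ))) := by
    have a1 : 24 * C * (X * (log X + B) / T) ≤ 2 * π * (8 * C * (X * (log X + B) / T)) := by
      have : 0 ≤ C * (X * (log X + B) / T) := by positivity
      nlinarith
    have a2 : 2 * π * B * X ^ (1 - δ) ≤ 2 * π * (8 * C * (B * X ^ (1 - δ))) := by
      have : 0 ≤ 2 * π * (B * X ^ (1 - δ)) := by positivity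
      nlinarith
    linarith
  exact le_of_mul_le_mul_left h8 (by positivity)


noncomputable def WW (x : ℝ) : ℝ := log x ^ ((3:ℝ)/5) * log (log x) ^ (-(1:ℝ)/5)

lemma WW_lower {x : ℝ} (h : 1 ≤ log (log x)) (h1 : 1 ≤ log x) : log x ^ (2/5 : ℝ) ≤ WW x := by
  unfold WW
  have h2 : log (log x) ≤ log x := (log_le_sub_one_of_pos (by linarith)).trans (by linarith)
  have h3 : log x ^ (-(1:ℝ)/5) ≤ log (log x) ^ (-(1:ℝ)/5) :=
    rpow_le_rpow_of_nonpos (by linarith) h2 (by norm_num)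
  calc log x ^ (2/5 : ℝ) = log x ^ ((3:ℝ)/5) * log x ^ (-(1:ℝ)/5) := by
        rw [← rpow_add (by linarith)]; norm_num
    _ ≤ _ := by gcongr

lemma WW_upper {x : ℝ} (h : 1 ≤ log (log x)) (h1 : 1 ≤ log x) : WW x ≤ log x ^ (3/5 : ℝ) := by
  unfold WW
  have : log (log x) ^ (-(1:ℝ)/5) ≤ 1 := rpow_le_one_of_one_le_of_nonpos h (by norm_num)
  nlinarith [rpow_nonneg (by linarith : 0 ≤ log x) (3/5 : ℝ)]

lemma WW_tendsto : Tendsto WW atTop atTop := by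
  refine tendsto_atTop_mono' atTop ?_ ((tendsto_rpow_atTop (by norm_num : (0:ℝ) < 2/5)).comp tendsto_log_atTop)
  filter_upwards [(tendsto_log_atTop.comp tendsto_log_atTop).eventually_ge_atTop 1, tendsto_log_atTop.eventually_ge_atTop 1] with x h1 h2
  exact WW_lower h1 h2

lemma WW_cmp {x y r : ℝ} (h : 1 ≤ log (log x)) (h1 : 1 ≤ log x) (hr : 1 ≤ r) (hy : log y = r * log x) :
    WW x ≤ WW y ∧ WW y ≤ r * WW x := by
  have hL : 0 < log x := by linarith
  have hl : 0 < log (log x) := by linarith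
  have e : log (log y) = log r + log (log x) := by rw [hy, log_mul (by linarith) hL.ne']
  have hlr : 0 ≤ log r := log_nonneg hr
  have e1 : log (log y) ≤ r * log (log x) := by
    have := log_le_sub_one_of_pos (by linarith : 0 < r)
    rw [e]; nlinarith
  have e2 : log (log x) ≤ log (log y) := by linarith
  unfold WW
  constructor
  · have a1 : (r * log (log x)) ^ (-(1:ℝ)/5) ≤ log (log y) ^ (-(1:ℝ)/5) :=
      rpow_le_rpow_of_nonpos (by linarith) e1 (by norm_num)
    have a2 : (1:ℝ) ≤ r ^ (3/5 : ℝ) * r ^ (-(1:ℝ)/5) := by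
      rw [← rpow_add (by linarith)]
      exact one_le_rpow hr (by norm_num)
    calc log x ^ ((3:ℝ)/5) * log (log x) ^ (-(1:ℝ)/5)
        ≤ (r ^ (3/5 : ℝ) * r ^ (-(1:ℝ)/5)) * (log x ^ ((3:ℝ)/5) * log (log x) ^ (-(1:ℝ)/5)) :=
          le_mul_of_one_le_left (by positivity) a2
      _ = (r * log x) ^ ((3:ℝ)/5) * (r * log (log x)) ^ (-(1:ℝ)/5) := by
          rw [mul_rpow (by linarith) hL.le, mul_rpow (by linarith) hl.le]; ring
      _ ≤ _ := by
          have : 0 ≤ log y := by rw [hy]; positivity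
          rw [← hy]; gcongr
  · have a1 : log (log y) ^ (-(1:ℝ)/5) ≤ log (log x) ^ (-(1:ℝ)/5) :=
      rpow_le_rpow_of_nonpos hl e2 (by norm_num)
    have a2 : r ^ (3/5 : ℝ) ≤ r := by
      calc r ^ (3/5 : ℝ) ≤ r ^ (1 : ℝ) := rpow_le_rpow_of_exponent_le hr (by norm_num)
        _ = r := rpow_one r
    have hp : 0 < log (log y) := by linarith
    have e3 : log y ^ ((3:ℝ)/5) = r ^ ((3:ℝ)/5) * log x ^ ((3:ℝ)/5) := by
      rw [hy, mul_rpow (by linarith) hL.le]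
    rw [e3]
    calc r ^ ((3:ℝ)/5) * log x ^ ((3:ℝ)/5) * log (log y) ^ (-(1:ℝ)/5)
        ≤ r * log x ^ ((3:ℝ)/5) * log (log x) ^ (-(1:ℝ)/5) := by gcongr
      _ = _ := by ring

lemma WW_mono {x y : ℝ} (hx : exp (exp 1) ≤ x) (hxy : x ≤ y) : WW x ≤ WW y := by
  have hx0 : 0 < x := (exp_pos _).trans_le hx
  have h1 : exp 1 ≤ log x := (le_log_iff_exp_le hx0).mpr hx
  have h2 : 1 ≤ log x := by linarith [add_one_le_exp (1:ℝ)]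
  have h3 : 1 ≤ log (log x) := (le_log_iff_exp_le (by linarith)).mpr h1
  refine (WW_cmp h3 h2 (r := log y / log x) ?_ ?_).1
  · rw [le_div_iff₀ (by linarith), one_mul]; exact log_le_log hx0 hxy
  · rw [div_mul_cancel₀ _ (by linarith)]

lemma WW_sqrt {x : ℝ} (hx : exp (exp 1) ≤ √x) : WW x ≤ 2 * WW (√x) := by
  have hx0 : 0 < √x := (exp_pos _).trans_le hx
  have h1 : exp 1 ≤ log √x := (le_log_iff_exp_le hx0).mpr hx
  have h2 : 1 ≤ log √x := by linarith [add_one_le_exp (1:ℝ)]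
  have h3 : 1 ≤ log (log √x) := (le_log_iff_exp_le (by linarith)).mpr h1
  refine (WW_cmp h3 h2 (r := 2) (by norm_num) ?_).2
  rw [log_sqrt (Real.sqrt_pos.mp hx0).le]; ring

lemma zf_WW {x : ℝ} (h : 1 ≤ log (log x)) (h1 : 1 ≤ log x) (hW : 1 < WW x) :
    WW x ≤ zf (exp (WW x)) * log x := by
  unfold zf th
  rw [log_exp]
  set W := WW x with hWd
  have hlW : 0 < log W := log_pos hW
  have hl2 : log W ≤ log (log x) := by
    apply log_le_log (by linarith)
    refine (WW_upper h h1).trans ?_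
    calc log x ^ (3/5 : ℝ) ≤ log x ^ (1 : ℝ) := rpow_le_rpow_of_exponent_le h1 (by norm_num)
      _ = _ := rpow_one _
  have hL : 0 < log x := by linarith
  have hl : 0 < log (log x) := by linarith
  have e1 : (log W / W) ^ (2/3 : ℝ) / log W = W ^ (-(2/3) : ℝ) * log W ^ (-(1/3) : ℝ) := by
    rw [div_rpow hlW.le (by linarith), rpow_neg (by linarith),
      show (-(1/3) : ℝ) = 2/3 - 1 by norm_num, rpow_sub hlW, rpow_one]
    field_simp
  have e2 : W ^ (-(2/3) : ℝ) = log x ^ (-(2/5) : ℝ) * log (log x) ^ (2/15 : ℝ) := by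
    rw [hWd]; unfold WW
    rw [mul_rpow (by positivity) (by positivity), ← rpow_mul hL.le, ← rpow_mul hl.le]
    norm_num
  have e3 : log (log x) ^ (-(1/3) : ℝ) ≤ log W ^ (-(1/3) : ℝ) :=
    rpow_le_rpow_of_nonpos hlW hl2 (by norm_num)
  calc W = log x ^ ((3:ℝ)/5) * log (log x) ^ (-(1:ℝ)/5) := rfl
    _ = (log x ^ (-(2/5) : ℝ) * log x ^ (1:ℝ)) * (log (log x) ^ (2/15 : ℝ) * log (log x) ^ (-(1/3) : ℝ)) := by
      rw [← rpow_add hL, ← rpow_add hl]; norm_num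
    _ = W ^ (-(2/3) : ℝ) * log (log x) ^ (-(1/3) : ℝ) * log x := by rw [e2, rpow_one]; ring
    _ ≤ W ^ (-(2/3) : ℝ) * log W ^ (-(1/3) : ℝ) * log x := by
      have : 0 < W := by linarith
      gcongr
    _ = _ := by rw [e1]

lemma pow_exp_ev (K A : ℝ) {c : ℝ} (hc : 0 < c) : ∀ᶠ W : ℝ in atTop, K * W ^ A ≤ exp (c * W) := by
  have h := (isLittleO_rpow_exp_pos_mul_atTop A hc).const_mul_left K
  filter_upwards [h.bound (by norm_num : (0:ℝ) < 1)] with W hW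
  rw [one_mul, norm_of_nonneg (exp_pos _).le] at hW
  exact (le_abs_self _).trans hW

lemma psi1_bd : ∃ c : ℝ, 0 < c ∧ ∀ᶠ X : ℝ in atTop,
    |∑ n ∈ Ioc 0 ⌊X⌋₊, (ArithmeticFunction.vonMangoldt n - 1) * (1 - n / X)|
      ≤ X * exp (-c * WW X) := by
  obtain ⟨c, A, hc, hA, hG⟩ := GG_bd
  obtain ⟨K, hK, hS⟩ := shift_bd
  set c' := min c 1 / 2 with hc'
  have hm : 0 < min c 1 := lt_min hc one_pos
  have hc0 : 0 < c' := by positivity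
  refine ⟨c', hc0, ?_⟩
  have hte : Tendsto (fun X => exp (WW X)) atTop atTop := tendsto_exp_atTop.comp WW_tendsto
  filter_upwards [hte.eventually hG, hte.eventually (zf_ev 2 hc (by norm_num)),
    hte.eventually_ge_atTop 4, WW_tendsto.eventually (pow_exp_ev (9 * K) (A + 3) hc0),
    WW_tendsto.eventually_gt_atTop 1, (tendsto_log_atTop.comp tendsto_log_atTop).eventually_ge_atTop 1,
    tendsto_log_atTop.eventually_ge_atTop 1, eventually_ge_atTop 3] with X h1 h2 h3 h4 h5 h6 h7 h8
  have hδ := h2.2.2.2.1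
  have h28 := h2.2.2.2.2.2.2.2.1
  have hX0 : 0 < X := by linarith
  set W := WW X with hW
  have key := hS X (W ^ A) (exp W / 4) (c * zf (exp W)) h8 (by linarith) (by positivity) (by linarith) (by
    intro s a1 a2 a3
    have := h1 s a1 a2 a3
    rwa [log_exp] at this)
  refine key.trans ?_
  have hz := zf_WW h6 h7 h5
  rw [← hW] at hz
  have b1 : X ^ (1 - c * zf (exp W)) ≤ X * exp (-(2 * c') * W) := by
    rw [rpow_def_of_pos hX0]
    nth_rw 2 [← exp_log hX0]
    rw [← exp_add]
    apply exp_le_exp.mpr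
    have : 2 * c' ≤ c := by rw [hc']; linarith [min_le_left c 1]
    nlinarith
  have b2 : exp (-W) ≤ exp (-(2 * c') * W) := by
    apply exp_le_exp.mpr
    have : 2 * c' ≤ 1 := by rw [hc']; linarith [min_le_right c 1]
    nlinarith
  have b3 : log X ≤ W ^ (A + 3) := by
    calc log X = log X ^ (1 : ℝ) := (rpow_one _).symm
      _ ≤ log X ^ ((2/5 : ℝ) * (A + 3)) := rpow_le_rpow_of_exponent_le h7 (by linarith)
      _ = (log X ^ (2/5 : ℝ)) ^ (A + 3) := rpow_mul (by linarith) _ _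
      _ ≤ W ^ (A + 3) := by
        apply rpow_le_rpow (by positivity) (WW_lower h6 h7) (by linarith)
  have b4 : W ^ A ≤ W ^ (A + 3) := rpow_le_rpow_of_exponent_le h5.le (by linarith)
  have hWp : 0 < W := by linarith
  have hE : exp (-(2 * c') * W) * exp (c' * W) = exp (-c' * W) := by rw [← exp_add]; ring_nf
  calc K * (X * (log X + W ^ A) / (exp W / 4) + W ^ A * X ^ (1 - c * zf (exp W)))
      = K * (X * (log X + W ^ A) * 4 * exp (-W) + W ^ A * X ^ (1 - c * zf (exp W))) := by
        rw [exp_neg]; field_simp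
    _ ≤ K * (X * (W ^ (A + 3) + W ^ (A + 3)) * 4 * exp (-(2 * c') * W)
          + W ^ (A + 3) * (X * exp (-(2 * c') * W))) := by gcongr
    _ = X * exp (-(2 * c') * W) * (9 * K * W ^ (A + 3)) := by ring
    _ ≤ X * exp (-(2 * c') * W) * exp (c' * W) := by gcongr
    _ = X * exp (-c' * W) := by rw [mul_assoc, hE]


lemma WW_small (c : ℝ) : ∀ᶠ x : ℝ in atTop, c * WW x ≤ log x := by
  filter_upwards [((tendsto_rpow_atTop (by norm_num : (0:ℝ) < 2/5)).comp tendsto_log_atTop).eventually_ge_atTop |c|,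
    (tendsto_log_atTop.comp tendsto_log_atTop).eventually_ge_atTop 1,
    tendsto_log_atTop.eventually_ge_atTop 1, WW_tendsto.eventually_ge_atTop 0] with x h1 h2 h3 h4
  simp only [Function.comp] at h1
  have h5 := WW_upper h2 h3
  have h6 : 0 < log x := by linarith
  calc c * WW x ≤ |c| * WW x := by gcongr; exact le_abs_self c
    _ ≤ log x ^ (2/5:ℝ) * log x ^ (3/5:ℝ) := by gcongr
    _ = log x := by rw [← rpow_add h6]; norm_num

lemma smooth_cmp {f : ℕ → ℝ} (hf : ∀ n, 0 ≤ f n) {a b : ℝ} (ha : 0 ≤ a) (hab : a ≤ b) :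
    (b - a) * ∑ n ∈ Ioc 0 ⌊a⌋₊, f n
      ≤ ∑ n ∈ Ioc 0 ⌊b⌋₊, f n * (b - n) - ∑ n ∈ Ioc 0 ⌊a⌋₊, f n * (a - n) ∧
    ∑ n ∈ Ioc 0 ⌊b⌋₊, f n * (b - n) - ∑ n ∈ Ioc 0 ⌊a⌋₊, f n * (a - n)
      ≤ (b - a) * ∑ n ∈ Ioc 0 ⌊b⌋₊, f n := by
  have hsub : Ioc 0 ⌊a⌋₊ ⊆ Ioc 0 ⌊b⌋₊ := Finset.Ioc_subset_Ioc_right (Nat.floor_mono hab)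
  have e1 := sum_sdiff (f := fun n => f n * (b - n)) hsub
  have e2 := sum_sdiff (f := f) hsub
  have e3 : ∑ n ∈ Ioc 0 ⌊a⌋₊, f n * (b - n) - ∑ n ∈ Ioc 0 ⌊a⌋₊, f n * (a - n)
      = (b - a) * ∑ n ∈ Ioc 0 ⌊a⌋₊, f n := by
    rw [← sum_sub_distrib, mul_sum]
    exact sum_congr rfl fun n _ => by ring
  have hmem : ∀ n ∈ Ioc 0 ⌊b⌋₊ \ Ioc 0 ⌊a⌋₊, a ≤ n ∧ (n : ℝ) ≤ b := by
    intro n hn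
    rw [Finset.mem_sdiff, mem_Ioc, mem_Ioc] at hn
    refine ⟨?_, (Nat.le_floor_iff (ha.trans hab)).mp hn.1.2⟩
    have : ⌊a⌋₊ < n := by have := hn.2; have := hn.1.1; omega
    exact ((Nat.floor_lt ha).mp this).le
  have h1 : 0 ≤ ∑ n ∈ Ioc 0 ⌊b⌋₊ \ Ioc 0 ⌊a⌋₊, f n * (b - n) :=
    sum_nonneg fun n hn => mul_nonneg (hf n) (by linarith [(hmem n hn).2])
  have h2 : ∑ n ∈ Ioc 0 ⌊b⌋₊ \ Ioc 0 ⌊a⌋₊, f n * (b - n)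
      ≤ (b - a) * ∑ n ∈ Ioc 0 ⌊b⌋₊ \ Ioc 0 ⌊a⌋₊, f n := by
    rw [mul_sum]
    refine sum_le_sum fun n hn => ?_
    have := (hmem n hn).1
    nlinarith [hf n]
  constructor
  · linarith
  · rw [← e2, mul_add]; linarith

lemma smooth_eq {X : ℝ} (hX : 0 < X) :
    ∑ n ∈ Ioc 0 ⌊X⌋₊, ArithmeticFunction.vonMangoldt n * (X - n)
      - ∑ n ∈ Ioc 0 ⌊X⌋₊, (fun _ : ℕ => (1:ℝ)) n * (X - n)
    = X * ∑ n ∈ Ioc 0 ⌊X⌋₊, (ArithmeticFunction.vonMangoldt n - 1) * (1 - n / X) := by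
  rw [← sum_sub_distrib, mul_sum]
  refine sum_congr rfl fun n _ => ?_
  field_simp

lemma unsmooth {a b e : ℝ} (ha : 0 < a) (hab : a ≤ b)
    (h1 : |∑ n ∈ Ioc 0 ⌊a⌋₊, (ArithmeticFunction.vonMangoldt n - 1) * (1 - n / a)| ≤ a * e)
    (h2 : |∑ n ∈ Ioc 0 ⌊b⌋₊, (ArithmeticFunction.vonMangoldt n - 1) * (1 - n / b)| ≤ b * e) :
    (b - a) * Chebyshev.psi a ≤ (b - a) * b + 2 * b ^ 2 * e ∧
    (b - a) * (a - 1) - 2 * b ^ 2 * e ≤ (b - a) * Chebyshev.psi b := by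
  have hb : 0 < b := by linarith
  have e0 : 0 ≤ e := by
    have := (abs_nonneg _).trans h1
    by_contra h
    push Not at h
    nlinarith
  have A := smooth_cmp (f := fun n => ArithmeticFunction.vonMangoldt n)
    (fun n => ArithmeticFunction.vonMangoldt_nonneg) ha.le hab
  have B := smooth_cmp (f := fun _ => (1:ℝ)) (fun n => zero_le_one) ha.le hab
  have ea := smooth_eq ha
  have eb := smooth_eq hb
  have fa : a - 1 ≤ ∑ n ∈ Ioc 0 ⌊a⌋₊, (1:ℝ) := by
    simp; linarith [Nat.lt_floor_add_one a]
  have fb : ∑ n ∈ Ioc 0 ⌊b⌋₊, (1:ℝ) ≤ b := by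
    simp; exact Nat.floor_le hb.le
  have ga : |a * ∑ n ∈ Ioc 0 ⌊a⌋₊, (ArithmeticFunction.vonMangoldt n - 1) * (1 - n / a)| ≤ b ^ 2 * e := by
    rw [abs_mul, abs_of_pos ha]
    calc _ ≤ a * (a * e) := by gcongr
      _ ≤ b * (b * e) := by gcongr
      _ = _ := by ring
  have gb : |b * ∑ n ∈ Ioc 0 ⌊b⌋₊, (ArithmeticFunction.vonMangoldt n - 1) * (1 - n / b)| ≤ b ^ 2 * e := by
    rw [abs_mul, abs_of_pos hb]
    calc _ ≤ b * (b * e) := by gcongr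
      _ = _ := by ring
  rw [← ea] at ga
  rw [← eb] at gb
  have ga' := abs_le.mp ga
  have gb' := abs_le.mp gb
  have m1 := mul_le_mul_of_nonneg_left fa (by linarith : 0 ≤ b - a)
  have m2 := mul_le_mul_of_nonneg_left fb (by linarith : 0 ≤ b - a)
  unfold Chebyshev.psi
  constructor
  · linarith [A.1, B.2]
  · linarith [A.2, B.1]

lemma psi_bd : ∃ c : ℝ, 0 < c ∧ ∀ᶠ x : ℝ in atTop, |Chebyshev.psi x - x| ≤ 10 * (x * exp (-c * WW x)) := by
  obtain ⟨c, hc, h⟩ := psi1_bd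
  refine ⟨c / 4, by positivity, ?_⟩
  obtain ⟨x₀, hx₀⟩ := eventually_atTop.mp h
  have hs : Tendsto (fun x : ℝ => √x) atTop atTop := tendsto_sqrt_atTop
  filter_upwards [hs.eventually_ge_atTop x₀, hs.eventually_ge_atTop (exp (exp 1)), hs.eventually_ge_atTop 2,
    WW_small (c / 4), (WW_tendsto.const_mul_atTop (by positivity : 0 < c / 4)).eventually_ge_atTop 1] with x h1 h2 h3 h4 h5
  have hx0 : 0 < x := Real.sqrt_pos.mp (by linarith)
  have hsq : √x * √x = x := Real.mul_self_sqrt hx0.le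
  set W := WW x with hW
  set d := exp (-(c / 4) * W) with hd
  have hd0 : 0 < d := exp_pos _
  have hd1 : d ≤ 1 / 2 := by
    have : d ≤ exp (-1) := exp_le_exp.mpr (by linarith)
    refine this.trans ?_
    rw [exp_neg, ← one_div]
    apply one_div_le_one_div_of_le (by norm_num)
    linarith [add_one_le_exp (1:ℝ)]
  have hdd : exp (-(c / 2) * W) = d * d := by rw [hd, ← exp_add]; ring_nf
  have hxd : 1 ≤ x * d := by
    nth_rw 1 [← exp_log hx0]
    rw [hd, ← exp_add]
    apply one_le_exp
    linarith
  have key : ∀ y, √x ≤ y → |∑ n ∈ Ioc 0 ⌊y⌋₊, (ArithmeticFunction.vonMangoldt n - 1) * (1 - n / y)| ≤ y * (d * d) := by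
    intro y hy
    refine (hx₀ y (h1.trans hy)).trans ?_
    rw [← hdd]
    have : W ≤ 2 * WW y := (WW_sqrt h2).trans (by linarith [WW_mono h2 hy])
    have : 0 < y := by linarith
    apply mul_le_mul_of_nonneg_left _ this.le
    apply exp_le_exp.mpr
    nlinarith
  have hsx : √x ≤ x / 2 := by nlinarith
  have p1 := (unsmooth hx0 (by nlinarith : x ≤ x + x * d) (key x (by linarith)) (key _ (by nlinarith))).1
  have p2 := (unsmooth (a := x - x * d) (b := x) (by nlinarith) (by nlinarith) (key _ (by nlinarith)) (key x (by linarith))).2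
  have hxd0 : 0 < x * d := by linarith
  rw [abs_le]
  constructor
  · have : x * d * (x - 4 * (x * d)) ≤ x * d * Chebyshev.psi x := by nlinarith
    have := le_of_mul_le_mul_left this hxd0
    linarith
  · have : x * d * Chebyshev.psi x ≤ x * d * (x + 10 * (x * d)) := by
      have : (1 + d) ^ 2 ≤ 4 := by nlinarith
      have : 0 ≤ (x * d) ^ 2 * (4 - (1 + d) ^ 2) := by apply mul_nonneg (sq_nonneg _); linarith
      nlinarith
    have := le_of_mul_le_mul_left this hxd0
    linarith

lemma sqrt_small (c : ℝ) (k : ℕ) : ∀ᶠ x : ℝ in atTop, √x * log x ^ k ≤ x * exp (-c * WW x) := by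
  have hl := (isLittleO_log_rpow_rpow_atTop (k : ℝ) (by norm_num : (0:ℝ) < 1/4)).bound (by norm_num : (0:ℝ) < 1)
  filter_upwards [WW_small (4 * c), hl, eventually_ge_atTop 1] with x h1 h2 h3
  have hx0 : 0 < x := by linarith
  rw [one_mul, norm_of_nonneg (by positivity : 0 ≤ x ^ (1/4:ℝ)), rpow_natCast] at h2
  have h4 := (le_abs_self _).trans h2
  have h5 : x ^ (-(1/4) : ℝ) ≤ exp (-c * WW x) := by
    rw [rpow_def_of_pos hx0]; apply exp_le_exp.mpr; linarith
  calc √x * log x ^ k ≤ x ^ (1/2:ℝ) * x ^ (1/4:ℝ) := by rw [sqrt_eq_rpow]; gcongr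
    _ = x ^ (1:ℝ) * x ^ (-(1/4) : ℝ) := by rw [← rpow_add hx0, ← rpow_add hx0]; norm_num
    _ ≤ _ := by rw [rpow_one]; gcongr

lemma theta_bd : ∃ c : ℝ, 0 < c ∧ ∀ᶠ x : ℝ in atTop, |Chebyshev.theta x - x| ≤ 12 * (x * exp (-c * WW x)) := by
  obtain ⟨c, hc, h⟩ := psi_bd
  refine ⟨c, hc, ?_⟩
  filter_upwards [h, sqrt_small c 1, eventually_ge_atTop 1] with x h1 h2 h3
  have := Chebyshev.abs_psi_sub_theta_le_sqrt_mul_log h3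
  rw [pow_one] at h2
  rw [abs_le] at *
  constructor <;> linarith [h1.1, h1.2, this.1, this.2]

lemma li_parts {x : ℝ} (hx : 2 ≤ x) : ∫ t in (2:ℝ)..x, 1 / log t
    = x / log x - 2 / log 2 + ∫ t in (2:ℝ)..x, 1 / log t ^ 2 := by
  have i2 := Chebyshev.intervalIntegrable_one_div_log_sq (a := 2) (b := x) (by norm_num) (by linarith)
  have hlog : ∀ t ∈ Set.uIcc 2 x, 0 < t ∧ log t ≠ 0 := by
    intro t ht
    rw [Set.uIcc_of_le hx] at ht
    exact ⟨by linarith [ht.1], (log_pos (by linarith [ht.1])).ne'⟩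
  have i1 : IntervalIntegrable (fun t => 1 / log t) volume 2 x := by
    refine ContinuousOn.intervalIntegrable fun t ht => ContinuousAt.continuousWithinAt ?_
    obtain ⟨a, b⟩ := hlog t ht
    have := a.ne'
    fun_prop
  have h := intervalIntegral.integral_eq_sub_of_hasDerivAt (f := fun t => t / log t)
    (f' := fun t => 1 / log t - 1 / log t ^ 2) (a := 2) (b := x) (by
      intro t ht
      obtain ⟨a, b⟩ := hlog t ht
      have hd := (hasDerivAt_id t).div (hasDerivAt_log a.ne') b
      have e : 1 / log t - 1 / log t ^ 2 = (1 * log t - id t * t⁻¹) / log t ^ 2 := by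
        rw [id, mul_inv_cancel₀ a.ne']
        field_simp
      rw [e]
      exact hd) (i1.sub i2)
  rw [intervalIntegral.integral_sub i1 i2] at h
  linarith

lemma pi_li_eq {x : ℝ} (hx : 2 ≤ x) : (Nat.primeCounting ⌊x⌋₊ : ℝ) - ∫ t in (2:ℝ)..x, 1 / log t
    = (Chebyshev.theta x - x) / log x + 2 / log 2 + ∫ t in (2:ℝ)..x, (Chebyshev.theta t - t) / (t * log t ^ 2) := by
  have i2 := Chebyshev.intervalIntegrable_one_div_log_sq (a := 2) (b := x) (by norm_num) (by linarith)
  have i1 : IntervalIntegrable (fun t => Chebyshev.theta t / (t * log t ^ 2)) volume 2 x := by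
    rw [intervalIntegrable_iff_integrableOn_Icc_of_le hx]
    exact Chebyshev.integrableOn_theta_div_id_mul_log_sq x
  rw [Chebyshev.primeCounting_eq_theta_div_log_add_integral hx, li_parts hx]
  have e : ∫ t in (2:ℝ)..x, (Chebyshev.theta t - t) / (t * log t ^ 2)
      = (∫ t in (2:ℝ)..x, Chebyshev.theta t / (t * log t ^ 2)) - ∫ t in (2:ℝ)..x, 1 / log t ^ 2 := by
    rw [← intervalIntegral.integral_sub i1 i2]
    apply intervalIntegral.integral_congr
    intro t ht
    rw [Set.uIcc_of_le hx] at ht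
    have h1 : 0 < log t := log_pos (by linarith [ht.1])
    have h2 : 0 < t := by linarith [ht.1]
    simp only
    field_simp
  rw [e]; ring

lemma int_bd {a b M : ℝ} (ha : 2 ≤ a) (hab : a ≤ b) (hM : ∀ t, a ≤ t → |Chebyshev.theta t - t| ≤ M * t) :
    |∫ t in a..b, (Chebyshev.theta t - t) / (t * log t ^ 2)| ≤ 4 * M * b := by
  have hM0 : 0 ≤ M := by
    have := (abs_nonneg _).trans (hM a le_rfl)
    by_contra h
    push Not at h
    nlinarith
  have h := intervalIntegral.norm_integral_le_of_norm_le_const (a := a) (b := b) (C := 4 * M)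
    (f := fun t => (Chebyshev.theta t - t) / (t * log t ^ 2)) (by
      intro t ht
      rw [Set.uIoc_of_le hab] at ht
      have h0 : 0 < t := by linarith [ht.1]
      have h1 : 1 / 2 ≤ log t := by
        have := log_le_log (by norm_num) (by linarith [ht.1] : 2 ≤ t)
        linarith [log_two_gt_d9]
      have h2 : 1 / 4 ≤ log t ^ 2 := by nlinarith
      rw [norm_eq_abs, abs_div, abs_of_pos (by positivity : 0 < t * log t ^ 2), div_le_iff₀ (by positivity)]
      refine (hM t ht.1.le).trans ?_
      have : 0 ≤ M * t := by positivity
      nlinarith)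
  rw [norm_eq_abs] at h
  refine h.trans ?_
  gcongr
  rw [abs_of_nonneg (by linarith)]
  linarith

lemma theta_triv {t : ℝ} (ht : 2 ≤ t) : |Chebyshev.theta t - t| ≤ 5 * t := by
  have h1 := Chebyshev.theta_nonneg t
  have h2 := Chebyshev.theta_le_log4_mul_x (x := t) (by linarith)
  have h3 : log 4 ≤ 3 := (log_le_sub_one_of_pos (by norm_num)).trans (by norm_num)
  rw [abs_le]
  constructor <;> nlinarith

lemma pi_bd : ∃ c : ℝ, 0 < c ∧ ∀ᶠ x : ℝ in atTop,
    |(Nat.primeCounting ⌊x⌋₊ : ℝ) - ∫ t in (2:ℝ)..x, 1 / log t| ≤ 100 * (x * exp (-c * WW x)) := by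
  obtain ⟨c, hc, h⟩ := theta_bd
  refine ⟨c / 2, by positivity, ?_⟩
  obtain ⟨x₀, hx₀⟩ := eventually_atTop.mp h
  have hs : Tendsto (fun x : ℝ => √x) atTop atTop := tendsto_sqrt_atTop
  filter_upwards [hs.eventually_ge_atTop x₀, hs.eventually_ge_atTop (exp (exp 1)), hs.eventually_ge_atTop 2,
    sqrt_small (c / 2) 0, tendsto_log_atTop.eventually_ge_atTop 1,
    WW_tendsto.eventually_ge_atTop 0] with x h1 h2 h3 h4 h5 h6
  have hx0 : 0 < x := Real.sqrt_pos.mp (by linarith)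
  have hsq : √x * √x = x := Real.mul_self_sqrt hx0.le
  have hsx : √x ≤ x / 2 := by nlinarith
  set D := exp (-(c / 2) * WW x) with hD
  rw [pow_zero, mul_one] at h4
  have key : ∀ t, √x ≤ t → |Chebyshev.theta t - t| ≤ (12 * D) * t := by
    intro t ht
    have ht0 : 0 < t := by linarith
    have h8 : exp (-c * WW t) ≤ D := by
      apply exp_le_exp.mpr
      have : WW x ≤ 2 * WW t := (WW_sqrt h2).trans (by linarith [WW_mono h2 ht])
      nlinarith
    calc _ ≤ 12 * (t * exp (-c * WW t)) := hx₀ t (h1.trans ht)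
      _ ≤ 12 * (t * D) := by gcongr
      _ = _ := by ring
  have hx2 : 2 ≤ x := by linarith
  have b1 := int_bd le_rfl h3 (fun t ht => theta_triv ht)
  have b2 := int_bd h3 (by linarith : √x ≤ x) key
  have hint : ∀ a b : ℝ, 2 ≤ a → a ≤ b → IntervalIntegrable (fun t => (Chebyshev.theta t - t) / (t * log t ^ 2)) volume a b := by
    intro a b ha hab
    have i2 := Chebyshev.intervalIntegrable_one_div_log_sq (a := a) (b := b) (by linarith) (by linarith)
    have i1 : IntervalIntegrable (fun t => Chebyshev.theta t / (t * log t ^ 2)) volume a b := by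
      rw [intervalIntegrable_iff_integrableOn_Icc_of_le hab]
      exact (Chebyshev.integrableOn_theta_div_id_mul_log_sq b).mono_set (Set.Icc_subset_Icc_left ha)
    refine (i1.sub i2).congr ?_
    intro t ht
    rw [Set.uIoc_of_le hab] at ht
    have h1 : 0 < log t := log_pos (by linarith [ht.1])
    have h2 : 0 < t := by linarith [ht.1]
    simp only
    field_simp
  rw [pi_li_eq hx2, ← intervalIntegral.integral_add_adjacent_intervals (hint 2 (√x) le_rfl h3)
    (hint (√x) x h3 (by linarith))]
  have b3 : |(Chebyshev.theta x - x) / log x| ≤ 12 * D * x := by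
    rw [abs_div, abs_of_pos (by linarith : 0 < log x)]
    refine (div_le_self (abs_nonneg _) h5).trans (key x (by linarith))
  have b4 : 2 / log 2 ≤ 4 := by
    rw [div_le_iff₀ (log_pos (by norm_num))]; linarith [log_two_gt_d9]
  have b5 : 0 ≤ 2 / log 2 := div_nonneg (by norm_num) (log_nonneg (by norm_num))
  rw [abs_le] at *
  constructor <;> linarith [b1.1, b1.2, b2.1, b2.2, b3.1, b3.2]

end VK

/-- The Prime Number Theorem with Vinogradov–Korobov error term:
`|π(x) − li(x)| ≤ C x exp(−c (log x)^{3/5} (log log x)^{-1/5})`. -/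
theorem prime_counting_vinogradov_korobov :
    ∃ c C x₀ : ℝ, 0 < c ∧ 0 < C ∧ 3 ≤ x₀ ∧
      ∀ x : ℝ, x₀ ≤ x →
        |primePi x - li x| ≤
          C * x * Real.exp (-c * Real.log x ^ ((3:ℝ)/5) *
            Real.log (Real.log x) ^ (-(1:ℝ)/5)) := by
  obtain ⟨c, hc, h⟩ := VK.pi_bd
  obtain ⟨x₀, hx₀⟩ := Filter.eventually_atTop.mp h
  refine ⟨c, 100, max x₀ 3, hc, by norm_num, le_max_right _ _, fun x hx => ?_⟩
  have key := hx₀ x ((le_max_left _ _).trans hx)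
  have e1 : primePi x = (Nat.primeCounting ⌊x⌋₊ : ℝ) := by
    unfold primePi
    congr 1
    rw [Nat.primeCounting, Nat.primeCounting', Nat.count_eq_card_filter_range]
    congr 1
    ext n
    simp [Nat.lt_succ_iff]
  have e2 : -c * Real.log x ^ ((3:ℝ)/5) * Real.log (Real.log x) ^ (-(1:ℝ)/5) = -c * VK.WW x := by
    unfold VK.WW; ring
  rw [e1, e2, mul_assoc]
  exact key
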